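/- arXiv:0709.2696 — 5 statements merged into one kernel-verified Lean document; each statement's English description precedes it below -/
import Mathlib

section
/- Let G be a group with triality S = ⟨σ, ρ⟩ and let M = M(G) = {x⁻¹·x^σ : x ∈ G}. The semidirect product G₀ = G ⋊ ⟨ρ⟩, with σ and ρ acting on G₀ by extending their action on G (σ sends the generator ρ to ρ⁻¹, and ρ acts by conjugation), is a group with triality S if and only if m³ = 1 for every m ∈ M. -/
/-- The set `M(G) = {x⁻¹ · xᔆ | x ∈ G}` underlying the Moufang loop of a group with
triality `⟨ρ, σ⟩`. -/
def MSet {G : Type*} [Group G] (σ : MulAut G) : Set G := {m | ∃ x : G, m = x⁻¹ * σ x}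

/-- `G` together with the automorphisms `ρ, σ` is a group with triality `S = ⟨ρ, σ⟩`:
`ρ³ = σ² = (ρσ)² = 1` and `[x,σ]·[x,σ]ᵖ·[x,σ]ᵖ² = 1` for all `x`. -/
def IsTriality {G : Type*} [Group G] (ρ σ : MulAut G) : Prop :=
  ρ ^ 3 = 1 ∧ σ ^ 2 = 1 ∧ (ρ * σ) ^ 2 = 1 ∧
    ∀ x : G, (x⁻¹ * σ x) * ρ (x⁻¹ * σ x) * ρ (ρ (x⁻¹ * σ x)) = 1

/-- A subgroup is `S`-invariant if it is stable under `ρ` and `σ`. -/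
def SInvariant {G : Type*} [Group G] (ρ σ : MulAut G) (K : Subgroup G) : Prop :=
  (∀ x : G, ρ x ∈ K ↔ x ∈ K) ∧ ∀ x : G, σ x ∈ K ↔ x ∈ K

/-- The group `S = ⟨ρ, σ⟩` of automorphisms. -/
def STri {G : Type*} [Group G] (ρ σ : MulAut G) : Subgroup (MulAut G) :=
  Subgroup.closure {ρ, σ}

/-- `[K, S]`: the subgroup generated by all commutators `[x, α] = x⁻¹ · α x`
with `x ∈ K`, `α ∈ S`. -/
def commSG {G : Type*} [Group G] (ρ σ : MulAut G) (K : Subgroup G) : Subgroup G :=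
  Subgroup.closure {g | ∃ x ∈ K, ∃ α ∈ STri ρ σ, g = x⁻¹ * α x}

/-- The subgroup `C_G(σ)` of fixed points of `σ`. -/
def fixedSub {G : Type*} [Group G] (σ : MulAut G) : Subgroup G where
  carrier := {g | σ g = g}
  one_mem' := map_one σ
  mul_mem' := by
    intro a b ha hb
    simp only [Set.mem_setOf_eq, map_mul] at *
    rw [ha, hb]
  inv_mem' := by
    intro a ha
    simp only [Set.mem_setOf_eq, map_inv] at *
    rw [ha]

section TriExt

variable {G : Type*} [Group G]

/-- The semidirect product `G₀ = G ⋊ ⟨ρ⟩`. -/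
abbrev TriExt (ρ : MulAut G) : Type _ :=
  SemidirectProduct G ↥(Subgroup.zpowers ρ) (Subgroup.zpowers ρ).subtype

/-- The extension of `ρ` to `G₀ = G ⋊ ⟨ρ⟩`, acting by conjugation by the element `ρ`. -/
def rho0 (ρ : MulAut G) : MulAut (TriExt ρ) :=
  MulAut.conj (SemidirectProduct.inr ⟨ρ, Subgroup.mem_zpowers ρ⟩)

theorem sigma_conj_zpowers {ρ σ : MulAut G} (h : IsTriality ρ σ) :
    ∀ r ∈ Subgroup.zpowers ρ, σ * r * σ⁻¹ = r⁻¹ := by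
  obtain ⟨h3, h2, hrs, -⟩ := h
  have hbase : σ * ρ * σ⁻¹ = ρ⁻¹ := by
    have hexp : ρ * σ * (ρ * σ) = 1 := by
      have := hrs
      rwa [pow_two] at this
    have hσ : σ⁻¹ = σ := by
      rw [inv_eq_iff_mul_eq_one, ← pow_two, h2]
    rw [hσ]
    have : σ * ρ * σ = ρ⁻¹ * (ρ * σ * (ρ * σ)) * σ⁻¹ * σ := by group
    rw [this, hexp]
    group
  rintro r ⟨k, rfl⟩
  rw [← zpow_neg]
  calc σ * ρ ^ k * σ⁻¹ = (σ * ρ * σ⁻¹) ^ k := by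
        rw [conj_zpow]
    _ = ρ ^ (-k) := by rw [hbase, inv_zpow, zpow_neg]

/-- The extension of `σ` to `G₀ = G ⋊ ⟨ρ⟩`, sending the generator `ρ` to `ρ⁻¹`. -/
def sigma0 (ρ σ : MulAut G) (h : IsTriality ρ σ) : MulAut (TriExt ρ) where
  toFun x := ⟨σ x.left, x.right⁻¹⟩
  invFun x := ⟨σ x.left, x.right⁻¹⟩
  left_inv x := by
    have h2 : ∀ g : G, σ (σ g) = g := by
      intro g
      have := congrArg (fun e : MulAut G => e g) h.2.1
      simpa [pow_two] using this
    cases x with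
    | mk l r => simp [h2]
  right_inv x := by
    have h2 : ∀ g : G, σ (σ g) = g := by
      intro g
      have := congrArg (fun e : MulAut G => e g) h.2.1
      simpa [pow_two] using this
    cases x with
    | mk l r => simp [h2]
  map_mul' x y := by
    have key : ∀ r : ↥(Subgroup.zpowers ρ), ∀ g : G,
        σ ((r : MulAut G) g) = ((r⁻¹ : ↥(Subgroup.zpowers ρ)) : MulAut G) (σ g) := by
      intro r g
      have hc := sigma_conj_zpowers h (r : MulAut G) r.2
      have : σ * (r : MulAut G) = ((r : MulAut G))⁻¹ * σ := by
        rw [← hc]; group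
      calc σ ((r : MulAut G) g) = (σ * (r : MulAut G)) g := rfl
        _ = (((r : MulAut G))⁻¹ * σ) g := by rw [this]
        _ = ((r⁻¹ : ↥(Subgroup.zpowers ρ)) : MulAut G) (σ g) := rfl
    apply SemidirectProduct.ext
    · show σ (x.left * (((Subgroup.zpowers ρ).subtype x.right) y.left)) = _
      simp only [map_mul]
      rw [show ((Subgroup.zpowers ρ).subtype x.right) y.left
          = ((x.right : MulAut G)) y.left from rfl]
      rw [key x.right y.left]
      rfl
    · show (x.right * y.right)⁻¹ = x.right⁻¹ * y.right⁻¹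
      rw [mul_inv_rev]
      have : ∀ a b : ↥(Subgroup.zpowers ρ), a * b = b * a := by
        intro a b
        rcases a with ⟨_, i, rfl⟩
        rcases b with ⟨_, j, rfl⟩
        ext : 1
        show (ρ ^ i) * (ρ ^ j) = (ρ ^ j) * (ρ ^ i)
        rw [← zpow_add, ← zpow_add, add_comm]
      exact this _ _

end TriExt

section TriExt

variable {G : Type*} [Group G]

theorem rho0_apply (ρ : MulAut G) (x : TriExt ρ) : rho0 ρ x = ⟨ρ x.left, x.right⟩ := by
  apply SemidirectProduct.ext
  · simp [rho0]
  · obtain ⟨g, r, k, rfl⟩ := x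
    ext1
    simp only [rho0, MulAut.conj_apply, SemidirectProduct.mul_right, SemidirectProduct.inv_right,
      SemidirectProduct.right_inr, Subgroup.coe_mul, Subgroup.coe_inv]
    group

theorem sigma0_apply {ρ σ : MulAut G} (h : IsTriality ρ σ) (x : TriExt ρ) :
    sigma0 ρ σ h x = ⟨σ x.left, x.right⁻¹⟩ := rfl

/-- The left component of `[x, σ]·[x, σ]ᵖ·[x, σ]ᵖ²` for `x = g r` in `G ⋊ ⟨ρ⟩`. -/
theorem triality_product_left {ρ σ : MulAut G} (h : IsTriality ρ σ) (x : TriExt ρ) :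
    ((x⁻¹ * sigma0 ρ σ h x) * rho0 ρ (x⁻¹ * sigma0 ρ σ h x) *
        rho0 ρ (rho0 ρ (x⁻¹ * sigma0 ρ σ h x))).left =
      (x.right : MulAut G)⁻¹ (x.left⁻¹ * σ x.left) *
      ((x.right : MulAut G) ^ (-3 : ℤ) * ρ) (x.left⁻¹ * σ x.left) *
      ((x.right : MulAut G) ^ (-5 : ℤ) * ρ ^ 2) (x.left⁻¹ * σ x.left) := by
  obtain ⟨g, r⟩ := x
  have h3 : (r : MulAut G) ^ (-3 : ℤ) =
    (r : MulAut G)⁻¹ * (r : MulAut G)⁻¹ * (r : MulAut G)⁻¹ := by group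
  have h5 : (r : MulAut G) ^ (-5 : ℤ) = (r : MulAut G)⁻¹ * (r : MulAut G)⁻¹ *
    ((r : MulAut G)⁻¹ * (r : MulAut G)⁻¹ * (r : MulAut G)⁻¹) := by group
  simp only [h3, h5, pow_two, rho0_apply, sigma0_apply, SemidirectProduct.mul_left,
    SemidirectProduct.mul_right, SemidirectProduct.inv_left, SemidirectProduct.inv_right,
    Subgroup.coe_subtype, MulAut.mul_apply, map_mul, map_inv]

theorem triality_product_right {ρ σ : MulAut G} (h : IsTriality ρ σ) (x : TriExt ρ) :
    ((x⁻¹ * sigma0 ρ σ h x) * rho0 ρ (x⁻¹ * sigma0 ρ σ h x) *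
        rho0 ρ (rho0 ρ (x⁻¹ * sigma0 ρ σ h x))).right = 1 := by
  obtain ⟨g, r, k, rfl⟩ := x
  ext1
  simp only [rho0_apply, sigma0_apply, SemidirectProduct.mul_right, SemidirectProduct.inv_right,
    Subgroup.coe_mul, Subgroup.coe_inv, Subgroup.coe_one]
  have : (ρ ^ 3) ^ (-2 * k) = 1 := by rw [h.1, one_zpow]
  rw [← this]
  group

theorem eq_one_or_eq_or_eq_sq_of_mem_zpowers {H : Type*} [Group H] {a r : H} (ha : a ^ 3 = 1)
    (hr : r ∈ Subgroup.zpowers a) : r = 1 ∨ r = a ∨ r = a ^ 2 := by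
  obtain ⟨k, rfl⟩ := hr
  have hk : a ^ k = a ^ (k % 3) := by
    conv_lhs => rw [← Int.mul_ediv_add_emod k 3]
    rw [zpow_add, zpow_mul, show a ^ (3 : ℤ) = 1 from mod_cast ha, one_zpow, one_mul]
  obtain h | h | h : k % 3 = 0 ∨ k % 3 = 1 ∨ k % 3 = 2 := by omega
  · left; simp [hk, h]
  · right; left; simp [hk, h]
  · right; right; simp only [hk, h]; norm_cast

theorem IsTriality.mul_rho_sq_mul_rho {ρ σ : MulAut G} (h : IsTriality ρ σ) (x : G) :
    (x⁻¹ * σ x) * ρ (ρ (x⁻¹ * σ x)) * ρ (x⁻¹ * σ x) = 1 := by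
  have hσ : σ (σ x) = x := by
    rw [← MulAut.mul_apply, ← pow_two, h.2.1, MulAut.one_apply]
  have hm := h.2.2.2 (σ x)
  rw [hσ, show (σ x)⁻¹ * x = (x⁻¹ * σ x)⁻¹ by group] at hm
  generalize x⁻¹ * σ x = m at hm ⊢
  simp only [map_inv] at hm
  have hm' : ρ (ρ m) * ρ m * m = 1 := by
    rw [← inv_eq_one, ← hm]
    group
  rw [mul_assoc]
  exact mul_eq_one_comm.mp hm'

theorem rho0_pow_three {ρ σ : MulAut G} (h : IsTriality ρ σ) : rho0 ρ ^ 3 = 1 := by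
  rw [rho0, ← map_pow, ← map_pow, show (⟨ρ, Subgroup.mem_zpowers ρ⟩ : Subgroup.zpowers ρ) ^ 3 = 1
    from Subtype.ext h.1, map_one, map_one]

theorem sigma0_sq {ρ σ : MulAut G} (h : IsTriality ρ σ) : sigma0 ρ σ h ^ 2 = 1 := by
  ext x : 1
  have hσ (g : G) : σ (σ g) = g := by
    rw [← MulAut.mul_apply, ← pow_two, h.2.1, MulAut.one_apply]
  simp [pow_two, sigma0_apply, hσ]

theorem rho0_mul_sigma0_sq {ρ σ : MulAut G} (h : IsTriality ρ σ) :
    (rho0 ρ * sigma0 ρ σ h) ^ 2 = 1 := by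
  ext x : 1
  have hρσ (g : G) : ρ (σ (ρ (σ g))) = g := by
    simpa [pow_two] using DFunLike.congr_fun h.2.2.1 g
  simp [pow_two, rho0_apply, sigma0_apply, hρσ]

end TriExt

/-- `G ⋊ ⟨ρ⟩`, with `ρ` acting by conjugation and `σ` sending the generator `ρ` to `ρ⁻¹`,
is a group with triality `⟨ρ, σ⟩` if and only if `m³ = 1` for every `m ∈ M(G)`. -/
theorem triality_of_extension_iff_exponent_three {G : Type} [Group G] (ρ σ : MulAut G)
    (h : IsTriality ρ σ) :
    IsTriality (rho0 ρ) (sigma0 ρ σ h) ↔ ∀ m ∈ MSet σ, m ^ 3 = 1 := by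
  have h3 : ρ ^ (3 : ℤ) = 1 := mod_cast h.1
  have e1 : (ρ ^ 2)⁻¹ = ρ := by
    rw [inv_eq_iff_mul_eq_one, ← pow_succ, h.1]
  have e2 : (ρ ^ 2) ^ (-3 : ℤ) * ρ = ρ := by
    calc _ = (ρ ^ (3 : ℤ)) ^ (-2 : ℤ) * ρ := by group
      _ = ρ := by simp [h3]
  have e4 : (ρ ^ 2) ^ (-5 : ℤ) * ρ ^ 2 = ρ := by
    calc _ = (ρ ^ (3 : ℤ)) ^ (-3 : ℤ) * ρ := by group
      _ = ρ := by simp [h3]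
  have cube (g : G) : ρ g * ρ g * ρ g = 1 ↔ g ^ 3 = 1 := by
    rw [← map_mul, ← map_mul, map_eq_one_iff ρ ρ.injective, pow_succ, pow_two]
  constructor
  · rintro ⟨-, -, -, ht⟩ _ ⟨g, rfl⟩
    have hl := triality_product_left h
      ⟨g, ⟨ρ ^ 2, pow_mem (Subgroup.mem_zpowers ρ) 2⟩⟩
    rw [ht, SemidirectProduct.one_left] at hl
    simp only [e2, e4] at hl
    rw [e1] at hl
    exact (cube _).mp hl.symm
  · intro hM
    refine ⟨rho0_pow_three h, sigma0_sq h, rho0_mul_sigma0_sq h, fun x ↦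
      SemidirectProduct.ext ?_ (triality_product_right h x)⟩
    rw [triality_product_left, SemidirectProduct.one_left]
    obtain hr | hr | hr := eq_one_or_eq_or_eq_sq_of_mem_zpowers h.1 x.right.2
    · rw [hr]
      simpa [pow_two] using h.2.2.2 x.left
    · have f2 : ρ ^ (-3 : ℤ) * ρ = ρ⁻¹ * (ρ * ρ) := by
        calc _ = (ρ ^ (3 : ℤ)) ^ (-1 : ℤ) * ρ := by group
          _ = ρ := by simp [h3]
          _ = _ := by group
      have f4 : ρ ^ (-5 : ℤ) * ρ ^ 2 = ρ⁻¹ * ρ := by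
        calc _ = (ρ ^ (3 : ℤ)) ^ (-1 : ℤ) := by group
          _ = ρ⁻¹ * ρ := by simp [h3]
      rw [hr, f2, f4]
      simp only [MulAut.mul_apply _ ρ⁻¹]
      rw [← map_mul, ← map_mul, MulAut.mul_apply, h.mul_rho_sq_mul_rho, map_one]
    · rw [hr, e2, e4, e1]
      exact (cube _).mpr (hM _ ⟨x.left, rfl⟩)
end

section
/- Let G be a group with triality S = ⟨σ, ρ⟩ and let M = M(G) = {x⁻¹·x^σ : x ∈ G}. Then for every m ∈ M, the three elements m, m^ρ, m^{ρ²} of G pairwise commute; and for all m, n ∈ M one has m^{−ρ}·n·m^{−ρ²} = n^{−ρ²}·m·n^{−ρ}. -/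
namespace IsTriality

variable {G : Type*} [Group G] {ρ σ : MulAut G} {m n : G}

theorem rho_rho_rho (h : IsTriality ρ σ) (x : G) : ρ (ρ (ρ x)) = x := by
  simpa [pow_succ] using DFunLike.congr_fun h.1 x

theorem sigma_sigma (h : IsTriality ρ σ) (x : G) : σ (σ x) = x := by
  simpa [pow_succ] using DFunLike.congr_fun h.2.1 x

theorem sigma_rho (h : IsTriality ρ σ) (x : G) : σ (ρ x) = ρ (ρ (σ x)) := by
  have key : ρ (σ (ρ (σ (σ x)))) = σ x := by
    simpa [pow_succ] using DFunLike.congr_fun h.2.2.1 (σ x)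
  rw [h.sigma_sigma] at key
  rw [← key, h.rho_rho_rho]

theorem sigma_eq_inv (h : IsTriality ρ σ) (hm : m ∈ MSet σ) : σ m = m⁻¹ := by
  obtain ⟨x, rfl⟩ := hm
  simp [h.sigma_sigma]

theorem inv_mem (h : IsTriality ρ σ) (hm : m ∈ MSet σ) : m⁻¹ ∈ MSet σ := by
  obtain ⟨x, rfl⟩ := hm
  exact ⟨σ x, by simp [h.sigma_sigma]⟩

theorem mul_rho_mul_rho_rho (h : IsTriality ρ σ) (hm : m ∈ MSet σ) :
    m * ρ m * ρ (ρ m) = 1 := by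
  obtain ⟨x, rfl⟩ := hm
  exact h.2.2.2 x

theorem commute_rho (h : IsTriality ρ σ) (hm : m ∈ MSet σ) : Commute m (ρ m) := by
  have h₁ := eq_inv_of_mul_eq_one_left (h.mul_rho_mul_rho_rho hm)
  have h₂ := eq_inv_of_mul_eq_one_left (h.mul_rho_mul_rho_rho (h.inv_mem hm))
  rw [map_inv, map_inv, inv_inv, ← mul_inv_rev] at h₂
  exact h₁.trans (by rw [← h₂, inv_inv])

theorem inv_mul_mul_sigma_mem (hn : n ∈ MSet σ) (g : G) : g⁻¹ * n * σ g ∈ MSet σ := by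
  obtain ⟨x, rfl⟩ := hn
  exact ⟨x * g, by simp [mul_assoc]⟩

theorem rho_rho_mul_mul_rho_mem (h : IsTriality ρ σ) (hm : m ∈ MSet σ) (hn : n ∈ MSet σ) :
    ρ (ρ m) * n * ρ m ∈ MSet σ := by
  simpa [h.sigma_rho, h.sigma_eq_inv hm, h.rho_rho_rho] using
    inv_mul_mul_sigma_mem hn (ρ (ρ m))⁻¹

end IsTriality

/-- In a group with triality `⟨ρ, σ⟩`, for `m, n ∈ M(G)` the elements `m, mᵖ, mᵖ²`
pairwise commute and `m⁻ᵖ · n · m⁻ᵖ² = n⁻ᵖ² · m · n⁻ᵖ`. -/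
theorem triality_loop_identities {G : Type} [Group G] (ρ σ : MulAut G)
    (h : IsTriality ρ σ) {m n : G} (hm : m ∈ MSet σ) (hn : n ∈ MSet σ) :
    (Commute m (ρ m) ∧ Commute m (ρ (ρ m)) ∧ Commute (ρ m) (ρ (ρ m))) ∧
      ρ m⁻¹ * n * ρ (ρ m⁻¹) = ρ (ρ n⁻¹) * m * ρ n⁻¹ := by
  have h_comm₀ := h.commute_rho hm
  have h_comm₁ : Commute (ρ m) (ρ (ρ m)) := h_comm₀.map ρ
  have h_comm₂ : Commute m (ρ (ρ m)) := by
    simpa only [h.rho_rho_rho] using (h_comm₁.map ρ).symm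
  refine ⟨⟨h_comm₀, h_comm₂, h_comm₁⟩, ?_⟩
  have key := h.mul_rho_mul_rho_rho (h.rho_rho_mul_mul_rho_mem hm hn)
  simp only [map_mul, map_inv, h.rho_rho_rho] at key ⊢
  have h_prod := h.mul_rho_mul_rho_rho hm
  have h_inv : (ρ m)⁻¹ * (ρ (ρ m))⁻¹ = m := by
    rw [← mul_inv_rev, ← h_comm₁.eq, ← eq_inv_of_mul_eq_one_left (by rwa [← mul_assoc])]
  have h_n : n = (ρ (ρ m))⁻¹ * (m⁻¹ * (ρ (ρ n))⁻¹ * (ρ m)⁻¹) *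
      ((ρ (ρ m))⁻¹ * (ρ n)⁻¹ * m⁻¹) * (ρ m)⁻¹ := by
    have h_inv_eq := eq_inv_of_mul_eq_one_left key
    simp only [mul_inv_rev, ← mul_assoc] at h_inv_eq ⊢
    rw [mul_assoc (ρ (ρ m))⁻¹, mul_assoc (ρ (ρ m))⁻¹, ← h_inv_eq]
    group
  calc (ρ m)⁻¹ * n * (ρ (ρ m))⁻¹
      = ((ρ m)⁻¹ * (ρ (ρ m))⁻¹) * m⁻¹ * (ρ (ρ n))⁻¹ * ((ρ m)⁻¹ * (ρ (ρ m))⁻¹) * (ρ n)⁻¹ *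
          (m⁻¹ * ((ρ m)⁻¹ * (ρ (ρ m))⁻¹)) := by
        conv_lhs => rw [h_n]
        simp only [mul_assoc]
    _ = (ρ (ρ n))⁻¹ * m * (ρ n)⁻¹ := by
        rw [h_inv]
        group
end

section
/- Let G be a group with triality S = ⟨ρ, σ⟩ and let M = M(G) = {[g,σ] : g ∈ G} be the corresponding Moufang loop, regarded as a subset of G. Then for every subloop P of M, the subgroup Q = ⟨P ∪ P^ρ⟩ of G is S-invariant, satisfies M(Q) = {[x,σ] : x ∈ Q} = P, and [Q, S] = Q. -/
section Triality

variable {G : Type*} [Group G] {ρ σ : MulAut G}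

theorem IsTriality.rho_rho_rho_s8 (h : IsTriality ρ σ) (x : G) : ρ (ρ (ρ x)) = x := by
  simpa [pow_succ] using DFunLike.congr_fun h.1 x

theorem IsTriality.sigma_sigma_s8 (h : IsTriality ρ σ) (x : G) : σ (σ x) = x := by
  simpa [pow_succ] using DFunLike.congr_fun h.2.1 x

theorem IsTriality.rho_sigma_rho_sigma (h : IsTriality ρ σ) (x : G) :
    ρ (σ (ρ (σ x))) = x := by
  simpa [pow_succ] using DFunLike.congr_fun h.2.2.1 x

theorem IsTriality.sigma_rho_s8 (h : IsTriality ρ σ) (x : G) : σ (ρ x) = ρ (ρ (σ x)) := by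
  have h1 := h.rho_sigma_rho_sigma (σ x)
  rw [h.sigma_sigma_s8] at h1
  rw [← h.rho_rho_rho_s8 (σ (ρ x)), h1]

theorem IsTriality.sigma_eq_inv_s8 (h : IsTriality ρ σ) {m : G} (hm : m ∈ MSet σ) :
    σ m = m⁻¹ := by
  obtain ⟨x, rfl⟩ := hm
  simp [h.sigma_sigma_s8]

theorem IsTriality.inv_mem_MSet (h : IsTriality ρ σ) {m : G} (hm : m ∈ MSet σ) :
    m⁻¹ ∈ MSet σ := by
  obtain ⟨x, rfl⟩ := hm
  exact ⟨σ x, by simp [h.sigma_sigma_s8]⟩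

theorem IsTriality.mul_rho_mul_rho_rho_s8 (h : IsTriality ρ σ) {m : G} (hm : m ∈ MSet σ) :
    m * ρ m * ρ (ρ m) = 1 := by
  obtain ⟨x, rfl⟩ := hm
  exact h.2.2.2 x

theorem IsTriality.rho_rho_eq (h : IsTriality ρ σ) {m : G} (hm : m ∈ MSet σ) :
    ρ (ρ m) = (ρ m)⁻¹ * m⁻¹ := by
  have h1 := h.mul_rho_mul_rho_rho_s8 hm
  rw [← mul_inv_rev]
  exact eq_inv_of_mul_eq_one_right h1

theorem IsTriality.commute_rho_s8 (h : IsTriality ρ σ) {m : G} (hm : m ∈ MSet σ) :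
    m * ρ m = ρ m * m := by
  have h1 := h.rho_rho_eq hm
  have h2 := h.rho_rho_eq (h.inv_mem_MSet hm)
  simp only [map_inv, inv_inv] at h2
  rw [← h2, h1]
  group

theorem IsTriality.sigma_rho_eq (h : IsTriality ρ σ) {m : G} (hm : m ∈ MSet σ) :
    σ (ρ m) = (ρ (ρ m))⁻¹ := by
  rw [h.sigma_rho_s8, h.sigma_eq_inv_s8 hm, map_inv, map_inv]

theorem IsTriality.mul_mem_MSet (h : IsTriality ρ σ) {m n : G} (hm : m ∈ MSet σ)
    (hn : n ∈ MSet σ) : (ρ m)⁻¹ * n * (ρ (ρ m))⁻¹ ∈ MSet σ := by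
  obtain ⟨y, rfl⟩ := hn
  exact ⟨y * ρ m, by rw [map_mul, h.sigma_rho_eq hm]; group⟩

/-- The two expressions for the product `m.n` of the Moufang loop. -/
theorem IsTriality.loop_mul_eq (h : IsTriality ρ σ) {m n : G} (hm : m ∈ MSet σ)
    (hn : n ∈ MSet σ) :
    (ρ m)⁻¹ * n * (ρ (ρ m))⁻¹ = (ρ (ρ n))⁻¹ * m * (ρ n)⁻¹ := by
  have hk := h.rho_rho_eq (h.inv_mem_MSet (h.mul_mem_MSet hm (h.inv_mem_MSet hn)))
  have hc := h.commute_rho_s8 hm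
  have h3 := h.rho_rho_eq hm
  simp only [map_mul, h.rho_rho_rho_s8, inv_inv, mul_inv_rev] at hk
  simp only [h3, mul_inv_rev, inv_inv] at hk
  have h1 : (ρ m)⁻¹ * (m * ρ m) = m := by rw [hc, inv_mul_cancel_left]
  have h2 : m * ρ m * m⁻¹ = ρ m := by rw [hc, mul_inv_cancel_right]
  have h4 : m⁻¹ * (ρ m)⁻¹ = (ρ m)⁻¹ * m⁻¹ := by rw [← mul_inv_rev, ← mul_inv_rev, hc]
  have hn3 : ρ (ρ n) = m * (ρ n)⁻¹ * ((ρ m)⁻¹ * m⁻¹) * n⁻¹ * ρ m := by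
    calc ρ (ρ n) = (ρ m)⁻¹ * (ρ m * (ρ (ρ n) * m)) * m⁻¹ := by group
      _ = (ρ m)⁻¹ * (m * ρ m) * (ρ n)⁻¹ * (m⁻¹ * (ρ m)⁻¹) * n⁻¹ * (m * ρ m * m⁻¹) := by
        rw [hk]
        group
      _ = m * (ρ n)⁻¹ * ((ρ m)⁻¹ * m⁻¹) * n⁻¹ * ρ m := by rw [h1, h2, h4]
  rw [hn3, h3]
  group

end Triality

/-- For every subloop `P` of the Moufang loop `M(G)` of a group with triality `G`,
the subgroup `Q = ⟨P ∪ Pᵖ⟩` is `S`-invariant, satisfies `M(Q) = P` and `[Q, S] = Q`. -/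
theorem subloop_generated_subgroup {G : Type} [Group G] (ρ σ : MulAut G)
    (h : IsTriality ρ σ) (P : Set G) (hPM : P ⊆ MSet σ) (h1P : (1 : G) ∈ P)
    (hPmul : ∀ m ∈ P, ∀ n ∈ P, ρ m⁻¹ * n * ρ (ρ m⁻¹) ∈ P)
    (hPinv : ∀ m ∈ P, m⁻¹ ∈ P) :
    SInvariant ρ σ (Subgroup.closure (P ∪ ⇑ρ '' P)) ∧
      {g : G | ∃ x ∈ Subgroup.closure (P ∪ ⇑ρ '' P), g = x⁻¹ * σ x} = P ∧
      commSG ρ σ (Subgroup.closure (P ∪ ⇑ρ '' P)) = Subgroup.closure (P ∪ ⇑ρ '' P) := by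
  have hmul : ∀ m ∈ P, ∀ n ∈ P, (ρ m)⁻¹ * n * (ρ (ρ m))⁻¹ ∈ P := by
    simpa only [map_inv] using hPmul
  have hmul' : ∀ m ∈ P, ∀ n ∈ P, (ρ (ρ m))⁻¹ * n * (ρ m)⁻¹ ∈ P := fun m hm n hn => by
    rw [← h.loop_mul_eq (hPM hn) (hPM hm)]
    exact hmul n hn m hm
  set Q := Subgroup.closure (P ∪ ⇑ρ '' P) with hQ
  have hP : ∀ m ∈ P, m ∈ Q := fun m hm => Subgroup.subset_closure (Or.inl hm)
  have hρP : ∀ m ∈ P, ρ m ∈ Q := fun m hm => Subgroup.subset_closure (Or.inr ⟨m, hm, rfl⟩)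
  have hρρP : ∀ m ∈ P, ρ (ρ m) ∈ Q := fun m hm => by
    rw [h.rho_rho_eq (hPM hm)]
    exact Q.mul_mem (Q.inv_mem (hρP m hm)) (Q.inv_mem (hP m hm))
  have hρQ : ∀ x ∈ Q, ρ x ∈ Q := by
    have : Q ≤ Q.comap (ρ : G →* G) := by
      rw [hQ, Subgroup.closure_le, ← hQ]
      rintro _ (hm | ⟨m, hm, rfl⟩)
      · exact hρP _ hm
      · exact hρρP _ hm
    exact this
  have hσQ : ∀ x ∈ Q, σ x ∈ Q := by
    have : Q ≤ Q.comap (σ : G →* G) := by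
      rw [hQ, Subgroup.closure_le, ← hQ]
      rintro _ (hm | ⟨m, hm, rfl⟩)
      · change σ _ ∈ Q
        rw [h.sigma_eq_inv_s8 (hPM hm)]
        exact Q.inv_mem (hP _ hm)
      · change σ _ ∈ Q
        rw [h.sigma_rho_eq (hPM hm)]
        exact Q.inv_mem (hρρP _ hm)
    exact this
  have hinv : SInvariant ρ σ Q := by
    refine ⟨fun x => ⟨fun hx => ?_, hρQ x⟩, fun x => ⟨fun hx => ?_, hσQ x⟩⟩
    · rw [← h.rho_rho_rho_s8 x]
      exact hρQ _ (hρQ _ hx)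
    · rw [← h.sigma_sigma_s8 x]
      exact hσQ _ hx
  have hcomm : ∀ m ∈ P, m = (ρ m)⁻¹ * σ (ρ m) := fun m hm => by
    rw [h.sigma_rho_eq (hPM hm), h.rho_rho_eq (hPM hm), mul_inv_rev, inv_inv, inv_inv,
      h.commute_rho_s8 (hPM hm), inv_mul_cancel_left]
  have hgen : ∀ g ∈ P ∪ ⇑ρ '' P, ∀ p ∈ P, g⁻¹ * p * σ g ∈ P := by
    rintro g (hm | ⟨m, hm, rfl⟩) p hp
    · have h1 := hmul' _ (hPinv _ hm) _ (hmul _ (hPinv _ hm) _ hp)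
      convert h1 using 1
      rw [h.sigma_eq_inv_s8 (hPM hm)]
      simp only [map_inv, inv_inv, h.rho_rho_eq (hPM hm)]
      have hc := h.commute_rho_s8 (hPM hm)
      have hc' : (ρ g)⁻¹ * g⁻¹ = g⁻¹ * (ρ g)⁻¹ := by
        rw [← mul_inv_rev, ← mul_inv_rev, hc]
      rw [hc']
      simp only [mul_assoc, inv_mul_cancel_left, inv_mul_cancel, mul_one]
    · rw [h.sigma_rho_eq (hPM hm)]
      exact hmul m hm p hp
  have hact : ∀ x ∈ Q, ∀ p ∈ P, x⁻¹ * p * σ x ∈ P := by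
    intro x hx
    induction hx using Subgroup.closure_induction'' with
    | one => intro p hp; simpa using hp
    | mem g hg => exact hgen g hg
    | inv_mem g hg =>
      refine hgen _ ?_
      rcases hg with hm | ⟨m, hm, rfl⟩
      · exact Or.inl (hPinv _ hm)
      · exact Or.inr ⟨m⁻¹, hPinv m hm, map_inv ρ m⟩
    | mul x y _ _ ihx ihy =>
      intro p hp
      have := ihy _ (ihx p hp)
      simpa only [mul_inv_rev, map_mul, mul_assoc] using this
  refine ⟨hinv, Set.Subset.antisymm ?_ fun m hm => ⟨ρ m, hρP m hm, hcomm m hm⟩,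
    le_antisymm ?_ ?_⟩
  · rintro _ ⟨x, hx, rfl⟩
    simpa using hact x hx 1 h1P
  · have hS : ∀ α ∈ STri ρ σ, ∀ x, α x ∈ Q ↔ x ∈ Q := by
      intro α hα
      induction hα using Subgroup.closure_induction with
      | mem α hα =>
        rcases hα with rfl | rfl
        · exact hinv.1
        · exact hinv.2
      | one => exact fun x => Iff.rfl
      | mul α β _ _ iα iβ => exact fun x => (iα (β x)).trans (iβ x)
      | inv α _ iα => exact fun x => by rw [← iα (α⁻¹ x), MulAut.apply_inv_self]
    rw [commSG, Subgroup.closure_le]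
    rintro _ ⟨x, hx, α, hα, rfl⟩
    exact Q.mul_mem (Q.inv_mem hx) ((hS α hα x).2 hx)
  · have hPC : ∀ m ∈ P, m ∈ commSG ρ σ Q := fun m hm =>
      Subgroup.subset_closure ⟨ρ m, hρP m hm, σ, Subgroup.subset_closure (by simp), hcomm m hm⟩
    conv_lhs => rw [hQ]
    rw [Subgroup.closure_le]
    rintro _ (hm | ⟨m, hm, rfl⟩)
    · exact hPC _ hm
    · have h1 : m⁻¹ * ρ m ∈ commSG ρ σ Q :=
        Subgroup.subset_closure ⟨m, hP m hm, ρ, Subgroup.subset_closure (by simp), rfl⟩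
      have h2 := (commSG ρ σ Q).mul_mem (hPC m hm) h1
      rwa [mul_inv_cancel_left] at h2
end

section
/- Let p be a prime and let G be a group with triality S = ⟨ρ, σ⟩ such that the Moufang loop M(G) is a finite p-loop (every element of M(G) has p-power order, equivalently |M(G)| is a power of p) and [G, S] = G. Then G is a finite p-group. -/
open scoped Pointwise

section General

variable {Γ : Type*} [Group Γ] {p : ℕ}

/-- The set of conjugates of `x` by elements of `T`. -/
def conjOrbit (T : Subgroup Γ) (x : Γ) : Set Γ := {y | ∃ g ∈ T, g * x * g⁻¹ = y}

theorem mem_conjOrbit_self (T : Subgroup Γ) (x : Γ) : x ∈ conjOrbit T x :=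
  ⟨1, T.one_mem, by group⟩

theorem conj_mem_conjOrbit {T : Subgroup Γ} {x y g : Γ} (hg : g ∈ T) (hy : y ∈ conjOrbit T x) :
    g * y * g⁻¹ ∈ conjOrbit T x := by
  obtain ⟨h, hh, rfl⟩ := hy
  exact ⟨g * h, T.mul_mem hg hh, by group⟩

theorem conjOrbit_eq_of_mem {T : Subgroup Γ} {x y : Γ} (hy : y ∈ conjOrbit T x) :
    conjOrbit T y = conjOrbit T x := by
  obtain ⟨h, hh, rfl⟩ := hy
  ext z
  constructor
  · rintro ⟨g, hg, rfl⟩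
    exact ⟨g * h, T.mul_mem hg hh, by group⟩
  · rintro ⟨g, hg, rfl⟩
    exact ⟨g * h⁻¹, T.mul_mem hg (T.inv_mem hh), by group⟩

theorem conjOrbit_mono {T T' : Subgroup Γ} (h : T' ≤ T) (x : Γ) :
    conjOrbit T' x ⊆ conjOrbit T x := by
  rintro y ⟨g, hg, rfl⟩
  exact ⟨g, h hg, rfl⟩

theorem mem_centralizer_singleton {x g : Γ} :
    g ∈ Subgroup.centralizer ({x} : Set Γ) ↔ g * x * g⁻¹ = x := by
  rw [Subgroup.mem_centralizer_singleton_iff, mul_inv_eq_iff_eq_mul]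

theorem card_conjOrbit_mul [Finite Γ] (T : Subgroup Γ) (x : Γ) :
    Nat.card (conjOrbit T x) * Nat.card (T ⊓ Subgroup.centralizer {x} : Subgroup Γ) =
      Nat.card T := by
  let _ : MulAction T Γ := MulAction.compHom Γ ((MulAut.conj (G := Γ)).comp T.subtype)
  have hsmul : ∀ (g : T) (y : Γ), g • y = (g : Γ) * y * (g : Γ)⁻¹ := fun g y => rfl
  have h1 : conjOrbit T x = MulAction.orbit T x := by
    ext y
    simp only [conjOrbit, Set.mem_ofPred_eq, MulAction.mem_orbit_iff, hsmul, Subtype.exists,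
      exists_prop]
  have h2 : (MulAction.stabilizer T x).map T.subtype = T ⊓ Subgroup.centralizer {x} := by
    ext g
    simp only [Subgroup.mem_map, MulAction.mem_stabilizer_iff, hsmul, Subgroup.mem_inf,
      mem_centralizer_singleton, Subgroup.subtype_apply]
    constructor
    · rintro ⟨a, ha, rfl⟩
      exact ⟨a.2, ha⟩
    · rintro ⟨ha, hb⟩
      exact ⟨⟨g, ha⟩, hb, rfl⟩
  rw [h1, ← h2, Subgroup.card_map_of_injective T.subtype_injective,
    ← Subgroup.card_mul_index (MulAction.stabilizer T x), MulAction.index_stabilizer,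
    Nat.card_coe_set_eq, mul_comm]

theorem card_conj_fixed_modEq [Finite Γ] [Fact p.Prime] {Q : Subgroup Γ} (hQ : IsPGroup p Q)
    (X : Set Γ) (hX : ∀ g ∈ Q, ∀ x ∈ X, g * x * g⁻¹ ∈ X) :
    Nat.card X ≡ Nat.card (X ∩ {x | ∀ g ∈ Q, g * x * g⁻¹ = x} : Set Γ) [MOD p] := by
  let _ : MulAction Q X :=
    { smul := fun g x => ⟨g * x * (g : Γ)⁻¹, hX g g.2 x x.2⟩
      one_smul := fun x => Subtype.ext (by change ((1 : Q) : Γ) * x * ((1 : Q) : Γ)⁻¹ = x; simp)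
      mul_smul := fun g h x => Subtype.ext (by
        change ((g * h : Q) : Γ) * x * ((g * h : Q) : Γ)⁻¹ = g * (h * x * (h : Γ)⁻¹) * (g : Γ)⁻¹
        push_cast
        group) }
  have hsmul : ∀ (g : Q) (x : X), ((g • x : X) : Γ) = g * x * (g : Γ)⁻¹ := fun g x => rfl
  have h := hQ.card_modEq_card_fixedPoints X
  have e : Nat.card (MulAction.fixedPoints Q X) =
      Nat.card (X ∩ {x | ∀ g ∈ Q, g * x * g⁻¹ = x} : Set Γ) := by
    refine Nat.card_congr
      { toFun := fun x => ⟨x.1.1, x.1.2, fun g hg => ?_⟩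
        invFun := fun x => ⟨⟨x.1, x.2.1⟩, fun g => Subtype.ext (x.2.2 g g.2)⟩
        left_inv := fun x => rfl
        right_inv := fun x => rfl }
    exact congrArg Subtype.val (x.2 ⟨g, hg⟩)
  rwa [e] at h

theorem isPGroup_subgroup_iff {H : Subgroup Γ} :
    IsPGroup p H ↔ ∀ x ∈ H, ∃ k : ℕ, x ^ p ^ k = 1 := by
  constructor
  · intro h x hx
    obtain ⟨k, hk⟩ := h ⟨x, hx⟩
    exact ⟨k, congrArg Subtype.val hk⟩
  · rintro h ⟨x, hx⟩
    obtain ⟨k, hk⟩ := h x hx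
    exact ⟨k, Subtype.ext hk⟩

theorem isPGroup_zpowers {x : Γ} {k : ℕ} (h : x ^ p ^ k = 1) :
    IsPGroup p (Subgroup.zpowers x) := by
  rw [isPGroup_subgroup_iff]
  rintro _ ⟨n, rfl⟩
  refine ⟨k, ?_⟩
  simp only
  rw [← zpow_natCast, ← zpow_mul, mul_comm, zpow_mul, zpow_natCast, h, one_zpow]

theorem pow_pow_eq_one_of_le {x : Γ} {k l : ℕ} (h : x ^ p ^ k = 1) (hkl : k ≤ l) :
    x ^ p ^ l = 1 := by
  obtain ⟨m, rfl⟩ := Nat.exists_eq_add_of_le hkl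
  rw [pow_add, pow_mul, h, one_pow]

theorem le_normalizer_iff {H K : Subgroup Γ} :
    H ≤ Subgroup.normalizer (K : Set Γ) ↔ ∀ g ∈ H, ∀ x ∈ K, g * x * g⁻¹ ∈ K := by
  constructor
  · intro h g hg x hx
    exact (Subgroup.mem_normalizer_iff.1 (h hg) x).1 hx
  · intro h g hg
    rw [Subgroup.mem_normalizer_iff]
    intro x
    refine ⟨h g hg x, fun hx => ?_⟩
    have := h g⁻¹ (H.inv_mem hg) _ hx
    simpa [mul_assoc] using this

theorem IsPGroup.sup_of_conj {H K : Subgroup Γ} (hH : IsPGroup p H)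
    (hK : IsPGroup p K) (h : ∀ g ∈ H, ∀ x ∈ K, g * x * g⁻¹ ∈ K) :
    IsPGroup p (H ⊔ K : Subgroup Γ) :=
  IsPGroup.to_sup_of_normal_right' hH hK (le_normalizer_iff.2 h)

/-- A subgroup generated by `S` is stable under conjugation by `g` if `S` is. -/
theorem conj_mem_closure {S : Set Γ} {K : Subgroup Γ} {g : Γ}
    (h : ∀ s ∈ S, g * s * g⁻¹ ∈ K) : ∀ x ∈ Subgroup.closure S, g * x * g⁻¹ ∈ K := by
  intro x hx
  have : Subgroup.closure S ≤ K.comap (MulAut.conj g).toMonoidHom := by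
    rw [Subgroup.closure_le]
    intro s hs
    simpa using h s hs
  simpa using this hx

/-- A finite subgroup `K` is stable under conjugation by `closure S` if it is stable
under conjugation by `S`. -/
theorem conj_mem_of_closure {S : Set Γ} {K : Subgroup Γ} [Finite K]
    (h : ∀ s ∈ S, ∀ x ∈ K, s * x * s⁻¹ ∈ K) :
    ∀ g ∈ Subgroup.closure S, ∀ x ∈ K, g * x * g⁻¹ ∈ K := by
  rw [← le_normalizer_iff, Subgroup.closure_le]
  intro s hs
  rw [SetLike.mem_coe, Subgroup.mem_normalizer_iff]
  intro x
  refine ⟨h s hs x, fun hx => ?_⟩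
  have hinj : Function.Injective (fun x : K => (⟨s * x * s⁻¹, h s hs x x.2⟩ : K)) := by
    intro a b hab
    simpa using congrArg Subtype.val hab
  obtain ⟨y, hy⟩ := (Finite.injective_iff_surjective.1 hinj) ⟨_, hx⟩
  have hy' : s * (y : Γ) * s⁻¹ = s * x * s⁻¹ := congrArg Subtype.val hy
  have : (y : Γ) = x := by simpa using hy'
  exact this ▸ y.2

end General

section PGroups

variable {Γ : Type*} [Group Γ] {p : ℕ}

theorem IsPGroup.exists_mem_normalizer [Finite Γ] [Fact p.Prime] {P K : Subgroup Γ}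
    (hP : IsPGroup p P) (hK : K < P) :
    ∃ g ∈ P, g ∉ K ∧ ∀ x ∈ K, g * x * g⁻¹ ∈ K := by
  have := hP.isNilpotent
  have hlt : K.subgroupOf P < ⊤ := by
    rw [lt_top_iff_ne_top, Ne, Subgroup.subgroupOf_eq_top]
    exact not_le_of_gt hK
  have hn := Group.normalizerCondition_of_isNilpotent (G := P) _ hlt
  obtain ⟨g, hg, hg'⟩ := SetLike.exists_of_lt hn
  refine ⟨g, g.2, fun h => hg' (Subgroup.mem_subgroupOf.2 h), fun x hx => ?_⟩
  exact Subgroup.mem_subgroupOf.1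
    ((Subgroup.mem_normalizer_iff.1 hg ⟨x, hK.le hx⟩).1 (Subgroup.mem_subgroupOf.2 hx))

theorem conj_mem_iff_of_closure_eq_top [Finite Γ] {X : Set Γ} (htop : Subgroup.closure X = ⊤)
    (hconj : ∀ x ∈ X, ∀ y ∈ X, x * y * x⁻¹ ∈ X) (g x : Γ) : g * x * g⁻¹ ∈ X ↔ x ∈ X := by
  have hg : g ∈ Subgroup.closure X := htop ▸ Subgroup.mem_top g
  induction hg using Subgroup.closure_induction generalizing x with
  | mem y hy =>
    refine ⟨fun hx => ?_, hconj y hy x⟩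
    have hinj : Function.Injective (fun x : X => (⟨y * x * y⁻¹, hconj y hy x x.2⟩ : X)) := by
      intro a b hab
      exact Subtype.ext (by simpa using congrArg Subtype.val hab)
    obtain ⟨z, hz⟩ := (Finite.injective_iff_surjective.1 hinj) ⟨_, hx⟩
    have hz' : y * (z : Γ) * y⁻¹ = y * x * y⁻¹ := congrArg Subtype.val hz
    have : (z : Γ) = x := by simpa using hz'
    exact this ▸ z.2
  | one => simp
  | mul a b _ _ ha hb =>
    refine Iff.trans ?_ ((ha (b * x * b⁻¹)).trans (hb x))
    simp [mul_assoc]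
  | inv a _ ha =>
    refine (ha (a⁻¹ * x * a⁻¹⁻¹)).symm.trans ?_
    simp [mul_assoc]

theorem exists_conj_mem_closure_inter [Finite Γ] [Fact p.Prime] {X : Set Γ}
    (hX : ∀ g x : Γ, x ∈ X → g * x * g⁻¹ ∈ X) {P K : Subgroup Γ} (hP : IsPGroup p P) (hK : K ≤ P)
    (hne : ¬ X ∩ P ⊆ K) :
    ∃ u ∈ X, u ∈ P ∧ u ∉ K ∧ ∀ x ∈ Subgroup.closure (X ∩ K),
      u * x * u⁻¹ ∈ Subgroup.closure (X ∩ K) := by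
  obtain ⟨M, hKM, hM⟩ := (Set.toFinite {M : Subgroup Γ | M ≤ P ∧ X ∩ M ⊆ K}).exists_le_maximal
    (a := K) ⟨hK, Set.inter_subset_right⟩
  have hMP : M < P := lt_of_le_of_ne hM.prop.1 (by
    rintro rfl
    exact hne hM.prop.2)
  obtain ⟨g, hgP, hgM, hg⟩ := hP.exists_mem_normalizer hMP
  have hXM : X ∩ (M : Set Γ) = X ∩ K :=
    Set.Subset.antisymm (fun x hx => ⟨hx.1, hM.prop.2 hx⟩) (fun x hx => ⟨hx.1, hKM hx.2⟩)
  have hgN : g ∈ Subgroup.normalizer (M : Set Γ) ⊓ P :=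
    ⟨(le_normalizer_iff (H := Subgroup.zpowers g)).2 (by
      rw [Subgroup.zpowers_eq_closure]
      exact conj_mem_of_closure (by simpa using hg)) (Subgroup.mem_zpowers g), hgP⟩
  have hnot : ¬ (X ∩ (Subgroup.normalizer (M : Set Γ) ⊓ P : Subgroup Γ) ⊆ (K : Set Γ)) := by
    intro hsub
    exact hgM (hM.le_of_ge ⟨inf_le_right, hsub⟩ (le_inf Subgroup.le_normalizer hM.prop.1) hgN)
  obtain ⟨u, hu, huK⟩ := Set.not_subset.1 hnot
  refine ⟨u, hu.1, hu.2.2, huK, conj_mem_closure fun s hs => Subgroup.subset_closure ?_⟩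
  rw [← hXM] at hs ⊢
  exact ⟨hX u s hs.1, (Subgroup.mem_normalizer_iff.1 hu.2.1 s).1 hs.2⟩

theorem isPGroup_of_pairs_of_closure_eq_top [Finite Γ] [Fact p.Prime] {X : Set Γ}
    (htop : Subgroup.closure X = ⊤) (hconj : ∀ x ∈ X, ∀ y ∈ X, x * y * x⁻¹ ∈ X)
    (hpair : ∀ x ∈ X, ∀ y ∈ X, IsPGroup p (Subgroup.closure {x, y})) :
    IsPGroup p (Subgroup.closure X) := by
  have hX : ∀ g x : Γ, x ∈ X → g * x * g⁻¹ ∈ X := fun g x hx =>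
    (conj_mem_iff_of_closure_eq_top htop hconj g x).2 hx
  by_cases hall : ∀ P Q : Sylow p Γ, X ∩ (P : Set Γ) ⊆ Q
  · obtain ⟨P⟩ : Nonempty (Sylow p Γ) := inferInstance
    refine P.2.to_le ((Subgroup.closure_le _).2 fun x hx => ?_)
    obtain ⟨Q, hQ⟩ := (hpair x hx x hx).exists_le_sylow
    exact hall Q P ⟨hx, hQ (Subgroup.subset_closure (by simp))⟩
  exfalso
  push Not at hall
  obtain ⟨A, B, hAB⟩ := hall
  let T := {PQ : Sylow p Γ × Sylow p Γ // ¬ X ∩ (PQ.1 : Set Γ) ⊆ PQ.2}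
  have : Nonempty T := ⟨⟨(A, B), hAB⟩⟩
  obtain ⟨⟨⟨P, Q⟩, hPQ⟩, hmax⟩ :=
    Finite.exists_max (fun PQ : T => (X ∩ ((PQ.1.1 : Subgroup Γ) ⊓ PQ.1.2 : Subgroup Γ)).ncard)
  simp only at hPQ
  have hQP : ¬ X ∩ (Q : Set Γ) ⊆ P := by
    intro hsub
    obtain ⟨g, rfl⟩ := MulAction.exists_smul_eq Γ P Q
    have himg : X ∩ ((g • P : Sylow p Γ) : Set Γ) = (fun x => g * x * g⁻¹) '' (X ∩ P) := by
      ext x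
      constructor
      · rintro ⟨hx, y, hy, rfl⟩
        refine ⟨y, ⟨(conj_mem_iff_of_closure_eq_top htop hconj g y).1 hx, hy⟩, rfl⟩
      · rintro ⟨y, hy, rfl⟩
        exact ⟨hX g y hy.1, y, hy.2, rfl⟩
    have hcard : (X ∩ ((g • P : Sylow p Γ) : Set Γ)).ncard = (X ∩ (P : Set Γ)).ncard := by
      rw [himg]
      exact Set.ncard_image_of_injective _ fun a b hab => by simpa using hab
    have := Set.eq_of_subset_of_ncard_le (s := X ∩ ((g • P : Sylow p Γ) : Set Γ))
      (t := X ∩ (P : Set Γ)) (fun x hx => ⟨hx.1, hsub hx⟩) hcard.ge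
    exact hPQ (this ▸ Set.inter_subset_right)
  obtain ⟨u, huX, huP, huK, hu⟩ := exists_conj_mem_closure_inter hX P.2
    (inf_le_left : (P : Subgroup Γ) ⊓ Q ≤ P) fun hs => hPQ fun x hx => (hs hx).2
  obtain ⟨v, hvX, hvQ, hvK, hv⟩ := exists_conj_mem_closure_inter hX Q.2
    (inf_le_right : (P : Subgroup Γ) ⊓ Q ≤ Q) fun hs => hQP fun x hx => (hs hx).1
  have hR : IsPGroup p (Subgroup.closure (X ∩ ((P : Subgroup Γ) ⊓ Q : Subgroup Γ))) :=
    P.2.to_le ((Subgroup.closure_le _).2 fun x hx => hx.2.1)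
  obtain ⟨S, hS⟩ := ((hpair u huX v hvX).sup_of_conj hR (conj_mem_of_closure (by
    rintro s (rfl | rfl)
    exacts [hu, hv]))).exists_le_sylow
  have huS : u ∈ S := hS (Subgroup.mem_sup_left (Subgroup.subset_closure (by simp)))
  have hvS : v ∈ S := hS (Subgroup.mem_sup_left (Subgroup.subset_closure (by simp)))
  have hIS : ∀ x ∈ X, x ∈ P → x ∈ Q → x ∈ S := fun x hx h1 h2 =>
    hS (Subgroup.mem_sup_right (Subgroup.subset_closure ⟨hx, h1, h2⟩))
  have key : ∀ U : Sylow p Γ, ∀ w ∈ X, w ∈ U → w ∈ S → w ∉ (P : Subgroup Γ) ⊓ Q →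
      (∀ x ∈ X, x ∈ P → x ∈ Q → x ∈ U) → X ∩ (U : Set Γ) ⊆ S ∧ X ∩ (S : Set Γ) ⊆ U := by
    intro U w hwX hwU hwS hwn hIU
    have hlt : (X ∩ ((P : Subgroup Γ) ⊓ Q : Subgroup Γ)).ncard <
        (X ∩ ((U : Subgroup Γ) ⊓ S : Subgroup Γ)).ncard :=
      Set.ncard_lt_ncard ⟨fun x hx => ⟨hx.1, hIU x hx.1 hx.2.1 hx.2.2, hIS x hx.1 hx.2.1 hx.2.2⟩,
        fun h => hwn (h ⟨hwX, hwU, hwS⟩).2⟩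
    constructor
    · by_contra hc
      exact absurd (hmax ⟨(U, S), hc⟩) (not_le_of_gt hlt)
    · by_contra hc
      have := hmax ⟨(S, U), hc⟩
      simp only [inf_comm (S : Subgroup Γ)] at this
      exact absurd this (not_le_of_gt hlt)
  have h1 := key P u huX huP huS huK fun x _ h _ => h
  have h2 := key Q v hvX hvQ hvS hvK fun x _ _ h => h
  exact hPQ fun x hx => h2.2 ⟨hx.1, h1.1 hx⟩

/-- A variant of the Baer–Suzuki theorem. -/
theorem isPGroup_closure_of_pairs [Finite Γ] [Fact p.Prime] {X : Set Γ}
    (hconj : ∀ x ∈ X, ∀ y ∈ X, x * y * x⁻¹ ∈ X)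
    (hpair : ∀ x ∈ X, ∀ y ∈ X, IsPGroup p (Subgroup.closure {x, y})) :
    IsPGroup p (Subgroup.closure X) := by
  have h := isPGroup_of_pairs_of_closure_eq_top (p := p)
    (X := ((↑) : Subgroup.closure X → Γ) ⁻¹' X) Subgroup.closure_closure_coe_preimage
    (fun x hx y hy => hconj x hx y hy) ?_
  · rw [Subgroup.closure_closure_coe_preimage] at h
    exact h.of_equiv Subgroup.topEquiv
  · intro x hx y hy
    rw [isPGroup_subgroup_iff]
    intro z hz
    have hz' : (z : Γ) ∈ Subgroup.closure {(x : Γ), (y : Γ)} := by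
      have := Subgroup.mem_map_of_mem (Subgroup.closure X).subtype hz
      rw [MonoidHom.map_closure, Set.image_pair] at this
      exact this
    obtain ⟨k, hk⟩ := isPGroup_subgroup_iff.1 (hpair x hx y hy) z hz'
    exact ⟨k, Subtype.ext hk⟩

theorem isPGroup_of_pow_mem_center [Finite Γ] [Fact p.Prime] {S : Set Γ}
    (htop : Subgroup.closure S = ⊤) (hS : ∀ s ∈ S, ∃ k : ℕ, s ^ p ^ k = 1)
    (hcen : ∀ g : Γ, ∃ k : ℕ, g ^ p ^ k ∈ Subgroup.center Γ) : IsPGroup p Γ := by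
  have hq : IsPGroup p (Γ ⧸ Subgroup.center Γ) := by
    intro g
    obtain ⟨g, rfl⟩ := QuotientGroup.mk_surjective g
    obtain ⟨k, hk⟩ := hcen g
    exact ⟨k, by rwa [← QuotientGroup.mk_pow, QuotientGroup.eq_one_iff]⟩
  have := hq.isNilpotent
  have hnil : Group.IsNilpotent Γ := Group.of_quotient_center_nilpotent this
  obtain ⟨P⟩ : Nonempty (Sylow p Γ) := inferInstance
  have hP : (P : Subgroup Γ).Normal :=
    Sylow.normal_of_normalizerCondition Group.normalizerCondition_of_isNilpotent P
  have := Sylow.unique_of_normal P hP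
  have hPtop : (P : Subgroup Γ) = ⊤ := by
    rw [eq_top_iff, ← htop, Subgroup.closure_le]
    intro s hs
    obtain ⟨k, hk⟩ := hS s hs
    obtain ⟨Q, hQ⟩ := (isPGroup_zpowers hk).exists_le_sylow
    rw [Subsingleton.elim P Q]
    exact hQ (Subgroup.mem_zpowers s)
  have := P.2
  rw [hPtop] at this
  exact this.of_equiv Subgroup.topEquiv

theorem exists_pow_mem_of_pow_central [Finite Γ] [Fact p.Prime] {S : Set Γ} {E : Subgroup Γ}
    (hS : ∀ s ∈ S, ∃ k : ℕ, s ^ p ^ k = 1) (hE : ∀ s ∈ S, ∀ x ∈ E, s * x * s⁻¹ ∈ E)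
    (hcen : ∀ g ∈ Subgroup.closure S, ∃ k : ℕ, ∀ s ∈ S, g ^ p ^ k * s * (g ^ p ^ k)⁻¹ * s⁻¹ ∈ E) :
    ∀ g ∈ Subgroup.closure S, ∃ k : ℕ, g ^ p ^ k ∈ E := by
  let H := Subgroup.closure S
  have hn : (E.subgroupOf H).Normal := ⟨fun n hn g => by
    rw [Subgroup.mem_subgroupOf] at hn ⊢
    exact conj_mem_of_closure hE g g.2 n hn⟩
  let π := QuotientGroup.mk' (E.subgroupOf H)
  have hgen : Subgroup.closure (π '' (((↑) : H → Γ) ⁻¹' S)) = ⊤ := by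
    rw [← MonoidHom.map_closure, Subgroup.closure_closure_coe_preimage,
      ← MonoidHom.range_eq_map, MonoidHom.range_eq_top]
    exact QuotientGroup.mk'_surjective _
  have hQ : IsPGroup p (H ⧸ E.subgroupOf H) := by
    refine isPGroup_of_pow_mem_center hgen ?_ ?_
    · rintro _ ⟨s, hs, rfl⟩
      obtain ⟨k, hk⟩ := hS s hs
      refine ⟨k, ?_⟩
      rw [← map_pow, show s ^ p ^ k = 1 from Subtype.ext hk, map_one]
    · intro g
      obtain ⟨g, rfl⟩ := QuotientGroup.mk'_surjective _ g
      obtain ⟨k, hk⟩ := hcen g g.2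
      refine ⟨k, ?_⟩
      have : Subgroup.closure (π '' (((↑) : H → Γ) ⁻¹' S)) ≤
          Subgroup.centralizer {π g ^ p ^ k} := by
        rw [Subgroup.closure_le]
        rintro _ ⟨s, hs, rfl⟩
        rw [SetLike.mem_coe, Subgroup.mem_centralizer_singleton_iff, eq_comm,
          ← mul_inv_eq_iff_eq_mul, ← mul_inv_eq_one, ← map_pow, ← map_mul,
          ← map_inv, ← map_inv, ← map_mul, ← map_mul]
        exact (QuotientGroup.eq_one_iff _).2 (Subgroup.mem_subgroupOf.2 (hk s hs))
      rw [hgen] at this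
      rw [Subgroup.mem_center_iff]
      intro h
      exact Subgroup.mem_centralizer_singleton_iff.1 (this (Subgroup.mem_top h))
  intro g hg
  obtain ⟨k, hk⟩ := hQ (π ⟨g, hg⟩)
  refine ⟨k, ?_⟩
  rw [← map_pow] at hk
  exact Subgroup.mem_subgroupOf.1 ((QuotientGroup.eq_one_iff _).1 hk)

end PGroups

section TriLines

variable {Γ : Type*} [Group Γ] {p : ℕ}

/-- Two involutions `d`, `e` normalising `T` such that any conjugate of `d` and any conjugate
of `e` under `T` have product of order dividing `3`, and any two conjugates of `d` have a product
of `p`-power order. -/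
structure TriPair (p : ℕ) (T : Subgroup Γ) (d e : Γ) : Prop where
  sq_d : d * d = 1
  sq_e : e * e = 1
  conj_d : ∀ g ∈ T, d * g * d ∈ T
  conj_e : ∀ g ∈ T, e * g * e ∈ T
  tri : ∀ g ∈ T, (g * d * g⁻¹ * e) ^ 3 = 1
  ppow : ∀ g ∈ T, ∃ k : ℕ, (g * d * g⁻¹ * d) ^ p ^ k = 1

theorem conj_pow_eq_one_iff {g x : Γ} {n : ℕ} : (g * x * g⁻¹) ^ n = 1 ↔ x ^ n = 1 := by
  rw [conj_pow, conj_eq_one_iff]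

theorem conj_involution_mem {T : Subgroup Γ} {d x : Γ} (hd : d * d = 1)
    (hT : ∀ g ∈ T, d * g * d ∈ T) {y : Γ} (hy : y ∈ conjOrbit T x) :
    d * y * d ∈ conjOrbit T (d * x * d) := by
  obtain ⟨g, hg, rfl⟩ := hy
  refine ⟨d * g * d, hT g hg, ?_⟩
  have hd' : d⁻¹ = d := inv_eq_of_mul_eq_one_right hd
  have h : ∀ z, d * (d * z) = z := fun z => by rw [← mul_assoc, hd, one_mul]
  simp [mul_assoc, hd', h]

theorem mul_mem_of_mem_conjOrbit {T : Subgroup Γ} {d : Γ}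
    (hT : ∀ g ∈ T, d * g * d ∈ T) {x y : Γ} (hx : x ∈ conjOrbit T d) (hy : y ∈ conjOrbit T d) :
    x * y ∈ T := by
  obtain ⟨g, hg, rfl⟩ := hx
  obtain ⟨h, hh, rfl⟩ := hy
  have : g * d * g⁻¹ * (h * d * h⁻¹) = g * (d * (g⁻¹ * h) * d) * h⁻¹ := by group
  rw [this]
  exact T.mul_mem (T.mul_mem hg (hT _ (T.mul_mem (T.inv_mem hg) hh))) (T.inv_mem hh)

theorem mul_self_of_mem_conjOrbit {T : Subgroup Γ} {d : Γ} (hd : d * d = 1)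
    {x : Γ} (hx : x ∈ conjOrbit T d) : x * x = 1 := by
  obtain ⟨g, hg, rfl⟩ := hx
  have : g * d * g⁻¹ * (g * d * g⁻¹) = g * (d * d) * g⁻¹ := by group
  rw [this, hd]
  group

namespace TriPair

variable {T : Subgroup Γ} {d e : Γ}

theorem mono (h : TriPair p T d e) {T' : Subgroup Γ} (hT : T' ≤ T)
    (hd : ∀ g ∈ T', d * g * d ∈ T') (he : ∀ g ∈ T', e * g * e ∈ T') : TriPair p T' d e :=
  ⟨h.sq_d, h.sq_e, hd, he, fun g hg => h.tri g (hT hg), fun g hg => h.ppow g (hT hg)⟩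

theorem mul_pow_three (h : TriPair p T d e) {x y : Γ} (hx : x ∈ conjOrbit T d)
    (hy : y ∈ conjOrbit T e) : (x * y) ^ 3 = 1 := by
  obtain ⟨g, hg, rfl⟩ := hx
  obtain ⟨k, hk, rfl⟩ := hy
  have := h.tri (k⁻¹ * g) (T.mul_mem (T.inv_mem hk) hg)
  rw [← conj_pow_eq_one_iff (g := k)] at this
  convert this using 2
  group

theorem exists_mul_pow (h : TriPair p T d e) {x y : Γ} (hx : x ∈ conjOrbit T d)
    (hy : y ∈ conjOrbit T d) : ∃ k : ℕ, (x * y) ^ p ^ k = 1 := by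
  obtain ⟨g, hg, rfl⟩ := hx
  obtain ⟨k, hk, rfl⟩ := hy
  obtain ⟨n, hn⟩ := h.ppow (k⁻¹ * g) (T.mul_mem (T.inv_mem hk) hg)
  refine ⟨n, ?_⟩
  rw [← conj_pow_eq_one_iff (g := k)] at hn
  convert hn using 2
  group

theorem braid (h : TriPair p T d e) : d * e * d = e * d * e := by
  have h1 := h.mul_pow_three (mem_conjOrbit_self T d) (mem_conjOrbit_self T e)
  have hd' : d⁻¹ = d := inv_eq_of_mul_eq_one_right h.sq_d
  have he' : e⁻¹ = e := inv_eq_of_mul_eq_one_right h.sq_e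
  rw [pow_three] at h1
  have : d * e * d * (e * d * e) = 1 := by simpa [mul_assoc] using h1
  rw [mul_eq_one_iff_eq_inv] at this
  rw [this]
  simp [hd', he', mul_assoc]

theorem symm (h : TriPair p T d e) : TriPair p T e d := by
  have hd' : d⁻¹ = d := inv_eq_of_mul_eq_one_right h.sq_d
  have he' : e⁻¹ = e := inv_eq_of_mul_eq_one_right h.sq_e
  refine ⟨h.sq_e, h.sq_d, h.conj_e, h.conj_d, fun g hg => ?_, fun g hg => ?_⟩
  · have := h.mul_pow_three (mem_conjOrbit_self T d) ⟨g, hg, rfl⟩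
    rw [← conj_pow_eq_one_iff (g := d⁻¹)] at this
    convert this using 2
    group
  · obtain ⟨n, hn⟩ := h.ppow (e * (d * g * d) * e) (h.conj_e _ (h.conj_d _ hg))
    refine ⟨n, ?_⟩
    rw [← conj_pow_eq_one_iff (g := d * e)] at hn
    convert hn using 2
    have hee : ∀ z, e * (e * z) = z := fun z => by rw [← mul_assoc, h.sq_e, one_mul]
    have hdd : ∀ z, d * (d * z) = z := fun z => by rw [← mul_assoc, h.sq_d, one_mul]
    have hb : ∀ z, d * (e * (d * z)) = e * (d * (e * z)) := fun z => by
      simpa [mul_assoc] using congrArg (· * z) h.braid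
    simp [mul_assoc, hd', he', hee, hdd, hb, h.sq_d]

theorem base_left (h : TriPair p T d e) {x : Γ} (hx : x ∈ conjOrbit T d) : TriPair p T x e := by
  refine ⟨mul_self_of_mem_conjOrbit h.sq_d hx, h.sq_e, ?_, h.conj_e, fun g hg => ?_,
    fun g hg => ?_⟩
  · obtain ⟨g, hg, rfl⟩ := hx
    intro k hk
    have : g * d * g⁻¹ * k * (g * d * g⁻¹) = g * (d * (g⁻¹ * k * g) * d) * g⁻¹ := by group
    rw [this]
    exact T.mul_mem (T.mul_mem hg (h.conj_d _ (T.mul_mem (T.mul_mem (T.inv_mem hg) hk) hg)))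
      (T.inv_mem hg)
  · exact h.mul_pow_three (conj_mem_conjOrbit hg hx) (mem_conjOrbit_self T e)
  · exact h.exists_mul_pow (conj_mem_conjOrbit hg hx) hx

theorem base_change (h : TriPair p T d e) {x y : Γ} (hx : x ∈ conjOrbit T d)
    (hy : y ∈ conjOrbit T e) : TriPair p T x y :=
  ((h.base_left hx).symm.base_left hy).symm

theorem third (h : TriPair p T d e) : TriPair p T d (d * e * d) := by
  have hd' : d⁻¹ = d := inv_eq_of_mul_eq_one_right h.sq_d
  have hee : ∀ z, e * (e * z) = z := fun z => by rw [← mul_assoc, h.sq_e, one_mul]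
  have hdd : ∀ z, d * (d * z) = z := fun z => by rw [← mul_assoc, h.sq_d, one_mul]
  refine ⟨h.sq_d, ?_, h.conj_d, fun g hg => ?_, fun g hg => ?_, h.ppow⟩
  · simp [mul_assoc, hee, hdd, h.sq_d]
  · have := h.conj_d _ (h.conj_e _ (h.conj_d _ hg))
    simpa [mul_assoc] using this
  · have hx := conj_involution_mem (x := d) h.sq_d h.conj_d ⟨g, hg, rfl⟩
    rw [h.sq_d, one_mul] at hx
    have := h.mul_pow_three hx (mem_conjOrbit_self T e)
    rw [← conj_pow_eq_one_iff (g := d)] at this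
    convert this using 2
    simp [mul_assoc, hdd, hd']

theorem conj_mem_third (h : TriPair p T d e) {x y : Γ} (hx : x ∈ conjOrbit T d)
    (hy : y ∈ conjOrbit T e) : x * y * x ∈ conjOrbit T (d * e * d) := by
  have hm : d * x ∈ T := mul_mem_of_mem_conjOrbit h.conj_d (mem_conjOrbit_self T d) hx
  have hxx := mul_self_of_mem_conjOrbit h.sq_d hx
  have hdd : ∀ z, d * (d * z) = z := fun z => by rw [← mul_assoc, h.sq_d, one_mul]
  have hd' : d⁻¹ = d := inv_eq_of_mul_eq_one_right h.sq_d
  have hx' : x⁻¹ = x := inv_eq_of_mul_eq_one_right hxx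
  have := conj_involution_mem h.sq_d h.conj_d (conj_mem_conjOrbit hm hy)
  simpa [mul_assoc, hd', hx', hdd, h.sq_d] using this

end TriPair

/-- The subgroup generated by the products of two elements in the same one of the three
classes of conjugates of `d`, `e` and `d * e * d` under `T`. -/
def triCore (T : Subgroup Γ) (d e : Γ) : Subgroup Γ :=
  Subgroup.closure (conjOrbit T d * conjOrbit T d ∪ conjOrbit T e * conjOrbit T e ∪
    conjOrbit T (d * e * d) * conjOrbit T (d * e * d))

namespace TriPair

variable {T : Subgroup Γ} {d e : Γ}

theorem triCore_le (h : TriPair p T d e) : triCore T d e ≤ T := by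
  rw [triCore, Subgroup.closure_le]
  rintro _ ((⟨x, hx, y, hy, rfl⟩ | ⟨x, hx, y, hy, rfl⟩) | ⟨x, hx, y, hy, rfl⟩)
  · exact mul_mem_of_mem_conjOrbit h.conj_d hx hy
  · exact mul_mem_of_mem_conjOrbit h.conj_e hx hy
  · exact mul_mem_of_mem_conjOrbit h.third.conj_e hx hy

theorem conj_triCore_mem {g : Γ} (hg : g ∈ T) :
    ∀ x ∈ triCore T d e, g * x * g⁻¹ ∈ triCore T d e := by
  have key : ∀ z, conjOrbit T z * conjOrbit T z ⊆ {w | g * w * g⁻¹ ∈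
      conjOrbit T z * conjOrbit T z} := by
    rintro z _ ⟨x, hx, y, hy, rfl⟩
    refine ⟨_, conj_mem_conjOrbit hg hx, _, conj_mem_conjOrbit hg hy, ?_⟩
    simp [mul_assoc]
  refine conj_mem_closure fun s hs => Subgroup.subset_closure ?_
  rcases hs with (hs | hs) | hs
  · exact Or.inl (Or.inl (key _ hs))
  · exact Or.inl (Or.inr (key _ hs))
  · exact Or.inr (key _ hs)

theorem conj_mul_conjOrbit_mem {z : Γ} (hd : d * d = 1) (hT : ∀ g ∈ T, d * g * d ∈ T) {w : Γ}
    (hw : w ∈ conjOrbit T z * conjOrbit T z) :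
    d * w * d⁻¹ ∈ conjOrbit T (d * z * d) * conjOrbit T (d * z * d) := by
  obtain ⟨x, hx, y, hy, rfl⟩ := hw
  refine ⟨_, conj_involution_mem hd hT hx, _, conj_involution_mem hd hT hy, ?_⟩
  have hd' : d⁻¹ = d := inv_eq_of_mul_eq_one_right hd
  have hdd : ∀ z, d * (d * z) = z := fun z => by rw [← mul_assoc, hd, one_mul]
  simp [mul_assoc, hd', hdd]

theorem conj_d_triCore_mem (h : TriPair p T d e) :
    ∀ x ∈ triCore T d e, d * x * d⁻¹ ∈ triCore T d e := by
  have hdd : ∀ z, d * (d * z) = z := fun z => by rw [← mul_assoc, h.sq_d, one_mul]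
  refine conj_mem_closure fun s hs => Subgroup.subset_closure ?_
  rcases hs with (hs | hs) | hs <;> have := conj_mul_conjOrbit_mem h.sq_d h.conj_d hs
  · simp only [mul_assoc, h.sq_d] at this
    exact Or.inl (Or.inl (by simpa [mul_assoc] using this))
  · exact Or.inr this
  · simp only [mul_assoc, h.sq_d, mul_one, hdd] at this
    exact Or.inl (Or.inr (by simpa [mul_assoc] using this))

theorem triCore_comm (h : TriPair p T d e) : triCore T e d = triCore T d e := by
  rw [triCore, triCore, ← h.braid, Set.union_comm (conjOrbit T e * _)]

theorem conj_e_triCore_mem (h : TriPair p T d e) :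
    ∀ x ∈ triCore T d e, e * x * e⁻¹ ∈ triCore T d e := by
  rw [← h.triCore_comm]
  exact h.symm.conj_d_triCore_mem

end TriPair

theorem isPGroup_two_closure_pair [Finite Γ] {x y : Γ} (hx : x * x = 1) (hy : y * y = 1) {k : ℕ}
    (hxy : (x * y) ^ 2 ^ k = 1) : IsPGroup 2 (Subgroup.closure {x, y}) := by
  have hxi : x⁻¹ = x := inv_eq_of_mul_eq_one_right hx
  have hyi : y⁻¹ = y := inv_eq_of_mul_eq_one_right hy
  have hX : IsPGroup 2 (Subgroup.zpowers x) :=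
    isPGroup_zpowers (k := 1) (by rw [pow_one, pow_two, hx])
  refine (hX.sup_of_conj (isPGroup_zpowers hxy) ?_).to_le ((Subgroup.closure_le _).2 ?_)
  · rw [Subgroup.zpowers_eq_closure x]
    refine conj_mem_of_closure ?_
    rintro s rfl
    rw [Subgroup.zpowers_eq_closure]
    refine conj_mem_closure ?_
    rintro z rfl
    rw [← Subgroup.zpowers_eq_closure]
    have : s * (s * y) * s⁻¹ = (s * y)⁻¹ := by
      simp [mul_inv_rev, hxi, hyi, ← mul_assoc, hx]
    rw [this]
    exact Subgroup.inv_mem _ (Subgroup.mem_zpowers _)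
  · rintro z (rfl | rfl)
    · exact Subgroup.mem_sup_left (Subgroup.mem_zpowers _)
    · have hz : x * (x * z) ∈ Subgroup.zpowers x ⊔ Subgroup.zpowers (x * z) :=
        Subgroup.mul_mem _ (Subgroup.mem_sup_left (Subgroup.mem_zpowers _))
          (Subgroup.mem_sup_right (Subgroup.mem_zpowers _))
      rwa [← mul_assoc, hx, one_mul] at hz

theorem conj_mem_conjOrbit_of_mem {T : Subgroup Γ} {d : Γ} (hd : d * d = 1)
    (hT : ∀ g ∈ T, d * g * d ∈ T) {x y : Γ} (hx : x ∈ conjOrbit T d) (hy : y ∈ conjOrbit T d) :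
    x * y * x ∈ conjOrbit T d := by
  have h1 := conj_involution_mem hd hT hy
  rw [hd, one_mul] at h1
  have h2 := conj_mem_conjOrbit
    (mul_mem_of_mem_conjOrbit hT hx (mem_conjOrbit_self T d)) h1
  have hxi : x⁻¹ = x := inv_eq_of_mul_eq_one_right (mul_self_of_mem_conjOrbit hd hx)
  have hdi : d⁻¹ = d := inv_eq_of_mul_eq_one_right hd
  have hdd : ∀ z, d * (d * z) = z := fun z => by rw [← mul_assoc, hd, one_mul]
  simpa [mul_assoc, hxi, hdi, hdd] using h2

namespace TriPair

variable {T : Subgroup Γ} {d e : Γ}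

theorem isPGroup_two_closure_mul [Finite Γ] (h : TriPair 2 T d e) :
    IsPGroup 2 (Subgroup.closure (conjOrbit T d * conjOrbit T d)) := by
  have : IsPGroup 2 (Subgroup.closure (conjOrbit T d)) := by
    refine isPGroup_closure_of_pairs (fun x hx y hy => ?_) fun x hx y hy => ?_
    · have hxi : x⁻¹ = x := inv_eq_of_mul_eq_one_right (mul_self_of_mem_conjOrbit h.sq_d hx)
      rw [hxi]
      exact conj_mem_conjOrbit_of_mem h.sq_d h.conj_d hx hy
    · obtain ⟨k, hk⟩ := h.exists_mul_pow hx hy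
      exact isPGroup_two_closure_pair (mul_self_of_mem_conjOrbit h.sq_d hx)
        (mul_self_of_mem_conjOrbit h.sq_d hy) hk
  refine this.to_le ((Subgroup.closure_le _).2 ?_)
  rintro _ ⟨x, hx, y, hy, rfl⟩
  exact Subgroup.mul_mem _ (Subgroup.subset_closure hx) (Subgroup.subset_closure hy)

theorem isPGroup_triCore_two [Finite Γ] (h : TriPair 2 T d e) :
    IsPGroup 2 (triCore T d e) := by
  have hle : ∀ {d e : Γ}, TriPair 2 T d e →
      Subgroup.closure (conjOrbit T d * conjOrbit T d) ≤ T := by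
    intro d e h
    rw [Subgroup.closure_le]
    rintro _ ⟨x, hx, y, hy, rfl⟩
    exact mul_mem_of_mem_conjOrbit h.conj_d hx hy
  have hn : ∀ z g : Γ, g ∈ T → ∀ x ∈ Subgroup.closure (conjOrbit T z * conjOrbit T z),
      g * x * g⁻¹ ∈ Subgroup.closure (conjOrbit T z * conjOrbit T z) := by
    intro z g hg
    refine conj_mem_closure ?_
    rintro _ ⟨x, hx, y, hy, rfl⟩
    refine Subgroup.subset_closure
      ⟨_, conj_mem_conjOrbit hg hx, _, conj_mem_conjOrbit hg hy, ?_⟩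
    simp [mul_assoc]
  rw [triCore, Subgroup.closure_union, Subgroup.closure_union]
  refine IsPGroup.sup_of_conj (IsPGroup.sup_of_conj h.isPGroup_two_closure_mul
    h.symm.isPGroup_two_closure_mul ?_) h.third.symm.isPGroup_two_closure_mul ?_
  · exact fun g hg => hn _ g (hle h hg)
  · exact fun g hg => hn _ g (sup_le (hle h) (hle h.symm) hg)

end TriPair

end TriLines

section Commutators

variable {Γ : Type*} [Group Γ] {p : ℕ}

/-- A group generated by `p`-elements `a`, `a'`, `b`, `c` with `⟨a, c⟩` and `⟨a', b⟩` commuting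
is a `p`-group if it has a set of `p`-elements stable under the maps `m ↦ a' ^ ε * m * a ^ ε`
and `m ↦ b ^ ε * m * c ^ ε` with `ε = ±1`. -/
theorem isPGroup_of_commute_of_stable [Finite Γ] [Fact p.Prime] {a a' b c : Γ} {M : Set Γ}
    (htop : Subgroup.closure {a, a', b, c} = ⊤)
    (hgen : ∀ s ∈ ({a, a', b, c} : Set Γ), ∃ k : ℕ, s ^ p ^ k = 1)
    (haa : Commute a a') (hab : Commute a b) (hca : Commute c a') (hcb : Commute c b)
    (hM1 : 1 ∈ M) (hMp : ∀ m ∈ M, ∃ k : ℕ, m ^ p ^ k = 1)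
    (hMa : ∀ m ∈ M, a' * m * a ∈ M) (hMa' : ∀ m ∈ M, a'⁻¹ * m * a⁻¹ ∈ M)
    (hMb : ∀ m ∈ M, b * m * c ∈ M) (hMb' : ∀ m ∈ M, b⁻¹ * m * c⁻¹ ∈ M) : IsPGroup p Γ := by
  set A := Subgroup.closure {a, c} with hA
  set B := Subgroup.closure {a', b} with hB
  have hAB : ∀ α ∈ A, ∀ β ∈ B, Commute α β := by
    have h1 : ∀ s ∈ ({a, c} : Set Γ), ∀ β ∈ B, Commute s β := by
      intro s hs β hβ
      have : B ≤ Subgroup.centralizer {s} := by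
        rw [hB, Subgroup.closure_le]
        rcases hs with (rfl | rfl) <;> rintro t (rfl | rfl) <;>
          rw [SetLike.mem_coe, Subgroup.mem_centralizer_singleton_iff]
        exacts [haa.symm.eq, hab.symm.eq, hca.symm.eq, hcb.symm.eq]
      exact (Subgroup.mem_centralizer_singleton_iff.1 (this hβ)).symm
    intro α hα β hβ
    have : A ≤ Subgroup.centralizer {β} := by
      rw [hA, Subgroup.closure_le]
      intro s hs
      rw [SetLike.mem_coe, Subgroup.mem_centralizer_singleton_iff]
      exact h1 s hs β hβ
    exact Subgroup.mem_centralizer_singleton_iff.1 (this hα)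
  have haA : a ∈ A := Subgroup.subset_closure (by simp)
  have hcA : c ∈ A := Subgroup.subset_closure (by simp)
  have haB : a' ∈ B := Subgroup.subset_closure (by simp)
  have hbB : b ∈ B := Subgroup.subset_closure (by simp)
  have hAM : ∀ α ∈ A, ∃ β ∈ B, β * α ∈ M := by
    intro α hα
    induction hα using Subgroup.closure_induction_right with
    | one => exact ⟨1, B.one_mem, by simpa using hM1⟩
    | mul_right x _ y hy ih =>
      obtain ⟨β, hβ, hm⟩ := ih
      rcases hy with rfl | rfl
      · exact ⟨_, B.mul_mem haB hβ, by simpa [mul_assoc] using hMa _ hm⟩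
      · exact ⟨_, B.mul_mem hbB hβ, by simpa [mul_assoc] using hMb _ hm⟩
    | mul_inv_cancel x _ y hy ih =>
      obtain ⟨β, hβ, hm⟩ := ih
      rcases hy with rfl | rfl
      · exact ⟨_, B.mul_mem (B.inv_mem haB) hβ, by simpa [mul_assoc] using hMa' _ hm⟩
      · exact ⟨_, B.mul_mem (B.inv_mem hbB) hβ, by simpa [mul_assoc] using hMb' _ hm⟩
  have hBM : ∀ β ∈ B, ∃ α ∈ A, β * α ∈ M := by
    intro β hβ
    induction hβ using Subgroup.closure_induction_left with
    | one => exact ⟨1, A.one_mem, by simpa using hM1⟩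
    | mul_left y hy x _ ih =>
      obtain ⟨α, hα, hm⟩ := ih
      rcases hy with rfl | rfl
      · exact ⟨_, A.mul_mem hα haA, by simpa [mul_assoc] using hMa _ hm⟩
      · exact ⟨_, A.mul_mem hα hcA, by simpa [mul_assoc] using hMb _ hm⟩
    | inv_mul_cancel y hy x _ ih =>
      obtain ⟨α, hα, hm⟩ := ih
      rcases hy with rfl | rfl
      · exact ⟨_, A.mul_mem hα (A.inv_mem haA), by simpa [mul_assoc] using hMa' _ hm⟩
      · exact ⟨_, A.mul_mem hα (A.inv_mem hcA), by simpa [mul_assoc] using hMb' _ hm⟩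
  have hsup : ∀ s ∈ ({a, a', b, c} : Set Γ), s ∈ A ∨ s ∈ B := by
    rintro s (rfl | rfl | rfl | rfl)
    exacts [Or.inl haA, Or.inr haB, Or.inr hbB, Or.inl hcA]
  have hcenter : ∀ z : Γ, (∀ α ∈ A, Commute α z) → (∀ β ∈ B, Commute β z) →
      z ∈ Subgroup.center Γ := by
    intro z h1 h2
    have : Subgroup.closure {a, a', b, c} ≤ Subgroup.centralizer {z} := by
      rw [Subgroup.closure_le]
      intro s hs
      rw [SetLike.mem_coe, Subgroup.mem_centralizer_singleton_iff]
      rcases hsup s hs with h | h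
      exacts [h1 s h, h2 s h]
    rw [htop] at this
    exact Subgroup.mem_center_iff.2 fun g =>
      Subgroup.mem_centralizer_singleton_iff.1 (this (Subgroup.mem_top g))
  have hmul : ∀ α ∈ A, ∀ β ∈ B, ∀ k : ℕ, (β * α) ^ p ^ k = 1 →
      α ^ p ^ k ∈ Subgroup.center Γ ∧ β ^ p ^ k ∈ Subgroup.center Γ := by
    intro α hα β hβ k hk
    rw [(hAB α hα β hβ).symm.mul_pow] at hk
    have e1 : α ^ p ^ k = (β ^ p ^ k)⁻¹ := eq_inv_of_mul_eq_one_right hk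
    have hαB : ∀ β' ∈ B, Commute β' (α ^ p ^ k) := fun β' hβ' =>
      (hAB _ (A.pow_mem hα _) β' hβ').symm
    have hβA : ∀ α' ∈ A, Commute α' (β ^ p ^ k) := fun α' hα' =>
      hAB α' hα' _ (B.pow_mem hβ _)
    have hz : α ^ p ^ k ∈ Subgroup.center Γ :=
      hcenter _ (fun α' hα' => e1 ▸ (hβA α' hα').inv_right) hαB
    exact ⟨hz, by simpa [e1] using hz⟩
  refine isPGroup_of_pow_mem_center htop hgen fun g => ?_
  have hg : ∃ β ∈ B, ∃ α ∈ A, β * α = g := by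
    have hg : g ∈ Subgroup.closure {a, a', b, c} := htop ▸ Subgroup.mem_top g
    have hle : Subgroup.closure {a, a', b, c} ≤ B ⊔ A := (Subgroup.closure_le _).2 fun s hs =>
      (hsup s hs).elim (fun h => Subgroup.mem_sup_right h) fun h => Subgroup.mem_sup_left h
    have hn : A ≤ Subgroup.normalizer (B : Set Γ) := le_normalizer_iff.2 fun α hα β hβ => by
      rw [(hAB α hα β hβ).eq, mul_inv_cancel_right]
      exact hβ
    have := hle hg
    rwa [← SetLike.mem_coe, Subgroup.coe_mul_of_right_le_normalizer_left B A hn] at this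
  obtain ⟨β, hβ, α, hα, rfl⟩ := hg
  obtain ⟨β', hβ', h1⟩ := hAM α hα
  obtain ⟨α', hα', h2⟩ := hBM β hβ
  obtain ⟨k, hk⟩ := hMp _ h1
  obtain ⟨l, hl⟩ := hMp _ h2
  refine ⟨max k l, ?_⟩
  rw [(hAB α hα β hβ).symm.mul_pow]
  exact Subgroup.mul_mem _
    (hmul α' hα' β hβ _ (pow_pow_eq_one_of_le hl (le_max_right k l))).2
    (hmul α hα β' hβ' _ (pow_pow_eq_one_of_le hk (le_max_left k l))).1

theorem exists_pow_mem_of_stable [Finite Γ] [Fact p.Prime] {a a' b c : Γ} {M : Set Γ}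
    {E : Subgroup Γ} (hE : ∀ s ∈ ({a, a', b, c} : Set Γ), ∀ x ∈ E, s * x * s⁻¹ ∈ E)
    (hgen : ∀ s ∈ ({a, a', b, c} : Set Γ), ∃ k : ℕ, s ^ p ^ k = 1)
    (haa : a * a' * a⁻¹ * a'⁻¹ ∈ E) (hab : a * b * a⁻¹ * b⁻¹ ∈ E)
    (hca : c * a' * c⁻¹ * a'⁻¹ ∈ E) (hcb : c * b * c⁻¹ * b⁻¹ ∈ E)
    (hM1 : 1 ∈ M) (hMp : ∀ m ∈ M, ∃ k : ℕ, m ^ p ^ k = 1)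
    (hMa : ∀ m ∈ M, a' * m * a ∈ M) (hMa' : ∀ m ∈ M, a'⁻¹ * m * a⁻¹ ∈ M)
    (hMb : ∀ m ∈ M, b * m * c ∈ M) (hMb' : ∀ m ∈ M, b⁻¹ * m * c⁻¹ ∈ M) :
    ∀ g ∈ Subgroup.closure {a, a', b, c}, ∃ k : ℕ, g ^ p ^ k ∈ E := by
  let H := Subgroup.closure {a, a', b, c}
  have hn : (E.subgroupOf H).Normal := ⟨fun n hn g => by
    rw [Subgroup.mem_subgroupOf] at hn ⊢
    exact conj_mem_of_closure hE g g.2 n hn⟩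
  let π := QuotientGroup.mk' (E.subgroupOf H)
  have hcomm : ∀ s t : H, (s * t * s⁻¹ * t⁻¹ : Γ) ∈ E → Commute (π s) (π t) := by
    intro s t hst
    have h1 : π (s * t * s⁻¹ * t⁻¹) = 1 :=
      (QuotientGroup.eq_one_iff _).2 (Subgroup.mem_subgroupOf.2 hst)
    rw [map_mul, map_mul, map_mul, map_inv, map_inv, mul_inv_eq_one, mul_inv_eq_iff_eq_mul] at h1
    exact h1
  have ha : a ∈ H := Subgroup.subset_closure (by simp)
  have ha' : a' ∈ H := Subgroup.subset_closure (by simp)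
  have hb : b ∈ H := Subgroup.subset_closure (by simp)
  have hc : c ∈ H := Subgroup.subset_closure (by simp)
  have hset : (((↑) : H → Γ) ⁻¹' {a, a', b, c}) = {⟨a, ha⟩, ⟨a', ha'⟩, ⟨b, hb⟩, ⟨c, hc⟩} := by
    ext x
    simp [Subtype.ext_iff]
  have hQ : IsPGroup p (H ⧸ E.subgroupOf H) := by
    refine isPGroup_of_commute_of_stable (a := π ⟨a, ha⟩) (a' := π ⟨a', ha'⟩) (b := π ⟨b, hb⟩)
      (c := π ⟨c, hc⟩) (M := π '' (((↑) : H → Γ) ⁻¹' M)) ?_ ?_ (hcomm _ _ haa) (hcomm _ _ hab)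
      (hcomm _ _ hca) (hcomm _ _ hcb) ⟨1, hM1, map_one π⟩ ?_ ?_ ?_ ?_ ?_
    · have : Subgroup.closure (π '' (((↑) : H → Γ) ⁻¹' {a, a', b, c})) = ⊤ := by
        rw [← MonoidHom.map_closure, Subgroup.closure_closure_coe_preimage,
          ← MonoidHom.range_eq_map, MonoidHom.range_eq_top]
        exact QuotientGroup.mk'_surjective _
      rw [hset] at this
      simpa [Set.image_insert_eq] using this
    · have : ∀ s : H, (s : Γ) ∈ ({a, a', b, c} : Set Γ) → ∃ k : ℕ, π s ^ p ^ k = 1 := by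
        intro s hs
        obtain ⟨k, hk⟩ := hgen s hs
        refine ⟨k, ?_⟩
        rw [← map_pow, show s ^ p ^ k = 1 from Subtype.ext hk, map_one]
      rintro s (rfl | rfl | rfl | rfl) <;> exact this _ (by simp)
    · rintro _ ⟨m, hm, rfl⟩
      obtain ⟨k, hk⟩ := hMp m hm
      refine ⟨k, ?_⟩
      rw [← map_pow, show m ^ p ^ k = 1 from Subtype.ext hk, map_one]
    · rintro _ ⟨m, hm, rfl⟩
      exact ⟨⟨a', ha'⟩ * m * ⟨a, ha⟩, hMa _ hm, by simp⟩
    · rintro _ ⟨m, hm, rfl⟩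
      exact ⟨⟨a', ha'⟩⁻¹ * m * ⟨a, ha⟩⁻¹, hMa' _ hm, by simp⟩
    · rintro _ ⟨m, hm, rfl⟩
      exact ⟨⟨b, hb⟩ * m * ⟨c, hc⟩, hMb _ hm, by simp⟩
    · rintro _ ⟨m, hm, rfl⟩
      exact ⟨⟨b, hb⟩⁻¹ * m * ⟨c, hc⟩⁻¹, hMb' _ hm, by simp⟩
  intro g hg
  obtain ⟨k, hk⟩ := hQ (π ⟨g, hg⟩)
  refine ⟨k, ?_⟩
  rw [← map_pow] at hk
  exact Subgroup.mem_subgroupOf.1 ((QuotientGroup.eq_one_iff _).1 hk)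

theorem comm_eq_comm_of_mul_eq_one {a a' b c x v : Γ} (haa : Commute a a')
    (hx : x * a * a' = 1) (hv : v * c * b = 1)
    (h : a' * v * a * (x * c * a') * (a * b * x) = 1) :
    c⁻¹ * a'⁻¹ * c * a' = b * a * b⁻¹ * a⁻¹ := by
  have hx' : x = a'⁻¹ * a⁻¹ := by
    rw [← mul_inv_rev]
    exact eq_inv_of_mul_eq_one_left (by rwa [← mul_assoc])
  have hv' : v = b⁻¹ * c⁻¹ := by
    rw [← mul_inv_rev]
    exact eq_inv_of_mul_eq_one_left (by rwa [← mul_assoc])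
  have e1 : a * (a'⁻¹ * a⁻¹) = a'⁻¹ := by
    rw [← mul_assoc, haa.inv_right.eq, mul_inv_cancel_right]
  have h2 : a' * (b⁻¹ * (c⁻¹ * (a'⁻¹ * c * a') * (a * b * a⁻¹))) * a'⁻¹ = 1 := by
    rw [← h, hx', hv', haa.inv_inv.symm.eq]
    have e2 : a * (a⁻¹ * a'⁻¹) = a'⁻¹ := by group
    have : a' * (b⁻¹ * c⁻¹) * a * (a⁻¹ * a'⁻¹ * c * a') * (a * b * (a⁻¹ * a'⁻¹)) =
      a' * (b⁻¹ * (c⁻¹ * (a'⁻¹ * c * a') * (a * b * a⁻¹))) * a'⁻¹ := by group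
    rw [this]
  rw [conj_eq_one_iff] at h2
  have h3 : c⁻¹ * (a'⁻¹ * c * a') * (a * b * a⁻¹) = b := by
    rw [inv_mul_eq_one] at h2
    exact h2.symm
  rw [← eq_mul_inv_iff_mul_eq] at h3
  rw [← mul_assoc, ← mul_assoc] at h3
  rw [h3]
  group

/-- The commutators `[b ^ m, a ^ n]`. -/
def zpowComm (a b : Γ) (n m : ℤ) : Γ := b ^ m * a ^ n * (b ^ m)⁻¹ * (a ^ n)⁻¹

theorem conj_zpowComm_left (a b : Γ) (n m : ℤ) :
    a * zpowComm a b n m * a⁻¹ = (zpowComm a b 1 m)⁻¹ * zpowComm a b (n + 1) m := by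
  simp only [zpowComm]
  group

theorem conj_zpowComm_right (a b : Γ) (n m : ℤ) :
    b * zpowComm a b n m * b⁻¹ = zpowComm a b n (m + 1) * (zpowComm a b n 1)⁻¹ := by
  simp only [zpowComm]
  group

theorem zpowComm_properties [Finite Γ] {a a' b c : Γ}
    (hf : ∀ n m, zpowComm a b n m = zpowComm a' c n m) :
    ∃ E : Subgroup Γ, E ≤ Subgroup.closure {a, b} ∧ b * a * b⁻¹ * a⁻¹ ∈ E ∧
      c * a' * c⁻¹ * a'⁻¹ ∈ E ∧
      (∀ s ∈ ({a, a', b, c} : Set Γ), ∀ x ∈ E, s * x * s⁻¹ ∈ E) ∧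
      ∀ x ∈ E, Commute x (a'⁻¹ * a) ∧ Commute x (c⁻¹ * b) := by
  have hmem : ∀ n m, zpowComm a b n m ∈
      Subgroup.closure {z | ∃ n m, z = zpowComm a b n m} := fun n m =>
    Subgroup.subset_closure ⟨n, m, rfl⟩
  have hcomm : ∀ (s t : Γ), (∀ n m, s * zpowComm a b n m * s⁻¹ = t * zpowComm a b n m * t⁻¹) →
      ∀ x ∈ Subgroup.closure {z | ∃ n m, z = zpowComm a b n m}, Commute x (t⁻¹ * s) := by
    intro s t hst x hx
    have : Subgroup.closure {z | ∃ n m, z = zpowComm a b n m} ≤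
        Subgroup.centralizer {t⁻¹ * s} := by
      rw [Subgroup.closure_le]
      rintro _ ⟨n, m, rfl⟩
      rw [SetLike.mem_coe, Subgroup.mem_centralizer_singleton_iff]
      have h1 : t⁻¹ * (s * zpowComm a b n m * s⁻¹) * s = t⁻¹ * (t * zpowComm a b n m * t⁻¹) * s :=
        by rw [hst]
      simpa [mul_assoc] using h1.symm
    exact Subgroup.mem_centralizer_singleton_iff.1 (this hx)
  refine ⟨Subgroup.closure {z | ∃ n m, z = zpowComm a b n m}, ?_, ?_, ?_, ?_, fun x hx =>
    ⟨hcomm a a' (fun n m => ?_) x hx, hcomm b c (fun n m => ?_) x hx⟩⟩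
  · rw [Subgroup.closure_le]
    rintro _ ⟨n, m, rfl⟩
    have ha : a ∈ Subgroup.closure {a, b} := Subgroup.subset_closure (by simp)
    have hb : b ∈ Subgroup.closure {a, b} := Subgroup.subset_closure (by simp)
    exact mul_mem (mul_mem (mul_mem (zpow_mem hb _) (zpow_mem ha _)) (inv_mem (zpow_mem hb _)))
      (inv_mem (zpow_mem ha _))
  · simpa [zpowComm] using hmem 1 1
  · have := hmem 1 1
    rw [hf] at this
    simpa [zpowComm] using this
  · rintro s (rfl | rfl | rfl | rfl) <;> refine conj_mem_closure ?_ <;> rintro _ ⟨n, m, rfl⟩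
    · rw [conj_zpowComm_left]
      exact mul_mem (inv_mem (hmem _ _)) (hmem _ _)
    · rw [hf, conj_zpowComm_left, ← hf, ← hf]
      exact mul_mem (inv_mem (hmem _ _)) (hmem _ _)
    · rw [conj_zpowComm_right]
      exact mul_mem (hmem _ _) (inv_mem (hmem _ _))
    · rw [hf, conj_zpowComm_right, ← hf, ← hf]
      exact mul_mem (hmem _ _) (inv_mem (hmem _ _))
  · rw [conj_zpowComm_left, hf n m, conj_zpowComm_left, hf, hf]
  · rw [conj_zpowComm_right, hf n m, conj_zpowComm_right, hf, hf]

end Commutators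

section TwoLines

variable {Γ : Type*} [Group Γ] {p : ℕ}

/-- The elements `m` such that `d * m` is a conjugate of `d` under `T`. -/
def conjDiff (T : Subgroup Γ) (d : Γ) : Set Γ := {m | d * m ∈ conjOrbit T d}

namespace TriPair

variable {T : Subgroup Γ} {d e : Γ}

theorem mul_mem_conjDiff (h : TriPair p T d e) {x : Γ} (hx : x ∈ conjOrbit T d) :
    d * x ∈ conjDiff T d := by
  change d * (d * x) ∈ conjOrbit T d
  rwa [← mul_assoc, h.sq_d, one_mul]

theorem one_mem_conjDiff (T : Subgroup Γ) (d : Γ) : 1 ∈ conjDiff T d := by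
  change d * 1 ∈ conjOrbit T d
  rw [mul_one]
  exact mem_conjOrbit_self T d

theorem mem_of_mem_conjDiff (h : TriPair p T d e) {m : Γ} (hm : m ∈ conjDiff T d) : m ∈ T := by
  have := mul_mem_of_mem_conjOrbit h.conj_d (mem_conjOrbit_self T d) hm
  rwa [← mul_assoc, h.sq_d, one_mul] at this

theorem exists_pow_of_mem_conjDiff (h : TriPair p T d e) {m : Γ} (hm : m ∈ conjDiff T d) :
    ∃ k : ℕ, m ^ p ^ k = 1 := by
  have := h.exists_mul_pow (mem_conjOrbit_self T d) hm
  rwa [← mul_assoc, h.sq_d, one_mul] at this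

theorem conj_eq_inv_of_mem_conjDiff (h : TriPair p T d e) {m : Γ} (hm : m ∈ conjDiff T d) :
    d * m * d = m⁻¹ := by
  have := mul_self_of_mem_conjOrbit h.sq_d hm
  rw [← mul_assoc] at this
  exact eq_inv_of_mul_eq_one_left this

theorem stable_conjDiff (h : TriPair p T d e) {m s : Γ} (hm : m ∈ conjDiff T d) (hs : s ∈ T) :
    d * s * d * m * s⁻¹ ∈ conjDiff T d := by
  have h1 := conj_mem_conjOrbit hs hm
  have hdd : ∀ z, d * (d * z) = z := fun z => by rw [← mul_assoc, h.sq_d, one_mul]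
  change d * (d * s * d * m * s⁻¹) ∈ conjOrbit T d
  simpa [mul_assoc, hdd] using h1

theorem zpow_mem_conjDiff (h : TriPair p T d e) {m : Γ} (hm : m ∈ conjDiff T d) (n : ℤ) :
    m ^ n ∈ conjDiff T d := by
  have hd' : d⁻¹ = d := inv_eq_of_mul_eq_one_right h.sq_d
  have key : ∀ (k : ℤ) (y : Γ), y ∈ conjDiff T d → m ^ k * y * m ^ k ∈ conjDiff T d := by
    intro k y hy
    have h1 := h.stable_conjDiff hy (T.zpow_mem (h.mem_of_mem_conjDiff hm) (-k))
    have h2 : d * m ^ (-k) * d = m ^ k := by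
      have := h.conj_eq_inv_of_mem_conjDiff hm
      nth_rw 2 [← hd'] at this ⊢
      rw [← conj_zpow, this, inv_zpow, zpow_neg, inv_inv]
    rwa [h2, zpow_neg, inv_inv] at h1
  obtain ⟨k, rfl | rfl⟩ := Int.even_or_odd' n
  · have := key k 1 (one_mem_conjDiff T d)
    rwa [mul_one, ← zpow_add, ← two_mul] at this
  · have := key k m hm
    rwa [← zpow_add_one, ← zpow_add, show k + 1 + k = 2 * k + 1 by ring] at this

theorem mul_pow_three_of_mem_conjDiff (h : TriPair p T d e) {m : Γ} (hm : m ∈ conjDiff T d) :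
    (m * (d * e)) ^ 3 = 1 := by
  have h1 := conj_involution_mem h.sq_d h.conj_d hm
  rw [h.sq_d, one_mul] at h1
  have h2 := h.mul_pow_three h1 (mem_conjOrbit_self T e)
  rwa [← mul_assoc, h.sq_d, one_mul, mul_assoc] at h2

theorem rotation_pow_three (h : TriPair p T d e) : (d * e) ^ 3 = 1 :=
  h.mul_pow_three (mem_conjOrbit_self T d) (mem_conjOrbit_self T e)

theorem rotation_conj_mem (h : TriPair p T d e) {t : Γ} (ht : t ∈ T) :
    d * e * t * (d * e)⁻¹ ∈ T := by
  have hd' : d⁻¹ = d := inv_eq_of_mul_eq_one_right h.sq_d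
  have he' : e⁻¹ = e := inv_eq_of_mul_eq_one_right h.sq_e
  simpa [hd', he', mul_assoc] using h.conj_d _ (h.conj_e _ ht)

theorem mul_conj_mul_conj (h : TriPair p T d e) {m r : Γ} (hr : r = d * e)
    (hm : m ∈ conjDiff T d) : m * (r * m * r⁻¹) * (r⁻¹ * m * r) = 1 := by
  have h1 := h.mul_pow_three_of_mem_conjDiff hm
  have h3 := h.rotation_pow_three
  rw [← hr] at h1 h3
  have h4 : r⁻¹ * r⁻¹ = r := by
    rw [← mul_inv_rev]
    exact inv_eq_of_mul_eq_one_right (by rw [← h3, pow_three, mul_assoc])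
  have : m * (r * m * r⁻¹) * (r⁻¹ * m * r) = m * r * m * (r⁻¹ * r⁻¹) * m * r := by group
  rw [this, h4, ← h1]
  simp only [pow_three, mul_assoc]

theorem commute_conj (h : TriPair p T d e) {m r : Γ} (hr : r = d * e)
    (hm : m ∈ conjDiff T d) : Commute (r * m * r⁻¹) (r⁻¹ * m * r) := by
  have h1 := h.mul_conj_mul_conj hr hm
  have h2 := h.mul_conj_mul_conj hr (h.zpow_mem_conjDiff hm (-1))
  rw [mul_assoc] at h1
  have h3 := eq_inv_of_mul_eq_one_right h1
  have h4 : (r⁻¹ * m * r * (r * m * r⁻¹) * m)⁻¹ = 1 := by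
    rw [← h2]
    group
  rw [inv_eq_one] at h4
  exact h3.trans (eq_inv_of_mul_eq_one_left h4).symm

theorem conj_conj (h : TriPair p T d e) {m r : Γ} (hr : r = d * e) :
    d * (r * m * r⁻¹) * d = r⁻¹ * (d * m * d) * r := by
  have hd' : d⁻¹ = d := inv_eq_of_mul_eq_one_right h.sq_d
  have he' : e⁻¹ = e := inv_eq_of_mul_eq_one_right h.sq_e
  have hdd : ∀ z, d * (d * z) = z := fun z => by rw [← mul_assoc, h.sq_d, one_mul]
  subst hr
  simp [mul_assoc, hd', he', hdd, h.sq_d]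

theorem comm_eq_comm (h : TriPair p T d e) {x v r : Γ} (hr : r = d * e)
    (hx : x ∈ conjDiff T d) (hv : v ∈ conjDiff T d) :
    (r * v * r⁻¹)⁻¹ * (r⁻¹ * x * r)⁻¹ * (r * v * r⁻¹) * (r⁻¹ * x * r) =
      (r⁻¹ * v * r) * (r * x * r⁻¹) * (r⁻¹ * v * r)⁻¹ * (r * x * r⁻¹)⁻¹ := by
  have h3 : r * r = r⁻¹ := by
    refine eq_inv_of_mul_eq_one_left ?_
    have := h.rotation_pow_three
    rw [← hr] at this
    rw [← this, pow_three, mul_assoc]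
  have h4 : r⁻¹ * r⁻¹ = r := by rw [← mul_inv_rev, h3, inv_inv]
  have ha : r * x * r⁻¹ ∈ T := by
    rw [hr]
    exact h.rotation_conj_mem (h.mem_of_mem_conjDiff hx)
  have hm := h.stable_conjDiff hv (T.inv_mem ha)
  have e1 : d * (r * x * r⁻¹)⁻¹ * d = r⁻¹ * x * r := by
    have : (r * x * r⁻¹)⁻¹ = r * x⁻¹ * r⁻¹ := by group
    rw [this, h.conj_conj hr, ← h.conj_eq_inv_of_mem_conjDiff hx]
    have hdd : ∀ z, d * (d * z) = z := fun z => by rw [← mul_assoc, h.sq_d, one_mul]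
    simp [mul_assoc, hdd, h.sq_d]
  rw [e1, inv_inv] at hm
  have key := h.mul_conj_mul_conj hr hm
  refine comm_eq_comm_of_mul_eq_one (x := x) (v := v) (h.commute_conj hr hx)
    (h.mul_conj_mul_conj hr hx) (h.mul_conj_mul_conj hr hv) ?_
  rw [← key]
  have e2 : r * (r⁻¹ * x * r * v * (r * x * r⁻¹)) * r⁻¹ =
      x * (r * v * r⁻¹) * ((r * r) * x * (r⁻¹ * r⁻¹)) := by group
  have e3 : r⁻¹ * (r⁻¹ * x * r * v * (r * x * r⁻¹)) * r =
      ((r⁻¹ * r⁻¹) * x * (r * r)) * (r⁻¹ * v * r) * x := by group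
  rw [e2, e3, h3, h4]

theorem rotation_mul_rotation (h : TriPair p T d e) : d * e * (d * e) = (d * e)⁻¹ := by
  refine eq_inv_of_mul_eq_one_left ?_
  rw [← h.rotation_pow_three, pow_three, mul_assoc]

theorem exists_isPGroup_of_mem_conjDiff [Finite Γ] [Fact p.Prime] (h : TriPair p T d e)
    {x v r : Γ} (hr : r = d * e) (hx : x ∈ conjDiff T d) (hv : v ∈ conjDiff T d) :
    ∃ K : Subgroup Γ, IsPGroup p K ∧ x ∈ K ∧ v ∈ K ∧ ∀ g ∈ K, r * g * r⁻¹ ∈ K := by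
  have h3 : r * r = r⁻¹ := by rw [hr, h.rotation_mul_rotation]
  have h4 : r⁻¹ * r⁻¹ = r := by rw [← mul_inv_rev, h3, inv_inv]
  have hX1 : ∀ (y : Γ) (n : ℤ), (r * y * r⁻¹) ^ n = r * y ^ n * r⁻¹ := fun y n => conj_zpow
  have hX2 : ∀ (y : Γ) (n : ℤ), (r⁻¹ * y * r) ^ n = r⁻¹ * y ^ n * r := fun y n => by
    simpa using conj_zpow (a := r⁻¹) (b := y) (i := n)
  have hpx : ∀ y ∈ conjDiff T d, ∃ k : ℕ, (r * y * r⁻¹) ^ p ^ k = 1 ∧ (r⁻¹ * y * r) ^ p ^ k = 1 ∧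
      ((r * y * r⁻¹)⁻¹) ^ p ^ k = 1 ∧ ((r⁻¹ * y * r)⁻¹) ^ p ^ k = 1 := by
    intro y hy
    obtain ⟨k, hk⟩ := h.exists_pow_of_mem_conjDiff hy
    have hk2 : (r⁻¹ * y * r) ^ p ^ k = 1 := by
      simpa [hk] using conj_pow (a := r⁻¹) (b := y) (i := p ^ k)
    refine ⟨k, conj_pow_eq_one_iff.2 hk, hk2, ?_, ?_⟩
    · rw [inv_pow, conj_pow_eq_one_iff.2 hk, inv_one]
    · rw [inv_pow, hk2, inv_one]
  obtain ⟨kx, hkx⟩ := hpx x hx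
  obtain ⟨kv, hkv⟩ := hpx v hv
  have hxx := h.mul_conj_mul_conj hr hx
  have hvv := h.mul_conj_mul_conj hr hv
  have hx12 := h.commute_conj hr hx
  have hv12 := h.commute_conj hr hv
  have hflip : ∀ y ∈ conjDiff T d, d * (r * y * r⁻¹) * d = (r⁻¹ * y * r)⁻¹ := by
    intro y hy
    rw [h.conj_conj hr, h.conj_eq_inv_of_mem_conjDiff hy]
    group
  have hT : ∀ y ∈ conjDiff T d, r * y * r⁻¹ ∈ T := fun y hy => by
    rw [hr]
    exact h.rotation_conj_mem (h.mem_of_mem_conjDiff hy)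
  have hstab : ∀ y ∈ conjDiff T d, ∀ m ∈ conjDiff T d,
      (r⁻¹ * y * r)⁻¹ * m * (r * y * r⁻¹)⁻¹ ∈ conjDiff T d := by
    intro y hy m hm
    rw [← hflip y hy]
    exact h.stable_conjDiff hm (hT y hy)
  have hstab' : ∀ y ∈ conjDiff T d, ∀ m ∈ conjDiff T d,
      (r⁻¹ * y * r) * m * (r * y * r⁻¹) ∈ conjDiff T d := by
    intro y hy m hm
    have := hstab y⁻¹ (by simpa using h.zpow_mem_conjDiff hy (-1)) m hm
    simpa [mul_assoc] using this
  set a := r * x * r⁻¹ with ha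
  set a' := r⁻¹ * x * r with ha'
  set b := r⁻¹ * v * r with hb
  set c := r * v * r⁻¹ with hc
  have hx' : x = (a * a')⁻¹ := eq_inv_of_mul_eq_one_left (by rwa [← mul_assoc])
  have hv' : v = (c * b)⁻¹ := eq_inv_of_mul_eq_one_left (by rwa [← mul_assoc])
  have hf : ∀ n m, zpowComm a b n m = zpowComm a'⁻¹ c⁻¹ n m := by
    intro n m
    have := h.comm_eq_comm hr (h.zpow_mem_conjDiff hx n) (h.zpow_mem_conjDiff hv m)
    rw [← hX1, ← hX1, ← hX2, ← hX2] at this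
    simp only [zpowComm, inv_zpow, inv_inv]
    exact this.symm
  obtain ⟨E, hEle, hE1, hE2, hEn, hEc⟩ := zpowComm_properties hf
  simp only [inv_inv] at hEc
  set K := Subgroup.closure {a, a'⁻¹, b, c⁻¹} with hK
  have haK : a ∈ K := Subgroup.subset_closure (by simp)
  have ha'K : a' ∈ K := inv_mem_iff.1 (Subgroup.subset_closure (by simp))
  have hbK : b ∈ K := Subgroup.subset_closure (by simp)
  have hcK : c ∈ K := inv_mem_iff.1 (Subgroup.subset_closure (by simp))
  have hgen : ∀ s ∈ ({a, a'⁻¹, b, c⁻¹} : Set Γ), ∃ k : ℕ, s ^ p ^ k = 1 := by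
    rintro s (rfl | rfl | rfl | rfl)
    exacts [⟨kx, hkx.1⟩, ⟨kx, hkx.2.2.2⟩, ⟨kv, hkv.2.1⟩, ⟨kv, hkv.2.2.1⟩]
  have hpow : ∀ g ∈ K, ∃ k : ℕ, g ^ p ^ k ∈ E := by
    have hEK := conj_mem_of_closure hEn
    have hle : K ≤ Subgroup.closure {a, a', b, c} := by
      rw [hK, Subgroup.closure_le]
      rintro s (rfl | rfl | rfl | rfl)
      exacts [Subgroup.subset_closure (by simp), inv_mem (Subgroup.subset_closure (by simp)),
        Subgroup.subset_closure (by simp), inv_mem (Subgroup.subset_closure (by simp))]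
    have hstable := exists_pow_mem_of_stable (p := p) (a := a) (a' := a') (b := b) (c := c)
      (M := conjDiff T d) (E := E) ?_ ?_ ?_ ?_ ?_ ?_ (one_mem_conjDiff T d)
      (fun m hm => h.exists_pow_of_mem_conjDiff hm) (hstab' x hx) (hstab x hx) (hstab' v hv)
      (hstab v hv)
    · exact fun g hg => hstable g (hle hg)
    · rintro s (rfl | rfl | rfl | rfl)
      exacts [hEK _ haK, hEK _ ha'K, hEK _ hbK, hEK _ hcK]
    · rintro s (rfl | rfl | rfl | rfl)
      exacts [⟨kx, hkx.1⟩, ⟨kx, hkx.2.1⟩, ⟨kv, hkv.2.1⟩, ⟨kv, hkv.1⟩]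
    · rw [hx12.eq, mul_inv_cancel_right, mul_inv_cancel]
      exact E.one_mem
    · have := E.inv_mem hE1
      simpa [mul_assoc] using this
    · have := hEK _ (mul_mem ha'K hcK) _ hE2
      simpa [mul_assoc] using this
    · rw [hv12.eq, mul_inv_cancel_right, mul_inv_cancel]
      exact E.one_mem
  have hxK : x ∈ K := hx' ▸ inv_mem (mul_mem haK ha'K)
  have hvK : v ∈ K := hv' ▸ inv_mem (mul_mem hcK hbK)
  have hconj : ∀ g ∈ K, r⁻¹ * g * r ∈ K := by
    intro g hg
    have : ∀ g ∈ K, r⁻¹ * g * r⁻¹⁻¹ ∈ K := by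
      refine conj_mem_closure ?_
      have e1 : r⁻¹ * a * r⁻¹⁻¹ = x := by rw [ha]; group
      have e2 : r⁻¹ * a'⁻¹ * r⁻¹⁻¹ = a⁻¹ := by
        have : r⁻¹ * a'⁻¹ * r⁻¹⁻¹ = (r⁻¹ * r⁻¹) * x⁻¹ * (r * r) := by rw [ha']; group
        rw [this, h3, h4, ha]
        group
      have e3 : r⁻¹ * b * r⁻¹⁻¹ = c := by
        have : r⁻¹ * b * r⁻¹⁻¹ = (r⁻¹ * r⁻¹) * v * (r * r) := by rw [hb]; group
        rw [this, h3, h4, hc]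
      have e4 : r⁻¹ * c⁻¹ * r⁻¹⁻¹ = v⁻¹ := by rw [hc]; group
      rintro s (rfl | rfl | rfl | rfl)
      · rwa [e1]
      · rw [e2]
        exact inv_mem haK
      · rwa [e3]
      · rw [e4]
        exact inv_mem hvK
    simpa using this g hg
  refine ⟨K, ?_, hxK, hvK, fun g hg => ?_⟩
  swap
  · have := hconj _ (hconj g hg)
    have e : r⁻¹ * (r⁻¹ * g * r) * r = (r⁻¹ * r⁻¹) * g * (r * r) := by group
    rwa [e, h3, h4] at this
  rw [isPGroup_subgroup_iff]
  have hbot := exists_pow_mem_of_pow_central (E := ⊥) hgen (by simp) ?_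
  · simpa using hbot
  intro g hg
  obtain ⟨k, hk⟩ := hpow g hg
  obtain ⟨l, hl⟩ := hpow _ (hconj g hg)
  have hmono : ∀ {z : Γ} {i j : ℕ}, z ^ p ^ i ∈ E → i ≤ j → z ^ p ^ j ∈ E := by
    intro z i j hz hij
    obtain ⟨m, rfl⟩ := Nat.exists_eq_add_of_le hij
    rw [pow_add, pow_mul]
    exact E.pow_mem hz _
  refine ⟨max k l, ?_⟩
  have hgk := hEc _ (hmono hk (le_max_left k l))
  have hgl := hEc _ (hmono hl (le_max_right k l))
  set N := p ^ max k l
  have e5 : (r⁻¹ * g * r) ^ N = r⁻¹ * g ^ N * r := by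
    simpa using conj_pow (a := r⁻¹) (b := g) (i := N)
  have hconjc : ∀ {y z : Γ}, Commute (r⁻¹ * y * r) z → Commute y (r * z * r⁻¹) := by
    intro y z hyz
    have := hyz.map (MulAut.conj r).toMonoidHom
    simpa [mul_assoc] using this
  rw [e5] at hgl
  have hx'' : x⁻¹ = a' * a := by rw [hx', inv_inv, hx12.eq]
  have hv'' : v⁻¹ = c * b := by rw [hv', inv_inv]
  have ca : Commute (g ^ N) a := by
    have := hconjc (hx''.symm ▸ hgl.1)
    have e : r * x⁻¹ * r⁻¹ = a⁻¹ := by rw [ha]; group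
    rw [e] at this
    simpa using this.inv_right
  have cc : Commute (g ^ N) c := by
    have := hconjc (hv''.symm ▸ hgl.2)
    have e : r * v⁻¹ * r⁻¹ = c⁻¹ := by rw [hc]; group
    rw [e] at this
    simpa using this.inv_right
  have ca' : Commute (g ^ N) a' := by
    simpa [mul_assoc] using hgk.1.mul_right ca.inv_right
  have cb : Commute (g ^ N) b := by
    simpa [mul_assoc] using cc.inv_right.mul_right hgk.2
  rintro s hs
  rw [Subgroup.mem_bot, mul_inv_eq_one, mul_inv_eq_iff_eq_mul]
  rcases hs with rfl | rfl | rfl | rfl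
  exacts [ca, ca'.inv_right, cb, cc.inv_right]

end TriPair

end TwoLines

section Three

variable {Γ : Type*} [Group Γ] {p : ℕ}

namespace TriPair

variable {T : Subgroup Γ} {d e : Γ}

theorem conj_mem_second (h : TriPair p T d e) {x w : Γ} (hx : x ∈ conjOrbit T d)
    (hw : w ∈ conjOrbit T (d * e * d)) : x * w * x ∈ conjOrbit T e := by
  have := h.third.conj_mem_third hx hw
  have hdd : ∀ z, d * (d * z) = z := fun z => by rw [← mul_assoc, h.sq_d, one_mul]
  simpa [mul_assoc, hdd, h.sq_d] using this

theorem conj_mem_third' (h : TriPair p T d e) {x y : Γ} (hx : x ∈ conjOrbit T d)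
    (hy : y ∈ conjOrbit T e) : y * x * y ∈ conjOrbit T (d * e * d) := by
  rw [h.braid]
  exact h.symm.conj_mem_third hy hx

theorem conj_mem_first (h : TriPair p T d e) {y w : Γ} (hy : y ∈ conjOrbit T e)
    (hw : w ∈ conjOrbit T (d * e * d)) : y * w * y ∈ conjOrbit T d := by
  rw [h.braid] at hw
  exact h.symm.conj_mem_second hy hw

theorem isPGroup_closure_mul_pair [Finite Γ] (h : TriPair 3 T d e) {x y x' y' : Γ}
    (hx : x ∈ conjOrbit T d) (hy : y ∈ conjOrbit T e) (hx' : x' ∈ conjOrbit T d)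
    (hy' : y' ∈ conjOrbit T e) : IsPGroup 3 (Subgroup.closure {x * y, x' * y'}) := by
  have : Fact (Nat.Prime 3) := ⟨Nat.prime_three⟩
  have hb := h.base_change hx hy
  have hx0 : ∀ {z : Γ}, z ∈ conjOrbit T d → x * z ∈ conjDiff T x := fun hz =>
    hb.mul_mem_conjDiff (by rwa [conjOrbit_eq_of_mem hx])
  have hz : y * (x * y' * x) * y ∈ conjOrbit T d :=
    h.conj_mem_first hy (h.conj_mem_third hx hy')
  obtain ⟨K, hK, h1, h2, hKr⟩ := hb.exists_isPGroup_of_mem_conjDiff rfl (hx0 hx') (hx0 hz)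
  have hxi : x⁻¹ = x := inv_eq_of_mul_eq_one_right hb.sq_d
  have hyi : y⁻¹ = y := inv_eq_of_mul_eq_one_right hb.sq_e
  have hxx : ∀ z, x * (x * z) = z := fun z => by rw [← mul_assoc, hb.sq_d, one_mul]
  have hyy : ∀ z, y * (y * z) = z := fun z => by rw [← mul_assoc, hb.sq_e, one_mul]
  have h3 : y * y' ∈ K := by
    have := hKr _ h2
    have hbr : ∀ z, x * (y * (x * z)) = y * (x * (y * z)) := fun z => by
      simpa [mul_assoc] using congrArg (· * z) hb.braid
    simpa [mul_assoc, hxi, hyi, hxx, hyy, hbr, hb.sq_d] using this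
  have hr : IsPGroup 3 (Subgroup.zpowers (x * y)) :=
    isPGroup_zpowers (k := 1) (by simpa using hb.rotation_pow_three)
  refine (hr.sup_of_conj hK ?_).to_le ((Subgroup.closure_le _).2 ?_)
  · rw [Subgroup.zpowers_eq_closure]
    refine conj_mem_of_closure ?_
    rintro s rfl
    exact hKr
  · rintro s (rfl | rfl)
    · exact Subgroup.mem_sup_left (Subgroup.mem_zpowers _)
    · have e : (x * x')⁻¹ * (x * y) * (y * y') = x' * y' := by
        have hxi' : x'⁻¹ = x' :=
          inv_eq_of_mul_eq_one_right (mul_self_of_mem_conjOrbit h.sq_d hx')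
        simp [mul_assoc, hxi, hxi', hxx, hyy]
      rw [← e]
      exact mul_mem (mul_mem (Subgroup.mem_sup_right (inv_mem h1))
        (Subgroup.mem_sup_left (Subgroup.mem_zpowers _))) (Subgroup.mem_sup_right h3)

theorem isPGroup_triCore_three [Finite Γ] (h : TriPair 3 T d e) :
    IsPGroup 3 (triCore T d e) := by
  have : Fact (Nat.Prime 3) := ⟨Nat.prime_three⟩
  have hinv : ∀ {z u : Γ}, z * z = 1 → u ∈ conjOrbit T z → u⁻¹ = u := fun hz hu =>
    inv_eq_of_mul_eq_one_right (mul_self_of_mem_conjOrbit hz hu)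
  have hmul : ∀ {z u : Γ}, z * z = 1 → u ∈ conjOrbit T z → ∀ t, u * (u * t) = t :=
    fun hz hu t => by rw [← mul_assoc, mul_self_of_mem_conjOrbit hz hu, one_mul]
  have hX : IsPGroup 3 (Subgroup.closure (conjOrbit T d * conjOrbit T e)) := by
    refine isPGroup_closure_of_pairs ?_ ?_
    · rintro _ ⟨u, hu, v, hv, rfl⟩ _ ⟨x, hx, y, hy, rfl⟩
      have h1 : u * (v * x * v) * u ∈ conjOrbit T e :=
        h.conj_mem_second hu (h.conj_mem_third' hx hv)
      have h2 : u * (v * y * v) * u ∈ conjOrbit T (d * e * d) :=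
        h.conj_mem_third hu (conj_mem_conjOrbit_of_mem h.sq_e h.conj_e hv hy)
      refine ⟨_, h.conj_mem_first h1 h2, _, h1, ?_⟩
      simp only [mul_inv_rev, hinv h.sq_d hu, hinv h.sq_e hv, mul_assoc, hmul h.sq_d hu,
        hmul h.sq_e hv, hmul h.sq_d hx]
    · rintro _ ⟨u, hu, v, hv, rfl⟩ _ ⟨x, hx, y, hy, rfl⟩
      exact h.isPGroup_closure_mul_pair hu hv hx hy
  have hmem : ∀ {x y : Γ}, x ∈ conjOrbit T d → y ∈ conjOrbit T e →
      x * y ∈ Subgroup.closure (conjOrbit T d * conjOrbit T e) := fun hx hy =>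
    Subgroup.subset_closure ⟨_, hx, _, hy, rfl⟩
  refine hX.to_le ((Subgroup.closure_le _).2 ?_)
  have hd := mem_conjOrbit_self T d
  have he := mem_conjOrbit_self T e
  rintro _ ((⟨x, hx, y, hy, rfl⟩ | ⟨x, hx, y, hy, rfl⟩) | ⟨x, hx, y, hy, rfl⟩)
  · have := mul_mem (hmem hx he) (inv_mem (hmem hy he))
    simpa [mul_inv_rev, hinv h.sq_d hy, mul_assoc, hinv h.sq_e he, hmul h.sq_e he] using this
  · have := mul_mem (inv_mem (hmem hd hx)) (hmem hd hy)
    simpa [mul_inv_rev, hinv h.sq_e hx, mul_assoc, hinv h.sq_d hd, hmul h.sq_d hd] using this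
  · have := mul_mem (hmem hd (h.conj_mem_second hd hx))
      (inv_mem (hmem hd (h.conj_mem_second hd hy)))
    simpa [mul_inv_rev, hinv h.third.sq_e hy, mul_assoc, hinv h.sq_d hd, hmul h.sq_d hd]
      using this

end TriPair

end Three

section Large

variable {Γ : Type*} [Group Γ] {p : ℕ}

theorem exists_pow_conj_eq {d x : Γ} {k : ℕ} (hp : Odd p) (hd : d * d = 1) (hx : x * x = 1)
    (hk : (x * d) ^ p ^ k = 1) : ∃ j : ℕ, (x * d) ^ j * d * ((x * d) ^ j)⁻¹ = x := by
  obtain ⟨j, hj⟩ := (hp.pow (n := k)).add_one.two_dvd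
  refine ⟨j, ?_⟩
  have hd' : d⁻¹ = d := inv_eq_of_mul_eq_one_right hd
  have hx' : x⁻¹ = x := inv_eq_of_mul_eq_one_right hx
  have h1 : d * ((x * d) ^ j)⁻¹ = (x * d) ^ j * d := by
    have : d * (x * d)⁻¹ * d⁻¹ = x * d := by
      rw [mul_inv_rev, hd', hx', ← mul_assoc, hd, one_mul]
    rw [← inv_pow]
    calc d * ((x * d)⁻¹) ^ j = (d * (x * d)⁻¹ * d⁻¹) ^ j * d := by rw [conj_pow]; group
      _ = _ := by rw [this]
  rw [mul_assoc, h1, ← mul_assoc, ← pow_add, ← two_mul, ← hj, pow_add, hk, one_mul, pow_one,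
    mul_assoc, hd, mul_one]

theorem card_conjOrbit_eq_relIndex [Finite Γ] (T : Subgroup Γ) (x : Γ) :
    Nat.card (conjOrbit T x) = (T ⊓ Subgroup.centralizer {x}).relIndex T := by
  have h1 := card_conjOrbit_mul T x
  have h2 := Subgroup.relIndex_mul_relIndex ⊥ (T ⊓ Subgroup.centralizer {x}) T bot_le inf_le_left
  rw [Subgroup.relIndex_bot_left, Subgroup.relIndex_bot_left] at h2
  exact Nat.eq_of_mul_eq_mul_left Nat.card_pos ((mul_comm _ _).trans (h1.trans h2.symm))

theorem IsPGroup.exists_ge_not_dvd_relIndex [Finite Γ] [Fact p.Prime] {R T : Subgroup Γ}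
    (hR : IsPGroup p R) (hRT : R ≤ T) :
    ∃ P, R ≤ P ∧ P ≤ T ∧ IsPGroup p P ∧ ¬ p ∣ P.relIndex T := by
  have hR' : IsPGroup p (R.subgroupOf T) := hR.comap_of_injective _ T.subtype_injective
  obtain ⟨P, hP⟩ := hR'.exists_le_sylow
  refine ⟨(P : Subgroup T).map T.subtype, ?_, Subgroup.map_subtype_le _, P.2.map _, ?_⟩
  · rw [← Subgroup.map_subgroupOf_eq_of_le hRT]
    exact Subgroup.map_mono hP
  · have := P.not_dvd_index
    rwa [Subgroup.relIndex, ← Subgroup.comap_subtype,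
      Subgroup.comap_map_eq_self_of_injective T.subtype_injective]

theorem exists_isTwoGroup_not_central [Finite Γ] {q : ℕ} [Fact p.Prime] [Fact q.Prime]
    (hpq : q ≠ p) {L : Subgroup Γ} {e : Γ} (he : e * e = 1) (hL : ∀ g ∈ L, e * g * e ∈ L)
    (hpow : ∀ g ∈ L, ∃ k : ℕ, (g * e * g⁻¹ * e) ^ p ^ k = 1)
    (hq : q ∣ (L ⊓ Subgroup.centralizer {e}).relIndex L) :
    ∃ t ∈ L, (∃ k : ℕ, t ^ 2 ^ k = 1) ∧ ∃ g ∈ L, g * t * g⁻¹ ≠ t := by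
  by_contra! hcon
  have he' : e⁻¹ = e := inv_eq_of_mul_eq_one_right he
  have hee : ∀ z, e * (e * z) = z := fun z => by rw [← mul_assoc, he, one_mul]
  have : Fact (Nat.Prime 2) := ⟨Nat.prime_two⟩
  have : Finite (MulAut L) := Finite.of_injective (fun f : MulAut L => (f : L → L))
    DFunLike.coe_injective
  have hodd : ¬ 2 ∣ Nat.card (Sylow q L) := by
    obtain ⟨A⟩ : Nonempty (Sylow q L) := inferInstance
    obtain ⟨B⟩ : Nonempty (Sylow 2 L) := inferInstance
    rw [A.card_eq_index_normalizer]
    intro h2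
    refine B.not_dvd_index (h2.trans (Subgroup.index_dvd_of_le fun b hb => ?_))
    obtain ⟨k, hk⟩ := isPGroup_subgroup_iff.1 B.2 b hb
    have hc : ∀ g : L, g * b = b * g := fun g => by
      have := hcon b b.2 ⟨k, by exact_mod_cast congrArg Subtype.val hk⟩ g g.2
      exact Subtype.ext (mul_inv_eq_iff_eq_mul.1 this)
    refine Subgroup.mem_normalizer_iff (H := (A : Subgroup L)) |>.2 fun g => ?_
    rw [← hc g, mul_inv_cancel_right]
  let f : MulAut L :=
    { toFun := fun g => ⟨e * g * e, hL g g.2⟩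
      invFun := fun g => ⟨e * g * e, hL g g.2⟩
      left_inv := fun g => Subtype.ext (by simp [mul_assoc, hee, he])
      right_inv := fun g => Subtype.ext (by simp [mul_assoc, hee, he])
      map_mul' := fun a b => Subtype.ext (by simp [mul_assoc, hee]) }
  have hf : ∀ g : L, ((f g : L) : Γ) = e * g * e := fun g => rfl
  have hff : f ^ 2 = 1 := by
    ext g
    rw [pow_two, MulAut.mul_apply, hf, hf]
    simp [mul_assoc, hee, he]
  have hZ : IsPGroup 2 (Subgroup.zpowers f) := isPGroup_zpowers (k := 1) (by rwa [pow_one])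
  obtain ⟨A, hA⟩ := hZ.nonempty_fixed_point_of_prime_not_dvd_card (Sylow q L) hodd
  have hfA : ∀ a ∈ A, f a ∈ A := fun a ha => by
    have h1 := hA ⟨f, Subgroup.mem_zpowers f⟩
    have h2 : f • A = A := h1
    rw [← h2]
    exact Subgroup.smul_mem_pointwise_smul a f (A : Subgroup L) ha
  have hAc : (A : Subgroup L) ≤ (L ⊓ Subgroup.centralizer {e}).subgroupOf L := by
    intro a ha
    rw [Subgroup.mem_subgroupOf]
    refine ⟨a.2, mem_centralizer_singleton.2 ?_⟩
    have h1 : a * (f a)⁻¹ ∈ A := mul_mem ha (inv_mem (hfA a ha))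
    obtain ⟨k, hk⟩ := isPGroup_subgroup_iff.1 A.2 _ h1
    obtain ⟨l, hl⟩ := hpow a a.2
    have h2 : ((a * (f a)⁻¹ : L) : Γ) = a * e * (a : Γ)⁻¹ * e := by
      simp [hf, he', mul_assoc]
    have hk' := congrArg Subtype.val hk
    rw [Subgroup.coe_pow, h2] at hk'
    have h3 : a * e * (a : Γ)⁻¹ * e = 1 := by
      have hco : Nat.Coprime (q ^ k) (p ^ l) := Nat.Coprime.pow _ _
        ((Nat.coprime_primes Fact.out Fact.out).2 hpq)
      rw [← orderOf_eq_one_iff]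
      exact Nat.eq_one_of_dvd_coprimes hco (orderOf_dvd_of_pow_eq_one hk')
        (orderOf_dvd_of_pow_eq_one hl)
    rw [eq_inv_of_mul_eq_one_left h3, he']
  exact A.not_dvd_index (hq.trans (Subgroup.index_dvd_of_le hAc))

theorem eq_one_or_eq_of_mem_zpowers {d g : Γ} (hd : d * d = 1) (hg : g ∈ Subgroup.zpowers d) :
    g = 1 ∨ g = d := by
  obtain ⟨n, rfl⟩ := hg
  rcases Int.even_or_odd' n with ⟨k, rfl | rfl⟩
  · left
    simp only [zpow_mul, zpow_ofNat, pow_two, hd, one_zpow]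
  · right
    simp only [zpow_add, zpow_mul, zpow_ofNat, pow_two, hd, one_zpow, one_mul, pow_one]

namespace TriPair

variable {T : Subgroup Γ} {d e : Γ}

theorem conj_first_mul (h : TriPair p T d e) {m : Γ} (hm : m ∈ conjDiff T d) :
    d * (e * m * e) * d = m⁻¹ * (e * m * e) ∧ Commute m (e * m * e) := by
  have hd' : d⁻¹ = d := inv_eq_of_mul_eq_one_right h.sq_d
  have he' : e⁻¹ = e := inv_eq_of_mul_eq_one_right h.sq_e
  have h1 := h.mul_conj_mul_conj rfl hm
  have h2 := h.commute_conj rfl hm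
  have h3 : (d * e)⁻¹ * m * (d * e) = (e * m * e)⁻¹ := by
    have : (d * e)⁻¹ * m * (d * e) = e * (d * m * d) * e := by simp [hd', he', mul_assoc]
    rw [this, h.conj_eq_inv_of_mem_conjDiff hm]
    simp [he', mul_assoc]
  have h4 : d * e * m * (d * e)⁻¹ = d * (e * m * e) * d := by simp [hd', he', mul_assoc]
  rw [h3, h4] at h1 h2
  have h5 : d * (e * m * e) * d = m⁻¹ * (e * m * e) :=
    eq_inv_mul_of_mul_eq (mul_inv_eq_one.1 h1)
  refine ⟨h5, ?_⟩
  rw [h5, Commute.inv_right_iff] at h2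
  have h6 : Commute m⁻¹ (e * m * e) := by
    have := h2.mul_left (Commute.refl (e * m * e)).inv_left
    rwa [mul_inv_cancel_right] at this
  exact Commute.inv_left_iff.1 h6

theorem conj_conj_self (h : TriPair p T d e) (m : Γ) : e * (e * m * e) * e = m := by
  have hee : ∀ z, e * (e * z) = z := fun z => by rw [← mul_assoc, h.sq_e, one_mul]
  simp [mul_assoc, hee, h.sq_e]

theorem exists_commute_conj_eq [Fact p.Prime] (hp3 : p ≠ 3) (h : TriPair p T d e) {x : Γ}
    (hx : x ∈ conjOrbit T d) : ∃ g ∈ T, g * e * g⁻¹ = e ∧ g * d * g⁻¹ = x := by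
  have hd' : d⁻¹ = d := inv_eq_of_mul_eq_one_right h.sq_d
  have he' : e⁻¹ = e := inv_eq_of_mul_eq_one_right h.sq_e
  have hdd : ∀ z, d * (d * z) = z := fun z => by rw [← mul_assoc, h.sq_d, one_mul]
  have hee : ∀ z, e * (e * z) = z := fun z => by rw [← mul_assoc, h.sq_e, one_mul]
  have hm := h.mul_mem_conjDiff hx
  obtain ⟨m, rfl⟩ : ∃ m, x = d * m := ⟨d * x, (hdd x).symm⟩
  rw [hdd] at hm
  obtain ⟨k, hk⟩ := h.exists_pow_of_mem_conjDiff hm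
  obtain ⟨h1, h2⟩ := h.conj_first_mul hm
  have hco : Nat.Coprime 3 (p ^ k) := Nat.Coprime.pow_right _
    ((Nat.coprime_primes Nat.prime_three Fact.out).2 hp3.symm)
  obtain ⟨j, hj⟩ : ∃ j : ℤ, m ^ (3 * j) = m⁻¹ := by
    have := Nat.gcd_eq_gcd_ab 3 (p ^ k)
    rw [hco.gcd_eq_one] at this
    refine ⟨-(Nat.gcdA 3 (p ^ k)), ?_⟩
    have h3 : (3 : ℤ) * -(Nat.gcdA 3 (p ^ k)) = -1 + (p ^ k : ℕ) * Nat.gcdB 3 (p ^ k) := by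
      push_cast at this ⊢
      linarith
    rw [h3, zpow_add, zpow_mul, zpow_natCast, hk, one_zpow, mul_one, zpow_neg_one]
  have hmT := h.mem_of_mem_conjDiff hm
  set v := e * m * e with hv
  have hvm : e * v * e = m := h.conj_conj_self m
  refine ⟨(m * v) ^ j, T.zpow_mem (T.mul_mem hmT (h.conj_e _ hmT)) j, ?_, ?_⟩
  · have h3 : Commute (m * v) e := by
      calc m * v * e = e * (e * m * e) * (e * v * e) := by
            simp [mul_assoc, hee]
        _ = e * (m * v) := by rw [← hv, hvm, mul_assoc, h2.eq]
    rw [(h3.zpow_left j).eq, mul_inv_cancel_right]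
  · have h3 : d * (m * v) ^ j * d⁻¹ = (m⁻¹ * (m⁻¹ * v)) ^ j := by
      rw [← conj_zpow, ← h1, ← h.conj_eq_inv_of_mem_conjDiff hm]
      congr 1
      simp [mul_assoc, hd', hdd]
    have h4 : (m⁻¹ * (m⁻¹ * v)) ^ j * ((m * v) ^ j)⁻¹ = m := by
      rw [h2.mul_zpow, ((Commute.refl m⁻¹).mul_right h2.inv_left).mul_zpow,
        h2.inv_left.mul_zpow]
      have h5 : m ^ (3 * j) = m ^ j * m ^ j * m ^ j := by
        rw [← zpow_add, ← zpow_add]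
        congr 1
        ring
      refine Eq.trans ?_ (show (m ^ j * m ^ j * m ^ j)⁻¹ = m by rw [← h5, hj, inv_inv])
      group
    calc (m * v) ^ j * d * ((m * v) ^ j)⁻¹
        = d * (d * (m * v) ^ j * d⁻¹) * ((m * v) ^ j)⁻¹ := by
          simp [mul_assoc, hdd, hd']
      _ = d * m := by rw [h3, mul_assoc, h4]

theorem conjOrbit_inf_centralizer [Fact p.Prime] (hp3 : p ≠ 3) (h : TriPair p T d e) :
    conjOrbit (T ⊓ Subgroup.centralizer {e}) d = conjOrbit T d := by
  refine (conjOrbit_mono inf_le_left d).antisymm fun x hx => ?_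
  obtain ⟨g, hg, h1, h2⟩ := h.exists_commute_conj_eq hp3 hx
  exact ⟨g, ⟨hg, mem_centralizer_singleton.2 h1⟩, h2⟩

theorem card_conjOrbit_eq (h : TriPair p T d e) :
    Nat.card (conjOrbit T d) = Nat.card (conjOrbit T e) := by
  have hd' : d⁻¹ = d := inv_eq_of_mul_eq_one_right h.sq_d
  have hdd : ∀ z, d * (d * z) = z := fun z => by rw [← mul_assoc, h.sq_d, one_mul]
  have hee : ∀ z, e * (e * z) = z := fun z => by rw [← mul_assoc, h.sq_e, one_mul]
  refine Nat.card_congr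
    { toFun := fun x => ⟨d * (e * x * e) * d, ?_⟩
      invFun := fun x => ⟨e * (d * x * d) * e, ?_⟩
      left_inv := fun x => Subtype.ext (by simp [mul_assoc, hdd, hee, h.sq_d, h.sq_e])
      right_inv := fun x => Subtype.ext (by simp [mul_assoc, hdd, hee, h.sq_d, h.sq_e]) }
  · have := conj_involution_mem h.sq_d h.conj_d (conj_involution_mem h.sq_e h.conj_e x.2)
    rw [← h.braid] at this
    simpa [mul_assoc, hdd, h.sq_d] using this
  · have := conj_involution_mem h.sq_e h.conj_e (conj_involution_mem h.sq_d h.conj_d x.2)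
    rw [h.braid] at this
    simpa [mul_assoc, hee, h.sq_e] using this

theorem not_two_dvd_card_conjOrbit [Finite Γ] (hp : Odd p) (h : TriPair p T d e) :
    ¬ 2 ∣ Nat.card (conjOrbit T d) := by
  have : Fact (Nat.Prime 2) := ⟨Nat.prime_two⟩
  have hd' : d⁻¹ = d := inv_eq_of_mul_eq_one_right h.sq_d
  have hZ : IsPGroup 2 (Subgroup.zpowers d) :=
    isPGroup_zpowers (k := 1) (by rw [pow_one, pow_two, h.sq_d])
  have key := card_conj_fixed_modEq hZ (conjOrbit T d) fun g hg x hx => by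
    rcases eq_one_or_eq_of_mem_zpowers h.sq_d hg with rfl | rfl
    · simpa using hx
    · have := conj_involution_mem h.sq_d h.conj_d hx
      rw [h.sq_d, one_mul] at this
      rwa [hd']
  have : conjOrbit T d ∩ {x | ∀ g ∈ Subgroup.zpowers d, g * x * g⁻¹ = x} = {d} := by
    ext x
    simp only [Set.mem_inter_iff, Set.mem_ofPred_eq, Set.mem_singleton_iff]
    constructor
    · rintro ⟨hx, hfix⟩
      have h1 := hfix d (Subgroup.mem_zpowers d)
      obtain ⟨k, hk⟩ := h.exists_mul_pow hx (mem_conjOrbit_self T d)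
      obtain ⟨j, hj⟩ := hp.pow (n := k)
      have h2 : (x * d) ^ 2 = 1 := by
        have : x * d = d * x := (mul_inv_eq_iff_eq_mul.1 h1).symm
        rw [pow_two]
        nth_rw 1 [this]
        rw [mul_assoc, ← mul_assoc x, mul_self_of_mem_conjOrbit h.sq_d hx, one_mul, h.sq_d]
      rw [hj, pow_add, pow_mul, h2, one_pow, one_mul, pow_one] at hk
      rw [eq_inv_of_mul_eq_one_left hk, hd']
    · rintro rfl
      refine ⟨mem_conjOrbit_self T x, ?_⟩
      intro g hg
      rcases eq_one_or_eq_of_mem_zpowers h.sq_d hg with rfl | rfl <;> simp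
  rw [this] at key
  intro h2
  have := (Nat.modEq_zero_iff_dvd.2 h2).symm.trans key
  simp [Nat.ModEq] at this

end TriPair

theorem exists_mem_conj_fixed [Finite Γ] {q : ℕ} [Fact q.Prime] {Q : Subgroup Γ}
    (hQ : IsPGroup q Q) {X : Set Γ} (hX : ∀ g ∈ Q, ∀ x ∈ X, g * x * g⁻¹ ∈ X)
    (hq : ¬ q ∣ Nat.card X) : ∃ x ∈ X, ∀ g ∈ Q, g * x * g⁻¹ = x := by
  have key := card_conj_fixed_modEq hQ X hX
  by_contra! hcon
  have : X ∩ {x | ∀ g ∈ Q, g * x * g⁻¹ = x} = ∅ := by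
    ext x
    simp only [Set.mem_inter_iff, Set.mem_ofPred_eq, Set.mem_empty_iff_false, iff_false, not_and]
    intro hx hfix
    obtain ⟨g, hg, hne⟩ := hcon x hx
    exact hne (hfix g hg)
  rw [this] at key
  exact hq ((Nat.modEq_zero_iff_dvd).1 (by simpa using key))

theorem conj_mem_inf_centralizer {T Q : Subgroup Γ} {z : Γ} (hT : ∀ g ∈ T, z * g * z ∈ T)
    (hz : ∀ s ∈ Q, s * z * s⁻¹ = z) :
    ∀ g ∈ T ⊓ Subgroup.centralizer Q, z * g * z ∈ T ⊓ Subgroup.centralizer Q := by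
  refine fun g hg => ⟨hT g hg.1, Subgroup.mem_centralizer_iff.2 fun s hs => ?_⟩
  have h1 : Commute s z := mul_inv_eq_iff_eq_mul.1 (hz s hs)
  have h2 : Commute s g := Subgroup.mem_centralizer_iff.1 hg.2 s hs
  exact (h1.mul_right h2).mul_right h1

namespace TriPair

variable {T : Subgroup Γ} {d e : Γ}

theorem exists_pow_mem_conj_eq (hp : Odd p) (h : TriPair p T d e) {x y : Γ}
    (hx : x ∈ conjOrbit T d) (hy : y ∈ conjOrbit T d) :
    ∃ j : ℕ, (y * x) ^ j * x * ((y * x) ^ j)⁻¹ = y := by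
  obtain ⟨k, hk⟩ := h.exists_mul_pow hy hx
  exact exists_pow_conj_eq hp (mul_self_of_mem_conjOrbit h.sq_d hx)
    (mul_self_of_mem_conjOrbit h.sq_d hy) hk

/-- The conjugates of `d` centralising a subgroup `Q` that centralises `d` form a single class
under the centraliser of `Q`. -/
theorem conjOrbit_inf_centralizer_eq (hp : Odd p) (h : TriPair p T d e) {Q : Subgroup Γ}
    (hQ : ∀ g ∈ Q, g * d * g⁻¹ = d) :
    conjOrbit (T ⊓ Subgroup.centralizer Q) d =
      conjOrbit T d ∩ {x | ∀ g ∈ Q, g * x * g⁻¹ = x} := by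
  ext x
  constructor
  · rintro ⟨g, hg, rfl⟩
    refine ⟨⟨g, hg.1, rfl⟩, fun s hs => ?_⟩
    have h1 : Commute s g := Subgroup.mem_centralizer_iff.1 hg.2 s hs
    have h2 : Commute s d := mul_inv_eq_iff_eq_mul.1 (hQ s hs)
    exact mul_inv_eq_iff_eq_mul.2 ((h1.mul_right h2).mul_right h1.inv_right)
  · rintro ⟨hx, hfix⟩
    obtain ⟨j, hj⟩ := h.exists_pow_mem_conj_eq hp (mem_conjOrbit_self T d) hx
    refine ⟨_, ⟨pow_mem (mul_mem_of_mem_conjOrbit h.conj_d hx (mem_conjOrbit_self T d)) j,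
      pow_mem (Subgroup.mem_centralizer_iff.2 fun s hs => ?_) j⟩, hj⟩
    have h1 : Commute s x := mul_inv_eq_iff_eq_mul.1 (hfix s hs)
    have h2 : Commute s d := mul_inv_eq_iff_eq_mul.1 (hQ s hs)
    exact h1.mul_right h2

theorem card_conjOrbit_dvd_card_triCore [Finite Γ] (hp : Odd p) (h : TriPair p T d e) :
    Nat.card (conjOrbit T d) ∣ Nat.card (triCore T d e) := by
  have : conjOrbit T d = conjOrbit (triCore T d e) d := by
    refine Set.Subset.antisymm (fun x hx => ?_) (conjOrbit_mono h.triCore_le d)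
    obtain ⟨j, hj⟩ := h.exists_pow_mem_conj_eq hp (mem_conjOrbit_self T d) hx
    have hmem : x * d ∈ triCore T d e := Subgroup.subset_closure
      (Or.inl (Or.inl ⟨x, hx, d, mem_conjOrbit_self T d, rfl⟩))
    exact ⟨_, pow_mem hmem j, hj⟩
  rw [this]
  exact Dvd.intro _ (card_conjOrbit_mul _ d)

theorem card_conjOrbit_eq_pow [Finite Γ] [Fact p.Prime] (hp : Odd p) (hp3 : p ≠ 3)
    (h : TriPair p T d e)
    (ih : ∀ T' < T, ∀ d' e', TriPair p T' d' e' → IsPGroup p (triCore T' d' e')) :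
    ∃ n, Nat.card (conjOrbit T d) = p ^ n := by
  have : Fact (Nat.Prime 2) := ⟨Nat.prime_two⟩
  have : Nonempty (conjOrbit T d) := ⟨⟨d, mem_conjOrbit_self T d⟩⟩
  refine ⟨_, Nat.eq_prime_pow_of_unique_prime_dvd Nat.card_pos.ne' ?_⟩
  intro q hq hqd
  by_contra hqp
  have : Fact q.Prime := ⟨hq⟩
  obtain ⟨Q, -, hQH, hQ, hQn⟩ := (IsPGroup.of_bot (p := q)).exists_ge_not_dvd_relIndex
    (bot_le (a := T ⊓ Subgroup.centralizer {e}))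
  have hQe : ∀ g ∈ Q, g * e * g⁻¹ = e := fun g hg => mem_centralizer_singleton.1 (hQH hg).2
  have hQT : ∀ g ∈ Q, g ∈ T := fun g hg => (hQH hg).1
  obtain ⟨t, htL, ⟨k, hk⟩, s, hsL, hst⟩ := exists_isTwoGroup_not_central (p := p) (e := e)
    (L := T ⊓ Subgroup.centralizer Q) hqp h.sq_e (conj_mem_inf_centralizer h.conj_e hQe)
    (fun g hg => h.symm.ppow g hg.1) (by
      rw [← card_conjOrbit_eq_relIndex, h.symm.conjOrbit_inf_centralizer_eq hp hQe]
      refine (Nat.modEq_zero_iff_dvd).1 (Nat.ModEq.trans (Nat.ModEq.symm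
        (card_conj_fixed_modEq hQ _ fun g hg x hx => conj_mem_conjOrbit (hQT g hg) hx)) ?_)
      rw [← h.card_conjOrbit_eq]
      exact Nat.modEq_zero_iff_dvd.2 hqd)
  have htT : Subgroup.zpowers t ≤ T := (Subgroup.zpowers_le).2 htL.1
  have htQ : Subgroup.zpowers t ≤ Subgroup.centralizer Q := (Subgroup.zpowers_le).2 htL.2
  have hfix : ∀ {z : Γ}, ¬ 2 ∣ Nat.card (conjOrbit T z) →
      ∃ x ∈ conjOrbit T z, ∀ g ∈ Subgroup.zpowers t, g * x * g⁻¹ = x := fun hz =>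
    exists_mem_conj_fixed (isPGroup_zpowers hk)
      (fun g hg x hx => conj_mem_conjOrbit (htT hg) hx) hz
  obtain ⟨x, hx, hxt⟩ := hfix (h.not_two_dvd_card_conjOrbit hp)
  obtain ⟨y, hy, hyt⟩ := hfix (h.symm.not_two_dvd_card_conjOrbit hp)
  have hb := h.base_change hx hy
  have hT' : TriPair p (T ⊓ Subgroup.centralizer (Subgroup.zpowers t)) x y :=
    hb.mono inf_le_left (conj_mem_inf_centralizer hb.conj_d hxt)
      (conj_mem_inf_centralizer hb.conj_e hyt)
  have hlt : T ⊓ Subgroup.centralizer (Subgroup.zpowers t) < T := by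
    refine inf_le_left.lt_of_ne fun heq => hst ?_
    have := (heq.ge hsL.1).2
    exact mul_inv_eq_iff_eq_mul.2
      (Subgroup.mem_centralizer_iff.1 this t (Subgroup.mem_zpowers t)).symm
  obtain ⟨n, hn⟩ := IsPGroup.iff_card.1 (ih _ hlt x y hT')
  have hF := hT'.card_conjOrbit_dvd_card_triCore hp
  rw [hn] at hF
  obtain ⟨z, hz, hzQ⟩ := exists_mem_conj_fixed hQ
    (X := conjOrbit (T ⊓ Subgroup.centralizer (Subgroup.zpowers t)) x)
    (fun g hg z hz => conj_mem_conjOrbit ⟨hQT g hg, Subgroup.mem_centralizer_iff.2 fun s hs =>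
      (Subgroup.mem_centralizer_iff.1 (htQ hs) g hg).symm⟩ hz)
    (fun hdvd => hqp ((Nat.prime_dvd_prime_iff_eq hq Fact.out).1
      (hq.dvd_of_dvd_pow (hdvd.trans hF))))
  have hzd : z ∈ conjOrbit T d := by
    rw [← conjOrbit_eq_of_mem hx]
    exact conjOrbit_mono inf_le_left x hz
  refine hQn ?_
  have hle : Q ≤ T ⊓ Subgroup.centralizer {e} ⊓ Subgroup.centralizer {z} := fun g hg =>
    ⟨hQH hg, mem_centralizer_singleton.2 (hzQ g hg)⟩
  rw [← Subgroup.relIndex_mul_relIndex _ _ _ hle inf_le_left, ← card_conjOrbit_eq_relIndex]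
  refine Dvd.dvd.mul_left ?_ _
  rw [← h.conjOrbit_inf_centralizer hp3] at hzd hqd
  rwa [conjOrbit_eq_of_mem hzd]

end TriPair

theorem mul_mul_mem_sup {d : Γ} {A B : Subgroup Γ} (hd : d * d = 1)
    (hA : ∀ x ∈ A, d * x * d ∈ A ⊔ B) (hB : ∀ x ∈ B, d * x * d ∈ A ⊔ B) :
    ∀ x ∈ A ⊔ B, d * x * d ∈ A ⊔ B := by
  have hd' : d⁻¹ = d := inv_eq_of_mul_eq_one_right hd
  have : A ⊔ B ≤ (A ⊔ B).comap (MulAut.conj d).toMonoidHom :=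
    sup_le (fun x hx => by simpa [hd'] using hA x hx) fun x hx => by simpa [hd'] using hB x hx
  intro x hx
  simpa [hd'] using this hx

theorem mem_normalizer_of_mul_self {d : Γ} {R : Subgroup Γ} (hd : d * d = 1)
    (hR : ∀ x ∈ R, d * x * d ∈ R) : d ∈ Subgroup.normalizer (R : Set Γ) := by
  have hd' : d⁻¹ = d := inv_eq_of_mul_eq_one_right hd
  have hdd : ∀ z, d * (d * z) = z := fun z => by rw [← mul_assoc, hd, one_mul]
  refine Subgroup.mem_normalizer_iff.2 fun x => ⟨fun hx => by simpa [hd'] using hR x hx,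
    fun hx => ?_⟩
  simpa [hd', mul_assoc, hdd, hd] using hR _ hx

theorem mem_of_mem_zpowers_conj [Finite Γ] {R : Subgroup Γ} {g : Γ}
    (hg : ∀ x ∈ R, g * x * g⁻¹ ∈ R) : ∀ s ∈ Subgroup.zpowers g, ∀ x ∈ R, s * x * s⁻¹ ∈ R := by
  rw [Subgroup.zpowers_eq_closure]
  exact conj_mem_of_closure (by rintro _ rfl; exact hg)

namespace TriPair

variable {T : Subgroup Γ} {d e : Γ}

theorem triCore_le_of (h : TriPair p T d e) {R : Subgroup Γ} (hRd : ∀ x ∈ R, d * x * d ∈ R)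
    (h1 : ∀ m ∈ conjDiff T d, m ∈ R) (h2 : ∀ m ∈ conjDiff T e, m ∈ R) : triCore T d e ≤ R := by
  have key : ∀ {a b : Γ}, TriPair p T a b → (∀ m ∈ conjDiff T a, m ∈ R) →
      ∀ x ∈ conjOrbit T a, ∀ y ∈ conjOrbit T a, x * y ∈ R := by
    intro a b h' hm x hx y hy
    have := mul_mem (inv_mem (hm _ (h'.mul_mem_conjDiff hx))) (hm _ (h'.mul_mem_conjDiff hy))
    have hx' : x⁻¹ = x := inv_eq_of_mul_eq_one_right (mul_self_of_mem_conjOrbit h'.sq_d hx)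
    rwa [mul_inv_rev, hx', mul_assoc, inv_mul_cancel_left] at this
  refine (Subgroup.closure_le _).2 ?_
  rintro _ ((⟨x, hx, y, hy, rfl⟩ | ⟨x, hx, y, hy, rfl⟩) | ⟨x, hx, y, hy, rfl⟩)
  · exact key h h1 x hx y hy
  · exact key h.symm h2 x hx y hy
  · have hdd : ∀ z, d * (d * z) = z := fun z => by rw [← mul_assoc, h.sq_d, one_mul]
    have hx' := conj_involution_mem h.sq_d h.conj_d hx
    have hy' := conj_involution_mem h.sq_d h.conj_d hy
    have he : d * (d * e * d) * d = e := by simp [mul_assoc, hdd, h.sq_d]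
    rw [he] at hx' hy'
    simpa [mul_assoc, hdd, h.sq_d] using hRd _ (key h.symm h2 _ hx' _ hy')

theorem exists_isPGroup_of_mem_conjDiff' [Finite Γ] (h : TriPair p T d e) {m : Γ}
    (hm : m ∈ conjDiff T d) : ∃ A ≤ T, IsPGroup p A ∧ m ∈ A ∧ (∀ x ∈ A, d * x * d ∈ A) ∧
      ∀ x ∈ A, e * x * e ∈ A := by
  obtain ⟨h1, h2⟩ := h.conj_first_mul hm
  obtain ⟨k, hk⟩ := h.exists_pow_of_mem_conjDiff hm
  have hmT := h.mem_of_mem_conjDiff hm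
  have he' : e⁻¹ = e := inv_eq_of_mul_eq_one_right h.sq_e
  set v := e * m * e with hv
  have hvm : e * v * e = m := h.conj_conj_self m
  have hvk : v ^ p ^ k = 1 := by
    rw [hv]
    nth_rw 2 [← he']
    rw [conj_pow_eq_one_iff, hk]
  have hmA : m ∈ Subgroup.zpowers m ⊔ Subgroup.zpowers v :=
    Subgroup.mem_sup_left (Subgroup.mem_zpowers m)
  have hvA : v ∈ Subgroup.zpowers m ⊔ Subgroup.zpowers v :=
    Subgroup.mem_sup_right (Subgroup.mem_zpowers v)
  have hz : ∀ {a z : Γ}, a * a = 1 →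
      a * z * a ∈ Subgroup.zpowers m ⊔ Subgroup.zpowers v → ∀ x ∈ Subgroup.zpowers z,
      a * x * a ∈ Subgroup.zpowers m ⊔ Subgroup.zpowers v := by
    rintro a z ha hz _ ⟨n, rfl⟩
    have ha' : a⁻¹ = a := inv_eq_of_mul_eq_one_right ha
    have := zpow_mem hz n
    nth_rw 2 [← ha'] at this
    rwa [conj_zpow, ha'] at this
  refine ⟨Subgroup.zpowers m ⊔ Subgroup.zpowers v, sup_le ?_ ?_,
    (isPGroup_zpowers hk).sup_of_conj (isPGroup_zpowers hvk) ?_, hmA,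
    mul_mul_mem_sup h.sq_d (hz h.sq_d ?_) (hz h.sq_d ?_),
    mul_mul_mem_sup h.sq_e (hz h.sq_e ?_) (hz h.sq_e ?_)⟩
  · exact Subgroup.zpowers_le.2 hmT
  · exact Subgroup.zpowers_le.2 (h.conj_e _ hmT)
  · rintro _ ⟨i, rfl⟩ _ ⟨j, rfl⟩
    have : Commute (m ^ i) (v ^ j) := h2.zpow_zpow i j
    change m ^ i * v ^ j * (m ^ i)⁻¹ ∈ _
    rw [this.eq, mul_inv_cancel_right]
    exact zpow_mem (Subgroup.mem_zpowers v) j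
  · rw [h.conj_eq_inv_of_mem_conjDiff hm]
    exact inv_mem hmA
  · rw [h1]
    exact mul_mem (inv_mem hmA) hvA
  · exact hvA
  · rw [hvm]
    exact hmA

theorem conjDiff_subset_of_not_dvd [Finite Γ] [Fact p.Prime] (h : TriPair p T d e) {R : Subgroup Γ}
    (hRT : R ≤ T) (hRd : ∀ x ∈ R, d * x * d ∈ R) (hR : ¬ p ∣ R.relIndex T)
    (hcard : ∃ n, Nat.card (conjOrbit T d) = p ^ n) {m : Γ} (hm : m ∈ conjDiff T d) : m ∈ R := by
  obtain ⟨n, hn⟩ := hcard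
  have h1 : Nat.card (conjOrbit T d) ∣ Nat.card (conjOrbit R d) := by
    have h2 : (R ⊓ Subgroup.centralizer {d}).relIndex (T ⊓ Subgroup.centralizer {d}) *
        Nat.card (conjOrbit T d) = Nat.card (conjOrbit R d) * R.relIndex T := by
      rw [card_conjOrbit_eq_relIndex, card_conjOrbit_eq_relIndex,
        Subgroup.relIndex_mul_relIndex _ _ _ (inf_le_inf_right _ hRT) inf_le_left,
        Subgroup.relIndex_mul_relIndex _ _ _ inf_le_left hRT]
    refine Nat.Coprime.dvd_of_dvd_mul_right ?_ (Dvd.intro_left _ h2)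
    rw [hn]
    exact Nat.Coprime.pow_left _ ((Nat.Prime.coprime_iff_not_dvd Fact.out).2 hR)
  have : Nonempty (conjOrbit R d) := ⟨⟨d, mem_conjOrbit_self R d⟩⟩
  have h3 : conjOrbit R d = conjOrbit T d :=
    Set.eq_of_subset_of_ncard_le (conjOrbit_mono hRT d) (Nat.le_of_dvd Nat.card_pos h1)
      (Set.toFinite _)
  have hdd : ∀ z, d * (d * z) = z := fun z => by rw [← mul_assoc, h.sq_d, one_mul]
  have h4 : d * m ∈ conjOrbit R d := h3 ▸ hm
  obtain ⟨g, hg, h5⟩ := h4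
  have h6 : m = d * g * d * g⁻¹ := by rw [← hdd m, ← h5]; simp only [mul_assoc]
  rw [h6]
  exact mul_mem (hRd g hg) (inv_mem hg)

theorem isPGroup_triCore_large [Finite Γ] [Fact p.Prime] (hp : Odd p) (hp3 : p ≠ 3)
    (h : TriPair p T d e) : IsPGroup p (triCore T d e) := by
  induction hT : Nat.card T using Nat.strong_induction_on generalizing T d e with
  | _ n ih =>
  subst hT
  have ih' : ∀ T' < T, ∀ d' e', TriPair p T' d' e' → IsPGroup p (triCore T' d' e') :=
    fun T' hT' d' e' h' => ih _ (Set.ncard_lt_ncard hT' (Set.toFinite _)) h' rfl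
  obtain ⟨R, ⟨hRT, hR, hRd, hRe⟩, hmax⟩ := (Set.toFinite {R : Subgroup Γ | R ≤ T ∧ IsPGroup p R ∧
    (∀ x ∈ R, d * x * d ∈ R) ∧ ∀ x ∈ R, e * x * e ∈ R}).exists_maximal
      ⟨⊥, bot_le, IsPGroup.of_bot, by simp [h.sq_d], by simp [h.sq_e]⟩
  by_cases hdvd : p ∣ R.relIndex T
  swap
  · exact hR.to_le (h.triCore_le_of hRd
      (fun m => h.conjDiff_subset_of_not_dvd hRT hRd hdvd (h.card_conjOrbit_eq_pow hp hp3 ih'))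
      fun m => h.symm.conjDiff_subset_of_not_dvd hRT hRe hdvd
        (h.symm.card_conjOrbit_eq_pow hp hp3 ih'))
  by_cases hnorm : ∀ g ∈ T, ∀ x ∈ R, g * x * g⁻¹ ∈ R
  · have key : ∀ A ≤ T, IsPGroup p A → (∀ x ∈ A, d * x * d ∈ A) → (∀ x ∈ A, e * x * e ∈ A) →
        A ≤ R := fun A hAT hA hAd hAe =>
      le_sup_left.trans (hmax (y := A ⊔ R) ⟨sup_le hAT hRT,
        hA.sup_of_conj hR fun g hg => hnorm g (hAT hg),
        mul_mul_mem_sup h.sq_d (fun x hx => Subgroup.mem_sup_left (hAd x hx))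
          fun x hx => Subgroup.mem_sup_right (hRd x hx),
        mul_mul_mem_sup h.sq_e (fun x hx => Subgroup.mem_sup_left (hAe x hx))
          fun x hx => Subgroup.mem_sup_right (hRe x hx)⟩ le_sup_right)
    refine hR.to_le (h.triCore_le_of hRd (fun m hm => ?_) fun m hm => ?_)
    · obtain ⟨A, hAT, hA, hmA, hAd, hAe⟩ := h.exists_isPGroup_of_mem_conjDiff' hm
      exact key A hAT hA hAd hAe hmA
    · obtain ⟨A, hAT, hA, hmA, hAe, hAd⟩ := h.symm.exists_isPGroup_of_mem_conjDiff' hm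
      exact key A hAT hA hAd hAe hmA
  obtain ⟨P, hRP, hPT, hP, hPn⟩ := hR.exists_ge_not_dvd_relIndex hRT
  obtain ⟨g, hgP, hgR, hg⟩ := hP.exists_mem_normalizer
    (hRP.lt_of_ne (by rintro rfl; exact hPn hdvd))
  have hdN := mem_normalizer_of_mul_self h.sq_d hRd
  have heN := mem_normalizer_of_mul_self h.sq_e hRe
  have h1 : TriPair p (T ⊓ Subgroup.normalizer (R : Set Γ)) d e := h.mono inf_le_left
    (fun x hx => ⟨h.conj_d x hx.1, mul_mem (mul_mem hdN hx.2) hdN⟩)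
    (fun x hx => ⟨h.conj_e x hx.1, mul_mem (mul_mem heN hx.2) heN⟩)
  have hlt : T ⊓ Subgroup.normalizer (R : Set Γ) < T :=
    inf_le_left.lt_of_ne fun heq => hnorm (le_normalizer_iff.1 (inf_eq_left.1 heq))
  have hN := ih' _ hlt d e h1
  have hgg := mem_of_mem_zpowers_conj hg
  have hR1 : IsPGroup p (Subgroup.zpowers g ⊔ R : Subgroup Γ) :=
    (hP.to_le (Subgroup.zpowers_le.2 hgP)).sup_of_conj hR hgg
  have hR1T : Subgroup.zpowers g ⊔ R ≤ T ⊓ Subgroup.normalizer (R : Set Γ) :=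
    sup_le (le_inf (Subgroup.zpowers_le.2 (hPT hgP)) (le_normalizer_iff.2 hgg))
      (le_inf hRT Subgroup.le_normalizer)
  have hmem : ∀ {a : Γ}, a * a = 1 → conjOrbit (T ⊓ Subgroup.normalizer (R : Set Γ)) a *
      conjOrbit (T ⊓ Subgroup.normalizer (R : Set Γ)) a ⊆
        (triCore (T ⊓ Subgroup.normalizer (R : Set Γ)) d e : Set Γ) →
      ∀ x ∈ Subgroup.zpowers g ⊔ R, a * x * a ∈ Subgroup.zpowers g ⊔ R ⊔
        triCore (T ⊓ Subgroup.normalizer (R : Set Γ)) d e := by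
    intro a ha hsub x hx
    have h2 : x⁻¹ * a * x⁻¹⁻¹ * a ∈ triCore (T ⊓ Subgroup.normalizer (R : Set Γ)) d e :=
      hsub ⟨_, ⟨x⁻¹, inv_mem (hR1T hx), rfl⟩, a, mem_conjOrbit_self _ _, rfl⟩
    have h3 : a * x * a = x * (x⁻¹ * a * x⁻¹⁻¹ * a) := by group
    rw [h3]
    exact mul_mem (Subgroup.mem_sup_left hx) (Subgroup.mem_sup_right h2)
  have hd' : d⁻¹ = d := inv_eq_of_mul_eq_one_right h.sq_d
  have he' : e⁻¹ = e := inv_eq_of_mul_eq_one_right h.sq_e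
  refine (hgR (hmax (y := Subgroup.zpowers g ⊔ R ⊔ triCore _ d e)
    ⟨sup_le (hR1T.trans inf_le_left) (h1.triCore_le.trans inf_le_left),
      hR1.sup_of_conj hN fun s hs => conj_triCore_mem (hR1T hs),
      mul_mul_mem_sup h.sq_d (hmem h.sq_d ?_) fun x hx => Subgroup.mem_sup_right ?_,
      mul_mul_mem_sup h.sq_e (hmem h.sq_e ?_) fun x hx => Subgroup.mem_sup_right ?_⟩
    (le_sup_right.trans le_sup_left)
    (Subgroup.mem_sup_left (Subgroup.mem_sup_left (Subgroup.mem_zpowers g))))).elim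
  · exact fun z hz => Subgroup.subset_closure (Or.inl (Or.inl hz))
  · simpa only [hd'] using h1.conj_d_triCore_mem x hx
  · exact fun z hz => Subgroup.subset_closure (Or.inl (Or.inr hz))
  · simpa only [he'] using h1.conj_e_triCore_mem x hx

theorem isPGroup_triCore [Finite Γ] [Fact p.Prime] (h : TriPair p T d e) :
    IsPGroup p (triCore T d e) := by
  rcases eq_or_ne p 2 with rfl | hp2
  · exact h.isPGroup_triCore_two
  rcases eq_or_ne p 3 with rfl | hp3
  · exact h.isPGroup_triCore_three
  exact h.isPGroup_triCore_large (Nat.Prime.odd_of_ne_two Fact.out hp2) hp3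

end TriPair

end Large

section Finiteness

variable {G : Type*} [Group G]

theorem finiteIndex_centralizer_of_finite_conj {s : G}
    (hs : {y | ∃ g : G, g * s * g⁻¹ = y}.Finite) :
    (Subgroup.centralizer {s}).FiniteIndex := by
  rw [Subgroup.finiteIndex_iff_finite_quotient]
  have := hs.to_subtype
  refine Finite.of_injective (fun q : G ⧸ Subgroup.centralizer {s} =>
    (⟨q.out * s * q.out⁻¹, q.out, rfl⟩ : {y | ∃ g : G, g * s * g⁻¹ = y})) fun a b hab => ?_
  have h1 : a.out * s * a.out⁻¹ = b.out * s * b.out⁻¹ := congrArg Subtype.val hab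
  rw [← a.out_eq', ← b.out_eq']
  refine QuotientGroup.eq.2 (mem_centralizer_singleton.2 ?_)
  calc (a.out)⁻¹ * b.out * s * ((a.out)⁻¹ * b.out)⁻¹
      = (a.out)⁻¹ * (b.out * s * (b.out)⁻¹) * a.out := by group
    _ = s := by rw [← h1]; group

theorem finite_commutatorSet_of_finiteIndex_center [(Subgroup.center G).FiniteIndex] :
    Finite (commutatorSet G) := by
  let f : (G ⧸ Subgroup.center G) × (G ⧸ Subgroup.center G) → G := fun q =>
    q.1.out * q.2.out * q.1.out⁻¹ * q.2.out⁻¹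
  refine ((Set.finite_range f).subset ?_).to_subtype
  rintro _ ⟨a, b, rfl⟩
  refine ⟨(a, b), ?_⟩
  obtain ⟨⟨z, hz⟩, hz'⟩ := QuotientGroup.mk_out_eq_mul (Subgroup.center G) a
  obtain ⟨⟨w, hw⟩, hw'⟩ := QuotientGroup.mk_out_eq_mul (Subgroup.center G) b
  have h1 : ∀ g, Commute g z := fun g => Subgroup.mem_center_iff.1 hz g
  have h2 : Commute a⁻¹ w := Subgroup.mem_center_iff.1 hw a⁻¹
  simp only [f]
  rw [hz', hw', commutatorElement_def]
  calc a * z * (b * w) * (a * z)⁻¹ * (b * w)⁻¹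
      = a * (z * (b * w) * z⁻¹) * a⁻¹ * w⁻¹ * b⁻¹ := by group
    _ = a * b * (w * a⁻¹) * w⁻¹ * b⁻¹ := by
      rw [← (h1 (b * w)).eq, mul_inv_cancel_right]
      simp only [mul_assoc]
    _ = a * b * a⁻¹ * b⁻¹ := by
      rw [← h2.eq, mul_assoc (a * b), mul_assoc a⁻¹, mul_inv_cancel, mul_one]

/-- A group generated by finitely many elements, each of finite order and with finitely many
conjugates, is finite. -/
theorem finite_of_closure_eq_top {S : Set G} (hS : S.Finite) (htop : Subgroup.closure S = ⊤)
    (hord : ∀ s ∈ S, IsOfFinOrder s) (hconj : ∀ s ∈ S, {y | ∃ g : G, g * s * g⁻¹ = y}.Finite) :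
    Finite G := by
  have := hS.to_subtype
  have : (Subgroup.center G).FiniteIndex := by
    rw [Subgroup.center_eq_infi' htop]
    exact Subgroup.finiteIndex_iInf fun s => finiteIndex_centralizer_of_finite_conj (hconj s s.2)
  have := finite_commutatorSet_of_finiteIndex_center (G := G)
  have : Group.FG G := Group.fg_iff.2 ⟨S, htop, hS⟩
  have hab : Finite (Abelianization G) := by
    have : Group.FG (Abelianization G) :=
      Group.fg_of_surjective (f := Abelianization.of) QuotientGroup.mk_surjective
    refine CommGroup.finite_of_fg_isMulTorsion _ ?_
    rw [← CommGroup.torsion_eq_top_iff, eq_top_iff]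
    have h1 : Subgroup.closure S ≤
        (CommGroup.torsion (Abelianization G)).comap Abelianization.of :=
      (Subgroup.closure_le _).2 fun s hs => MonoidHom.isOfFinOrder _ (hord s hs)
    rintro x -
    obtain ⟨g, rfl⟩ := QuotientGroup.mk_surjective x
    exact h1 (htop.ge (Subgroup.mem_top g))
  have : Finite (G ⧸ commutator G) := hab
  exact Finite.of_equiv _ (Subgroup.groupEquivQuotientProdSubgroup (s := commutator G)).symm

end Finiteness

section Triality

variable {G : Type*} [Group G]

/-- The automorphisms of `G` all of whose commutators lie in `K`. -/
def commutatorMem (K : Subgroup G) : Subgroup (MulAut G) where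
  carrier := {α | ∀ x, x⁻¹ * α x ∈ K}
  one_mem' := fun x => by simp
  mul_mem' := fun {α β} hα hβ x => by
    have := mul_mem (hβ x) (hα (β x))
    rwa [mul_assoc, mul_inv_cancel_left] at this
  inv_mem' := fun {α} hα x => by
    have := inv_mem (hα (α⁻¹ x))
    rwa [MulAut.apply_inv_self, mul_inv_rev, inv_inv] at this

theorem commSG_le_of {ρ σ : MulAut G} {K : Subgroup G} (h1 : ∀ x, x⁻¹ * σ x ∈ K)
    (h2 : ∀ x, x⁻¹ * (σ * ρ) x ∈ K) : commSG ρ σ ⊤ ≤ K := by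
  have hσ : σ ∈ commutatorMem K := h1
  have hσρ : σ * ρ ∈ commutatorMem K := h2
  have hle : STri ρ σ ≤ commutatorMem K := (Subgroup.closure_le _).2 <| by
    rintro _ (rfl | rfl)
    · have := mul_mem (inv_mem hσ) hσρ
      rwa [inv_mul_cancel_left] at this
    · exact hσ
  refine (Subgroup.closure_le _).2 ?_
  rintro _ ⟨x, -, α, hα, rfl⟩
  exact hle hα x

theorem MSet_mul_eq_image {ρ σ : MulAut G} (h : IsTriality ρ σ) :
    MSet (σ * ρ) = ρ '' MSet σ := by
  obtain ⟨h3, h2, hρσ, -⟩ := h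
  have hconj : σ * ρ = ρ * σ * ρ⁻¹ := by
    rw [pow_two] at h2 hρσ
    have h4 : σ * ρ = ρ⁻¹ * σ := by
      rw [eq_inv_mul_iff_mul_eq, ← mul_left_inj σ, h2]
      simpa only [mul_assoc] using hρσ
    have h5 : ρ⁻¹ = ρ * ρ := inv_eq_of_mul_eq_one_right (by rw [← h3, pow_succ', pow_two])
    have h6 : σ * ρ⁻¹ = ρ * σ := by
      rw [mul_inv_eq_iff_eq_mul, mul_assoc, h4, mul_inv_cancel_left]
    rw [h4, mul_assoc, h6, h5, mul_assoc]
  rw [hconj]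
  refine Set.Subset.antisymm ?_ ?_
  · rintro _ ⟨x, rfl⟩
    exact ⟨_, ⟨ρ⁻¹ x, rfl⟩, by simp⟩
  · rintro _ ⟨_, ⟨x, rfl⟩, rfl⟩
    exact ⟨ρ x, by simp⟩

theorem finite_conj_of_finite_MSet {α : MulAut G} (hα : (MSet α).Finite) {m : G} (hm : m ∈ MSet α) :
    {y | ∃ g : G, g * m * g⁻¹ = y}.Finite := by
  refine (Set.Finite.mul hα hα.inv).subset ?_
  rintro _ ⟨g, rfl⟩
  obtain ⟨x, rfl⟩ := hm
  refine ⟨_, ⟨x * g⁻¹, rfl⟩, _, Set.inv_mem_inv.2 ⟨g⁻¹, rfl⟩, ?_⟩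
  simp [mul_assoc]

end Triality

section Assembly

variable {G : Type*} [Group G] {ρ σ : MulAut G} {p : ℕ}

theorem finite_of_isTriality (hp : p.Prime) (h : IsTriality ρ σ) (hfin : (MSet σ).Finite)
    (hord : ∀ m ∈ MSet σ, ∃ k : ℕ, orderOf m = p ^ k) (hGS : commSG ρ σ ⊤ = ⊤) : Finite G := by
  have hfin' : (MSet (σ * ρ)).Finite := MSet_mul_eq_image h ▸ hfin.image ρ
  have hord' : ∀ m ∈ MSet σ, IsOfFinOrder m := fun m hm => by
    obtain ⟨k, hk⟩ := hord m hm
    exact orderOf_pos_iff.1 (hk ▸ pow_pos hp.pos k)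
  refine finite_of_closure_eq_top (hfin.union hfin') (top_le_iff.1 (hGS.ge.trans (commSG_le_of
    (fun x => Subgroup.subset_closure (Or.inl ⟨x, rfl⟩))
    fun x => Subgroup.subset_closure (Or.inr ⟨x, rfl⟩)))) ?_ ?_
  · rintro m (hm | hm)
    · exact hord' m hm
    · rw [MSet_mul_eq_image h] at hm
      obtain ⟨m, hm, rfl⟩ := hm
      exact MonoidHom.isOfFinOrder (ρ : G →* G) (hord' m hm)
  · rintro m (hm | hm)
    · exact finite_conj_of_finite_MSet hfin hm
    · exact finite_conj_of_finite_MSet hfin' hm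

open SemidirectProduct in
theorem triPair_of_isTriality (h : IsTriality ρ σ)
    (hord : ∀ m ∈ MSet σ, ∃ k : ℕ, orderOf m = p ^ k) :
    TriPair p (inl (φ := MonoidHom.id (MulAut G))).range (inr σ) (inr (σ * ρ)) := by
  obtain ⟨h3, h2, hρσ, htri⟩ := h
  rw [pow_two] at h2 hρσ
  have he : σ * ρ * (σ * ρ) = 1 := by
    rw [← conj_eq_one_iff (a := ρ)]
    rw [← hρσ]
    group
  have hconj : ∀ α : MulAut G, α * α = 1 →
      ∀ g ∈ (inl (φ := MonoidHom.id (MulAut G))).range,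
        (inr α : G ⋊[MonoidHom.id _] MulAut G) * g * inr α ∈
          (inl (φ := MonoidHom.id (MulAut G))).range := by
    rintro α hα _ ⟨x, rfl⟩
    refine ⟨α x, ?_⟩
    have := inl_aut (φ := MonoidHom.id (MulAut G)) α x
    rwa [inv_eq_of_mul_eq_one_right hα] at this
  have hinl : ∀ x : G, (inl x * inr σ * (inl x)⁻¹ * inr σ : G ⋊[MonoidHom.id _] MulAut G) =
      inl (x⁻¹⁻¹ * σ x⁻¹) := fun x => by
    have := inl_aut (φ := MonoidHom.id (MulAut G)) σ x⁻¹
    rw [inv_eq_of_mul_eq_one_right h2] at this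
    rw [map_mul, inv_inv, ← map_inv, mul_assoc, mul_assoc, ← mul_assoc (inr σ)]
    exact congrArg _ this.symm
  refine ⟨by rw [← map_mul, h2, map_one], by rw [← map_mul, he, map_one], hconj σ h2,
    hconj _ he, ?_, ?_⟩
  · rintro _ ⟨x, rfl⟩
    rw [map_mul, ← mul_assoc, hinl]
    have htri := htri x⁻¹
    generalize x⁻¹⁻¹ * σ x⁻¹ = m at htri ⊢
    have hρ := inl_aut (φ := MonoidHom.id (MulAut G)) ρ
    calc (inl m * inr ρ : G ⋊[MonoidHom.id _] MulAut G) ^ 3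
        = inl m * (inr ρ * inl m * inr ρ⁻¹) * (inr ρ * (inr ρ * inl m * inr ρ⁻¹) * inr ρ⁻¹) *
            inr (ρ ^ 3) := by
          simp only [map_inv, map_mul, pow_succ, pow_zero, one_mul]
          group
      _ = inl (m * ρ m * ρ (ρ m)) * inr (ρ ^ 3) := by
          rw [map_mul, map_mul, ← hρ, ← hρ]
          rfl
      _ = 1 := by rw [htri, h3, map_one, map_one, mul_one]
  · rintro _ ⟨x, rfl⟩
    obtain ⟨k, hk⟩ := hord _ ⟨x⁻¹, rfl⟩
    exact ⟨k, by rw [hinl, ← map_pow, ← hk, pow_orderOf_eq_one, map_one]⟩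

open SemidirectProduct in
theorem isPGroup_of_isTriality [Finite G] [Fact p.Prime] (h : IsTriality ρ σ)
    (hord : ∀ m ∈ MSet σ, ∃ k : ℕ, orderOf m = p ^ k) (hGS : commSG ρ σ ⊤ = ⊤) :
    IsPGroup p G := by
  have : Finite (MulAut G) := Finite.of_injective (fun f : MulAut G => (f : G → G))
    DFunLike.coe_injective
  have : Finite (G ⋊[MonoidHom.id (MulAut G)] MulAut G) := Finite.of_equiv _ equivProd.symm
  have hT := triPair_of_isTriality h hord
  set K := triCore (inl (φ := MonoidHom.id (MulAut G))).range (inr σ) (inr (σ * ρ)) with hK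
  have hinl : ∀ (α : MulAut G), (inr α * inr α : G ⋊[MonoidHom.id _] MulAut G) = 1 → ∀ x : G,
      (inl (x⁻¹ * α x) : G ⋊[MonoidHom.id _] MulAut G) ∈
        conjOrbit (inl (φ := MonoidHom.id (MulAut G))).range (inr α) *
          conjOrbit (inl (φ := MonoidHom.id (MulAut G))).range (inr α) := fun α hα x => by
    refine ⟨_, ⟨inl x⁻¹, ⟨_, rfl⟩, rfl⟩, inr α, mem_conjOrbit_self _ _, ?_⟩
    have := inl_aut (φ := MonoidHom.id (MulAut G)) α x
    rw [map_inv, inv_eq_of_mul_eq_one_right hα] at this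
    rw [map_mul, map_inv, inv_inv]
    simp only [mul_assoc] at this ⊢
    exact congrArg _ this.symm
  have htop : (⊤ : Subgroup G) ≤ K.comap inl := hGS.ge.trans <| commSG_le_of
    (fun x => Subgroup.subset_closure (Or.inl (Or.inl (hinl _ hT.sq_d x))))
    fun x => Subgroup.subset_closure (Or.inl (Or.inr (hinl _ hT.sq_e x)))
  intro g
  obtain ⟨k, hk⟩ := hT.isPGroup_triCore ⟨inl g, htop (Subgroup.mem_top g)⟩
  exact ⟨k, inl_injective (by simpa using congrArg Subtype.val hk)⟩

end Assembly

/-- If `G` is a group with triality `S` such that the Moufang loop `M(G)` is a finite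
`p`-loop and `[G, S] = G`, then `G` is a finite `p`-group. -/
theorem p_group_of_p_loop {G : Type} [Group G] (p : ℕ) (hp : p.Prime) (ρ σ : MulAut G)
    (h : IsTriality ρ σ) (hfin : (MSet σ).Finite)
    (hord : ∀ m ∈ MSet σ, ∃ k : ℕ, orderOf m = p ^ k)
    (hGS : commSG ρ σ ⊤ = ⊤) :
    Finite G ∧ IsPGroup p G := by
  have := Fact.mk hp
  have := finite_of_isTriality hp h hfin hord hGS
  exact ⟨this, isPGroup_of_isTriality h hord hGS⟩
end

section
/- Let G be a finite group with triality S = ⟨ρ, σ⟩, let p be a prime, and let P be an S-invariant p-Sylow subgroup of G. Then M(P) is a p-Sylow subloop of the Moufang loop M(G). -/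
open Pointwise

/-- A Moufang loop: a loop (binary operation with two-sided identity in which the equations
`a * x = b` and `y * a = b` have unique solutions) satisfying the Moufang identity. -/
class MoufangLoop (M : Type*) extends Mul M, One M where
  one_mul : ∀ a : M, 1 * a = a
  mul_one : ∀ a : M, a * 1 = a
  existsUnique_mul_left : ∀ a b : M, ∃! x : M, a * x = b
  existsUnique_mul_right : ∀ a b : M, ∃! y : M, y * a = b
  moufang : ∀ x y z : M, (x * y) * (z * x) = (x * (y * z)) * x

namespace MoufangLoop

variable {M : Type*} [MoufangLoop M]

/-- The unique solution `x` of `a * x = b` (left division). -/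
noncomputable def lsol (a b : M) : M := (existsUnique_mul_left a b).exists.choose

/-- The unique solution `y` of `y * a = b` (right division). -/
noncomputable def rsol (a b : M) : M := (existsUnique_mul_right a b).exists.choose

theorem mul_lsol (a b : M) : a * lsol a b = b := (existsUnique_mul_left a b).exists.choose_spec

theorem rsol_mul (a b : M) : rsol a b * a = b := (existsUnique_mul_right a b).exists.choose_spec

/-- A subloop: a subset closed under the loop operations (multiplication and the
two divisions; in particular it contains the identity). -/
def IsSubloopSet (A : Set M) : Prop :=
  (1 : M) ∈ A ∧ (∀ x ∈ A, ∀ y ∈ A, x * y ∈ A) ∧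
    (∀ x ∈ A, ∀ y ∈ A, lsol x y ∈ A) ∧ ∀ x ∈ A, ∀ y ∈ A, rsol x y ∈ A

/-- `B` is a normal subloop of the (sub)loop `A`:  `B ⊆ A` and, for all `x, y ∈ A`,
`B*x = x*B`, `B*(x*y) = (B*x)*y` and `(x*B)*y = x*(B*y)` (as subsets). -/
def IsNormalIn (B A : Set M) : Prop :=
  B ⊆ A ∧ (∀ x ∈ A, B * ({x} : Set M) = ({x} : Set M) * B) ∧
    (∀ x ∈ A, ∀ y ∈ A, B * ({x * y} : Set M) = B * ({x} : Set M) * ({y} : Set M)) ∧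
    ∀ x ∈ A, ∀ y ∈ A, ({x} : Set M) * B * ({y} : Set M) = ({x} : Set M) * (B * ({y} : Set M))

/-- A composition series of the subloop `A` of `M`: a strictly decreasing chain of
subloops from `A` to `{1}`, each normal in the preceding one, such that each step is
a maximal normal subloop of the preceding one (equivalently, by the correspondence
theorem, each factor is a simple loop). -/
structure CompSeriesOn (M : Type*) [MoufangLoop M] (A : Set M) where
  n : ℕ
  c : Fin (n + 1) → Set M
  subloop : ∀ i, IsSubloopSet (c i)
  first : c 0 = A
  last : c (Fin.last n) = {1}
  normal : ∀ i : Fin n, IsNormalIn (c i.succ) (c i.castSucc)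
  proper : ∀ i : Fin n, c i.succ ≠ c i.castSucc
  maximal : ∀ i : Fin n, ∀ D : Set M, IsSubloopSet D → IsNormalIn D (c i.castSucc) →
    c i.succ ⊆ D → D = c i.succ ∨ D = c i.castSucc

/-- A composition series of the loop `M` itself. -/
abbrev CompSeries (M : Type*) [MoufangLoop M] := CompSeriesOn M Set.univ

/-- `f` realizes `Q` as the quotient of the subloop `A` of `M` by its normal subloop `B`:
on `A`, `f` is multiplicative, maps onto `Q`, and its fibres are exactly the cosets of `B`.
Thus `Q` is isomorphic to the factor loop `A/B`. -/
def IsFactorMap {Q : Type*} [Mul Q] (A B : Set M) (f : M → Q) : Prop :=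
  (∀ x ∈ A, ∀ y ∈ A, f (x * y) = f x * f y) ∧ (∀ q : Q, ∃ x ∈ A, f x = q) ∧
    ∀ x ∈ A, ∀ y ∈ A, (f x = f y ↔ x ∈ ({y} : Set M) * B)

/-- A `p`-Sylow subloop: a subloop of order `p ^ k` where `p ^ k` is the largest power
of `p` dividing the order of `M`. -/
def IsPSylowSubloop (p : ℕ) (A : Set M) : Prop :=
  IsSubloopSet A ∧ Nat.card A = p ^ ((Nat.card M).factorization p)

end MoufangLoop

namespace MoufangLoop

variable {M : Type*} [MoufangLoop M]

theorem mul_right_inj_of_loop {a x y : M} (h : a * x = a * y) : x = y :=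
  (existsUnique_mul_left a (a * y)).unique h rfl

theorem mul_left_inj_of_loop {a x y : M} (h : x * a = y * a) : x = y :=
  (existsUnique_mul_right a (y * a)).unique h rfl

/-- A finite multiplicatively closed subset containing the identity is a subloop. -/
theorem isSubloopSet_of_mul_mem [Finite M] {A : Set M} (one_mem : (1 : M) ∈ A)
    (mul_mem : ∀ x ∈ A, ∀ y ∈ A, x * y ∈ A) : IsSubloopSet A := by
  refine ⟨one_mem, mul_mem, fun x hx y hy => ?_, fun x hx y hy => ?_⟩
  · have hinj : Function.Injective (fun a : A => (⟨x * a, mul_mem x hx a a.2⟩ : A)) :=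
      fun a b hab => Subtype.ext (mul_right_inj_of_loop (congrArg Subtype.val hab))
    obtain ⟨a, ha⟩ := Finite.surjective_of_injective hinj ⟨y, hy⟩
    have : x * lsol x y = x * a := (mul_lsol x y).trans (congrArg Subtype.val ha).symm
    rw [mul_right_inj_of_loop this]
    exact a.2
  · have hinj : Function.Injective (fun a : A => (⟨a * x, mul_mem a a.2 x hx⟩ : A)) :=
      fun a b hab => Subtype.ext (mul_left_inj_of_loop (congrArg Subtype.val hab))
    obtain ⟨a, ha⟩ := Finite.surjective_of_injective hinj ⟨y, hy⟩
    have : rsol x y * x = a * x := (rsol_mul x y).trans (congrArg Subtype.val ha).symm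
    rw [mul_left_inj_of_loop this]
    exact a.2

end MoufangLoop

/-- The twisted conjugation action `g • m = g · m · (σ g)⁻¹` of `G` on `M(G)`. -/
abbrev twistedAction {G : Type*} [Group G] (σ : MulAut G) : MulAction G (MSet σ) where
  smul g m := ⟨g * m * (σ g)⁻¹, by
    obtain ⟨x, hx⟩ := m.2
    exact ⟨x * g⁻¹, by rw [hx]; simp [mul_assoc]⟩⟩
  one_smul m := Subtype.ext (by change 1 * (m : G) * (σ 1)⁻¹ = m; simp)
  mul_smul a b m := Subtype.ext (by
    change a * b * (m : G) * (σ (a * b))⁻¹ = a * (b * m * (σ b)⁻¹) * (σ a)⁻¹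
    simp [mul_assoc])

/-- If every orbit of a finite `p`-group on `X` is at least as large as the orbit of `a`, then
the size of the orbit of `a` divides the size of `X`. -/
theorem IsPGroup.card_orbit_dvd_card {p : ℕ} {P X : Type*} [Group P] [Finite P] [MulAction P X]
    [Finite X] (hp : p.Prime) (hP : IsPGroup p P) (a : X)
    (hle : ∀ b : X, Nat.card (MulAction.orbit P a) ≤ Nat.card (MulAction.orbit P b)) :
    Nat.card (MulAction.orbit P a) ∣ Nat.card X := by
  have : Fact p.Prime := ⟨hp⟩
  classical
  have := Fintype.ofFinite (MulAction.orbitRel.Quotient P X)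
  rw [Nat.card_congr (MulAction.selfEquivSigmaOrbits P X), Nat.card_sigma]
  refine Finset.dvd_sum fun ω _ => ?_
  obtain ⟨m, hm⟩ := hP.card_orbit a
  obtain ⟨n, hn⟩ := hP.card_orbit ω.out
  have := hle ω.out
  rw [hm, hn] at this ⊢
  exact pow_dvd_pow p ((Nat.pow_le_pow_iff_right hp.one_lt).mp this)

/-- For a transitive action, the `p`-part of the size of the set divides the size of every
orbit of a Sylow `p`-subgroup. -/
theorem Sylow.ordProj_card_dvd_card_orbit {p : ℕ} {G X : Type*} [Group G] [Finite G]
    [MulAction G X] [MulAction.IsPretransitive G X] (hp : p.Prime) (P : Sylow p G) (a : X) :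
    p ^ (Nat.card X).factorization p ∣ Nat.card (MulAction.orbit P a) := by
  have : Fact p.Prime := ⟨hp⟩
  have hG : Nat.card X * Nat.card (MulAction.stabilizer G a) = Nat.card G := by
    rw [← MulAction.index_stabilizer_of_transitive G a, Subgroup.index_mul_card]
  have hP : Nat.card (MulAction.orbit P a) * Nat.card (MulAction.stabilizer P a) =
      p ^ (Nat.card G).factorization p := by
    rw [← Sylow.card_eq_multiplicity P, ← Subgroup.index_mul_card (MulAction.stabilizer P a),
      MulAction.index_stabilizer]
    rfl
  have hdvd : Nat.card (MulAction.stabilizer P a) ∣ Nat.card (MulAction.stabilizer G a) :=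
    Subgroup.card_dvd_of_injective
      (((P : Subgroup G).subtype.comp (MulAction.stabilizer P a).subtype).codRestrict
        (MulAction.stabilizer G a) fun g => g.2)
      fun x y hxy => by
        have hval := congrArg Subtype.val hxy
        exact Subtype.ext (Subtype.ext hval)
  obtain ⟨k, -, hk⟩ := (Nat.dvd_prime_pow hp).mp (Dvd.intro _ hP)
  obtain ⟨j, -, hj⟩ := (Nat.dvd_prime_pow hp).mp (Dvd.intro_left _ hP)
  have hG0 : Nat.card X * Nat.card (MulAction.stabilizer G a) ≠ 0 := hG ▸ Nat.card_pos.ne'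
  have hjle : j ≤ (Nat.card (MulAction.stabilizer G a)).factorization p :=
    (hp.pow_dvd_iff_le_factorization (right_ne_zero_of_mul hG0)).mp (hj ▸ hdvd)
  rw [hk, hj, ← pow_add, ← hG,
    Nat.factorization_mul (left_ne_zero_of_mul hG0) (right_ne_zero_of_mul hG0)] at hP
  have hsum := Nat.pow_right_injective hp.two_le hP
  rw [Finsupp.add_apply] at hsum
  rw [hk]
  exact pow_dvd_pow p (by lia)

/-- If `P` is an `S`-invariant `p`-Sylow subgroup of a finite group with triality `G`,
then `M(P)` is a `p`-Sylow subloop of the Moufang loop `M(G)`. -/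
theorem loop_of_invariant_sylow_is_sylow {G : Type} [Group G] [Finite G] (p : ℕ)
    (hp : p.Prime) (ρ σ : MulAut G) (h : IsTriality ρ σ)
    [instL : MoufangLoop ↥(MSet σ)]
    (hone : ((1 : ↥(MSet σ)) : G) = 1)
    (hmul : ∀ m n : ↥(MSet σ),
      ((m * n : ↥(MSet σ)) : G) = ρ ((m : G)⁻¹) * (n : G) * ρ (ρ ((m : G)⁻¹)))
    (P : Sylow p G) (hSP : SInvariant ρ σ (P : Subgroup G)) :
    MoufangLoop.IsPSylowSubloop p
      {m : ↥(MSet σ) | ∃ x ∈ (P : Subgroup G), (m : G) = x⁻¹ * σ x} := by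
  let _ := twistedAction σ
  have hsmul (g : G) (m : MSet σ) : ((g • m : MSet σ) : G) = g * m * (σ g)⁻¹ := rfl
  have hsmulP (g : P) (m : MSet σ) : g • m = (g : G) • m := rfl
  have hmul_smul (m n : MSet σ) : m * n = ρ (m : G)⁻¹ • n := by
    obtain ⟨hρ, hσ, hρσ, -⟩ := h
    have hσ' (x : G) : σ (σ x) = x := by simpa [pow_two] using DFunLike.congr_fun hσ x
    have hρσ' (x : G) : ρ (σ (ρ (σ x))) = x := by
      simpa [pow_two] using DFunLike.congr_fun hρσ x
    have hinv : σ (m : G) = (m : G)⁻¹ := by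
      obtain ⟨x, hx⟩ := m.2
      rw [hx]
      simp [hσ']
    have hρ3 (x : G) : ρ (ρ (ρ x)) = x := by
      simpa [pow_succ] using DFunLike.congr_fun hρ x
    have hcomm : σ (ρ (m : G)) = ρ (ρ (m : G)⁻¹) := by
      apply ρ.injective
      rw [hρ3, ← hinv, ← hρσ' (σ m), hσ']
    apply Subtype.ext
    rw [hmul, hsmul, map_inv ρ (m : G), map_inv σ, inv_inv, hcomm, map_inv ρ (m : G)]
  have : MulAction.IsPretransitive G (MSet σ) := by
    refine (MulAction.isPretransitive_iff_base (1 : MSet σ)).mpr fun m => ?_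
    obtain ⟨x, hx⟩ := m.2
    exact ⟨x⁻¹, Subtype.ext (by simp [hsmul, hone, hx])⟩
  have horbit : {m : ↥(MSet σ) | ∃ x ∈ (P : Subgroup G), (m : G) = x⁻¹ * σ x} =
      MulAction.orbit P (1 : MSet σ) := by
    ext m
    constructor
    · rintro ⟨x, hxP, hx⟩
      exact ⟨⟨x, hxP⟩⁻¹, Subtype.ext (by simp [hsmulP, hsmul, hone, hx])⟩
    · rintro ⟨g, rfl⟩
      exact ⟨(g : G)⁻¹, inv_mem g.2, by simp [hsmulP, hsmul, hone]⟩
  have hmul_orbit (m : MSet σ) (hm : m ∈ MulAction.orbit P (1 : MSet σ)) (n : MSet σ) :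
      m * n ∈ MulAction.orbit P n := by
    have hmP : (m : G) ∈ (P : Subgroup G) := by
      obtain ⟨x, hxP, hx⟩ := horbit ▸ hm
      exact hx ▸ mul_mem (inv_mem hxP) ((hSP.2 x).mpr hxP)
    exact ⟨⟨ρ (m : G)⁻¹, (hSP.1 _).mpr (inv_mem hmP)⟩, (hmul_smul m n).symm⟩
  have hle (n : MSet σ) :
      Nat.card (MulAction.orbit P (1 : MSet σ)) ≤ Nat.card (MulAction.orbit P n) :=
    Nat.card_le_card_of_injective (fun m => ⟨m * n, hmul_orbit m m.2 n⟩) fun _ _ hab =>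
      Subtype.ext (MoufangLoop.mul_left_inj_of_loop (congrArg Subtype.val hab))
  rw [horbit]
  refine ⟨MoufangLoop.isSubloopSet_of_mul_mem (MulAction.mem_orbit_self 1) fun m hm n hn => ?_, ?_⟩
  · exact MulAction.orbit_eq_iff.mpr hn ▸ hmul_orbit m hm n
  · refine Nat.dvd_antisymm ?_ (P.ordProj_card_dvd_card_orbit hp 1)
    have hdvd := P.isPGroup'.card_orbit_dvd_card hp (1 : MSet σ) hle
    have : Fact p.Prime := ⟨hp⟩
    obtain ⟨k, hk⟩ := P.isPGroup'.card_orbit (1 : MSet σ)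
    rw [hk] at hdvd ⊢
    have : Nonempty (MSet σ) := ⟨1⟩
    exact pow_dvd_pow p ((hp.pow_dvd_iff_le_factorization Nat.card_pos.ne').mp hdvd)
end
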